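/- Let S be a compact surface with nonempty boundary, and let I ⊊ ∂S be a closed subset properly contained in the boundary. Then there exist a subspace Γ ⊆ S that is a finite graph and a deformation retraction H : S×[0,1] → S of S onto Γ (so H(x,0)=x for all x, H(S×{1}) ⊆ Γ, and H(a,1)=a for a ∈ Γ) satisfying H(x,t) = x for all x ∈ I and all t ∈ [0,1]. -/

import Mathlib

open Set Topology unitInterval

noncomputable section

/-- A map is proper-continuous: continuous and the preimage of every compact set is compact. -/
def ProperCont {X Y : Type*} [TopologicalSpace X] [TopologicalSpace Y] (f : X → Y) : Prop :=
  Continuous f ∧ ∀ K : Set Y, IsCompact K → IsCompact (f ⁻¹' K)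

/-- `f` and `g` are homotopic. -/
def Htpc {X Y : Type*} [TopologicalSpace X] [TopologicalSpace Y] (f g : X → Y) : Prop :=
  ∃ H : X × I → Y, Continuous H ∧ (∀ x, H (x, 0) = f x) ∧ (∀ x, H (x, 1) = g x)

/-- `f` and `g` are properly homotopic: joined by a homotopy which is itself a proper map. -/
def PHtpc {X Y : Type*} [TopologicalSpace X] [TopologicalSpace Y] (f g : X → Y) : Prop :=
  ∃ H : X × I → Y, ProperCont H ∧ (∀ x, H (x, 0) = f x) ∧ (∀ x, H (x, 1) = g x)

/-- `φ` is a proper homotopy equivalence with proper homotopy inverse `ψ`. -/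
def IsPHEPair {X Y : Type*} [TopologicalSpace X] [TopologicalSpace Y]
    (φ : X → Y) (ψ : Y → X) : Prop :=
  ProperCont φ ∧ ProperCont ψ ∧ PHtpc (ψ ∘ φ) id ∧ PHtpc (φ ∘ ψ) id

/-- `φ` is a proper homotopy equivalence (admitting some proper homotopy inverse). -/
def IsPHE {X Y : Type*} [TopologicalSpace X] [TopologicalSpace Y] (φ : X → Y) : Prop :=
  ∃ ψ : Y → X, IsPHEPair φ ψ

/-- `X` and `Y` are properly homotopy equivalent. -/
def PHEquivalent (X Y : Type*) [TopologicalSpace X] [TopologicalSpace Y] : Prop :=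
  ∃ φ : X → Y, IsPHE φ

/-- The standard Möbius band, realized as a subset of `ℝ³`. -/
def MobiusBand : Set (ℝ × ℝ × ℝ) :=
  {p | ∃ u v : ℝ, |v| ≤ 1 / 2 ∧
    p = ((1 + v * Real.cos (u / 2)) * Real.cos u,
         (1 + v * Real.cos (u / 2)) * Real.sin u,
         v * Real.sin (u / 2))}

/-- A surface: a connected, orientable (no embedded Möbius band), second-countable, Hausdorff
topological 2-manifold, possibly with boundary (locally modeled on the closed half-plane). -/
structure IsSurface (S : Type*) [TopologicalSpace S] : Prop where
  connected : ConnectedSpace S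
  t2 : T2Space S
  secondCountable : SecondCountableTopology S
  locallyHalfPlane : ∀ x : S, ∃ (U : Set S) (V : Set {p : ℝ × ℝ // 0 ≤ p.2}),
    IsOpen U ∧ x ∈ U ∧ IsOpen V ∧ Nonempty (↥U ≃ₜ ↥V)
  orientable : ¬ ∃ f : ↥MobiusBand → S, IsEmbedding f

/-- The boundary of a surface: the set of points having no open neighborhood
homeomorphic to `ℝ²`. -/
def Bd (S : Type*) [TopologicalSpace S] : Set S :=
  {x | ¬ ∃ U : Set S, IsOpen U ∧ x ∈ U ∧ Nonempty (↥U ≃ₜ (ℝ × ℝ))}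

/-- The unit circle in the plane. -/
def Circ : Set (ℝ × ℝ) := {p | p.1 ^ 2 + p.2 ^ 2 = 1}

/-- A simple closed curve in `S`: the image of a topological embedding of the circle. -/
def IsSimpleClosedCurve {S : Type*} [TopologicalSpace S] (α : Set S) : Prop :=
  ∃ f : ↥Circ → S, IsEmbedding f ∧ range f = α

/-- A boundary isolating curve: a simple closed curve `α ⊆ S ∖ ∂S` such that `S ∖ α` has
exactly two connected components `Y` and `Z` with `Y ∩ ∂S ≠ ∅`, `Z ∩ ∂S = ∅`, and
`Z ∪ α` noncompact. -/
def IsBoundaryIsolating {S : Type*} [TopologicalSpace S] (α : Set S) : Prop :=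
  IsSimpleClosedCurve α ∧ α ∩ Bd S = ∅ ∧
  ∃ Y Z : Set S, Y ≠ Z ∧
    (∀ C : Set S, (∃ x ∈ αᶜ, C = connectedComponentIn αᶜ x) ↔ (C = Y ∨ C = Z)) ∧
    (Y ∩ Bd S).Nonempty ∧ Z ∩ Bd S = ∅ ∧ ¬ IsCompact (Z ∪ α)

/-- The open part of the parametrizing interval of an edge. -/
def edgeInt : Set I := {t : I | 0 < (t : ℝ) ∧ (t : ℝ) < 1}

/-- A graph: a connected, locally finite, Hausdorff, 1-dimensional CW complex, presented by a
closed discrete vertex set and a set of characteristic maps of edges. -/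
structure IsGraph (Γ : Type*) [TopologicalSpace Γ] : Prop where
  connected : ConnectedSpace Γ
  t2 : T2Space Γ
  cell_structure : ∃ (V : Set Γ) (E : Set C(I, Γ)),
    IsClosed V ∧ DiscreteTopology ↥V ∧
    (∀ e ∈ E, e 0 ∈ V ∧ e 1 ∈ V) ∧
    (∀ e ∈ E, IsEmbedding (fun t : ↥edgeInt => e t.1)) ∧
    (∀ e ∈ E, (⇑e '' edgeInt) ∩ V = ∅) ∧
    (∀ e ∈ E, ∀ e' ∈ E, e ≠ e' → (⇑e '' edgeInt) ∩ (⇑e' '' edgeInt) = ∅) ∧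
    (V ∪ ⋃ e ∈ E, ⇑e '' edgeInt) = univ ∧
    (∀ x : Γ, ∃ U : Set Γ, IsOpen U ∧ x ∈ U ∧ {e ∈ E | (range ⇑e ∩ U).Nonempty}.Finite) ∧
    (∀ A : Set Γ, (∀ e ∈ E, IsClosed (⇑e ⁻¹' A)) → IsClosed (A ∩ ⋃ e ∈ E, range ⇑e)) ∧
    (∀ v ∈ V, (∃ e ∈ E, v ∈ range ⇑e) ∨ (univ : Set Γ) = {v})

/-- A finite graph: a graph with finitely many cells, equivalently a compact graph. -/
def IsFiniteGraph (Γ : Type*) [TopologicalSpace Γ] : Prop :=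
  IsGraph Γ ∧ CompactSpace Γ

/-- A deformation retraction of `S` onto the subspace `A`. -/
def IsDeformationRetraction {S : Type*} [TopologicalSpace S] (H : S × I → S) (A : Set S) :
    Prop :=
  Continuous H ∧ (∀ x, H (x, 0) = x) ∧ (∀ x, H (x, 1) ∈ A) ∧ (∀ a ∈ A, H (a, 1) = a)

/-- A proper deformation retraction of `S` onto the subspace `A`. -/
def IsProperDeformationRetraction {S : Type*} [TopologicalSpace S] (H : S × I → S)
    (A : Set S) : Prop :=
  ProperCont H ∧ (∀ x, H (x, 0) = x) ∧ (∀ x, H (x, 1) ∈ A) ∧ (∀ a ∈ A, H (a, 1) = a)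

/-- An end of a space, recorded as a compatible choice of a connected component of the
complement of each compact set. -/
def IsEndFn {Γ : Type*} [TopologicalSpace Γ] (s : Set Γ → Set Γ) : Prop :=
  (∀ K : Set Γ, IsCompact K → ∃ x ∈ Kᶜ, s K = connectedComponentIn Kᶜ x) ∧
  (∀ K K' : Set Γ, IsCompact K → IsCompact K' → K ⊆ K' → s K' ⊆ s K)

/-- A proper map induces the identity on the space of ends. -/
def InducesIdOnEnds {Γ : Type*} [TopologicalSpace Γ] (g : Γ → Γ) : Prop :=
  ∀ s : Set Γ → Set Γ, IsEndFn s → ∀ K : Set Γ, IsCompact K →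
    ∃ K' : Set Γ, IsCompact K' ∧ K ⊆ K' ∧ g '' s K' ⊆ s K

/-- An isotopy between `f` and `g` relative to the set `B`: a homotopy each of whose time
slices is a homeomorphism fixing `B` pointwise. -/
def IsotopicRel {S : Type*} [TopologicalSpace S] (B : Set S) (f g : S → S) : Prop :=
  ∃ H : S × I → S, Continuous H ∧ (∀ x, H (x, 0) = f x) ∧ (∀ x, H (x, 1) = g x) ∧
    ∀ t : I, IsHomeomorph (fun x => H (x, t)) ∧ ∀ x ∈ B, H (x, t) = x

/-- An isotopy between `f` and `g`: a homotopy each of whose time slices is a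
homeomorphism. -/
def Isotopic {S : Type*} [TopologicalSpace S] (f g : S → S) : Prop :=
  ∃ H : S × I → S, Continuous H ∧ (∀ x, H (x, 0) = f x) ∧ (∀ x, H (x, 1) = g x) ∧
    ∀ t : I, IsHomeomorph (fun x => H (x, t))

/-- Representatives for the mapping class group of a surface: homeomorphisms fixing the
boundary pointwise, with the compact-open topology. -/
abbrev MCGRep (S : Type*) [TopologicalSpace S] :=
  {f : C(S, S) // IsHomeomorph ⇑f ∧ ∀ x ∈ Bd S, f x = x}

/-- The isotopy-rel-boundary relation on representatives. -/
def mcgRel (S : Type*) [TopologicalSpace S] (f g : MCGRep S) : Prop :=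
  IsotopicRel (Bd S) ⇑f.1 ⇑g.1

/-- The mapping class group `Map(S)` of a surface as a topological space: homeomorphisms
fixing the boundary pointwise, modulo isotopy rel boundary, with the quotient of the
compact-open topology. -/
abbrev MCG (S : Type*) [TopologicalSpace S] := Quot (mcgRel S)

/-- Representatives for the extended mapping class group: all homeomorphisms. -/
abbrev ExRep (S : Type*) [TopologicalSpace S] := {f : C(S, S) // IsHomeomorph ⇑f}

/-- The (free) isotopy relation on representatives. -/
def exRel (S : Type*) [TopologicalSpace S] (f g : ExRep S) : Prop :=
  Isotopic ⇑f.1 ⇑g.1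

/-- The extended mapping class group `ExMap(S)` as a topological space. -/
abbrev ExMCG (S : Type*) [TopologicalSpace S] := Quot (exRel S)

/-- Representatives for the mapping class group of a graph: proper homotopy equivalences
admitting a proper homotopy inverse, with the compact-open topology. -/
abbrev GphRep (Γ : Type*) [TopologicalSpace Γ] := {g : C(Γ, Γ) // IsPHE ⇑g}

/-- The proper homotopy relation on representatives. -/
def gphRel (Γ : Type*) [TopologicalSpace Γ] (g h : GphRep Γ) : Prop :=
  PHtpc ⇑g.1 ⇑h.1

/-- The mapping class group `Map(Γ)` of a graph as a topological space. -/
abbrev GphMCG (Γ : Type*) [TopologicalSpace Γ] := Quot (gphRel Γ)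

/-- Rotation of the unit circle by angle `a`. -/
def rotC (a : ℝ) (p : ↥Circ) : ↥Circ :=
  ⟨(p.1.1 * Real.cos a - p.1.2 * Real.sin a, p.1.1 * Real.sin a + p.1.2 * Real.cos a), by
    have h : p.1.1 ^ 2 + p.1.2 ^ 2 = 1 := p.2
    have h2 := Real.sin_sq_add_cos_sq a
    simp only [Circ, Set.mem_setOf_eq]
    nlinarith [h, h2]⟩

/-- Reflection of the unit circle (the standard orientation-reversing involution). -/
def circConj (p : ↥Circ) : ↥Circ :=
  ⟨(p.1.1, -p.1.2), by
    have h : p.1.1 ^ 2 + p.1.2 ^ 2 = 1 := p.2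
    simp only [Circ, Set.mem_setOf_eq]
    nlinarith [h]⟩

/-- The midpoint of the unit interval. -/
def ihalf : I := ⟨1 / 2, by norm_num [Set.mem_Icc]⟩

/-- `f` is the twist map determined by an embedded annular collar `e`:
`e(θ,t) ↦ e(θ + 2πt, t)` on the image of `e` and the identity elsewhere. -/
def IsTwistMap {S : Type*} [TopologicalSpace S] (e : ↥Circ × I → S) (f : S → S) : Prop :=
  IsEmbedding e ∧
  (∀ (θ : ↥Circ) (t : I), f (e (θ, t)) = e (rotC (2 * Real.pi * (t : ℝ)) θ, t)) ∧
  (∀ x, x ∉ range e → f x = x)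

/-- A Dehn twist about a compact boundary component of `S`. -/
def IsCptBdTwist {S : Type*} [TopologicalSpace S] (f : S → S) : Prop :=
  ∃ e : ↥Circ × I → S, IsTwistMap e f ∧
    (∃ x ∈ Bd S, range (fun θ : ↥Circ => e (θ, 0)) = connectedComponentIn (Bd S) x ∧
      IsCompact (connectedComponentIn (Bd S) x)) ∧
    (∀ (θ : ↥Circ) (t : I), (t : ℝ) ≠ 0 → e (θ, t) ∉ Bd S)

/-- The closed unit disk in the plane. -/
def ClosedDisk : Set (ℝ × ℝ) := {p | p.1 ^ 2 + p.2 ^ 2 ≤ 1}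

/-- A Dehn twist about a degenerate boundary chain: a twist supported in an annulus disjoint
from `∂S` whose core curve cuts off a piece homeomorphic to a closed disk with a nonempty
proper closed subset removed from its boundary circle. -/
def IsDegChainTwist {S : Type*} [TopologicalSpace S] (f : S → S) : Prop :=
  ∃ e : ↥Circ × I → S, IsTwistMap e f ∧ range e ∩ Bd S = ∅ ∧
    ∃ x ∈ (range fun θ : ↥Circ => e (θ, ihalf))ᶜ,
      ∃ J : Set (ℝ × ℝ), J ⊆ Circ ∧ IsClosed J ∧ J.Nonempty ∧ J ≠ Circ ∧
        Nonempty
          (↥(closure (connectedComponentIn (range fun θ : ↥Circ => e (θ, ihalf))ᶜ x)) ≃ₜ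
            ↥(ClosedDisk \ J))

/-- `f` is a finite composition of maps satisfying the predicate `P`. -/
def IsProductOf {S : Type*} [TopologicalSpace S] (P : (S → S) → Prop) (f : S → S) : Prop :=
  ∃ L : List (S → S), (∀ g ∈ L, P g) ∧ f = L.foldr (· ∘ ·) id

/-- The closed half-strip `[0,∞) × [0,1]`. -/
def HalfStrip : Set (ℝ × ℝ) := {p | 0 ≤ p.1 ∧ 0 ≤ p.2 ∧ p.2 ≤ 1}

/-- The closed strip `ℝ × [0,1]`. -/
def FullStrip : Set (ℝ × ℝ) := {p | 0 ≤ p.2 ∧ p.2 ≤ 1}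

/-- A closed annulus in the plane. -/
def AnnulusSet : Set (ℝ × ℝ) := {p | 1 ≤ p.1 ^ 2 + p.2 ^ 2 ∧ p.1 ^ 2 + p.2 ^ 2 ≤ 4}

/-- A surface is sporadic if it is homeomorphic to the closed disk, the half-strip, the
strip, or the annulus. -/
def IsSporadic (S : Type*) [TopologicalSpace S] : Prop :=
  Nonempty (S ≃ₜ ↥ClosedDisk) ∨ Nonempty (S ≃ₜ ↥HalfStrip) ∨
    Nonempty (S ≃ₜ ↥FullStrip) ∨ Nonempty (S ≃ₜ ↥AnnulusSet)

/-- A parametrization of a compact boundary component of `S` by the circle. -/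
def IsCptBdParam {S : Type*} [TopologicalSpace S] (β : ↥Circ → S) : Prop :=
  IsEmbedding β ∧ ∃ x ∈ Bd S, range β = connectedComponentIn (Bd S) x ∧
    IsCompact (range β)

/-- A proper parametrization of a noncompact boundary component of `S` by the line. -/
def IsNcptBdParam {S : Type*} [TopologicalSpace S] (β : ℝ → S) : Prop :=
  IsEmbedding β ∧ ProperCont β ∧ ∃ x ∈ Bd S, range β = connectedComponentIn (Bd S) x ∧
    ¬ IsCompact (range β)

/-- `g` fixes (up to homotopy, resp. proper homotopy, and preserving orientations) each
curve and line of the collection `B` of `φ'`-images of boundary components: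
membership in `Map(Γ, B)`. -/
def FixesBdryImages {S : Type*} [TopologicalSpace S] (G : Set S) (φ' : S → ↥G)
    (g : ↥G → ↥G) : Prop :=
  (∀ β : ↥Circ → S, IsCptBdParam β → Htpc (g ∘ φ' ∘ β) (φ' ∘ β)) ∧
  (∀ β : ℝ → S, IsNcptBdParam β → PHtpc (g ∘ φ' ∘ β) (φ' ∘ β))

/-- `g` preserves the collection `B` of `φ'`-images of boundary components, possibly
permuting its members and reversing orientations: membership in `Map*(Γ, B)`. -/
def PermutesBdryImages {S : Type*} [TopologicalSpace S] (G : Set S) (φ' : S → ↥G)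
    (g : ↥G → ↥G) : Prop :=
  (∀ β : ↥Circ → S, IsCptBdParam β → ∃ β' : ↥Circ → S, IsCptBdParam β' ∧
    (Htpc (g ∘ φ' ∘ β) (φ' ∘ β') ∨ Htpc (g ∘ φ' ∘ β) (φ' ∘ β' ∘ circConj))) ∧
  (∀ β : ℝ → S, IsNcptBdParam β → ∃ β' : ℝ → S, IsNcptBdParam β' ∧
    (PHtpc (g ∘ φ' ∘ β) (φ' ∘ β') ∨ PHtpc (g ∘ φ' ∘ β) (φ' ∘ β' ∘ (fun r : ℝ => -r))))

end

namespace SurfaceSpine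

section Logs

variable {X Y : Type*} [TopologicalSpace X] [TopologicalSpace Y]

/-- `f` has a continuous logarithm on `K`. -/
def HasLog (f : X → ℂ) (K : Set X) : Prop :=
  ∃ u : X → ℂ, ContinuousOn u K ∧ ∀ z ∈ K, Complex.exp (u z) = f z

lemma HasLog.mono {f : X → ℂ} {K L : Set X} (h : HasLog f K) (hL : L ⊆ K) : HasLog f L := by
  obtain ⟨u, hu, h⟩ := h
  exact ⟨u, hu.mono hL, fun z hz => h z (hL hz)⟩

lemma HasLog.congr {f g : X → ℂ} {K : Set X} (h : HasLog f K) (hfg : ∀ z ∈ K, f z = g z) :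
    HasLog g K := by
  obtain ⟨u, hu, h⟩ := h
  exact ⟨u, hu, fun z hz => (h z hz).trans (hfg z hz)⟩

lemma HasLog.mul {f g : X → ℂ} {K : Set X} (hf : HasLog f K) (hg : HasLog g K) :
    HasLog (fun z => f z * g z) K := by
  obtain ⟨u, hu, h⟩ := hf
  obtain ⟨w, hw, h'⟩ := hg
  exact ⟨fun z => u z + w z, hu.add hw, fun z hz => by rw [Complex.exp_add, h z hz, h' z hz]⟩

lemma HasLog.comp {f : X → ℂ} {K : Set X} (hf : HasLog f K) {g : Y → X} {L : Set Y}
    (hg : ContinuousOn g L) (hm : MapsTo g L K) : HasLog (fun y => f (g y)) L := by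
  obtain ⟨u, hu, h⟩ := hf
  exact ⟨fun y => u (g y), hu.comp hg hm, fun y hy => h _ (hm hy)⟩

lemma HasLog.ne_zero {f : X → ℂ} {K : Set X} (hf : HasLog f K) {z : X} (hz : z ∈ K) :
    f z ≠ 0 := by
  obtain ⟨u, hu, h⟩ := hf
  rw [← h z hz]; exact Complex.exp_ne_zero _

lemma HasLog.continuousOn {f : X → ℂ} {K : Set X} (hf : HasLog f K) : ContinuousOn f K := by
  obtain ⟨u, hu, h⟩ := hf
  exact (Complex.continuous_exp.comp_continuousOn hu).congr fun z hz => (h z hz).symm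

lemma hasLog_slitPlane {f : X → ℂ} {K : Set X} (hf : ContinuousOn f K)
    (h : ∀ z ∈ K, f z ∈ Complex.slitPlane) : HasLog f K :=
  ⟨fun z => Complex.log (f z), hf.clog h,
    fun z hz => Complex.exp_log (Complex.slitPlane_ne_zero (h z hz))⟩

lemma hasLog_const {c : ℂ} (hc : c ≠ 0) (K : Set X) : HasLog (fun _ => c) K :=
  ⟨fun _ => Complex.log c, continuousOn_const, fun _ _ => Complex.exp_log hc⟩

/-- The homotopy lifting property for the exponential. -/
lemma hasLog_of_homotopy {K : Set X} (h : ℝ → X → ℂ)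
    (hc : ContinuousOn (fun p : ℝ × X => h p.1 p.2) (Icc 0 1 ×ˢ K))
    (hne : ∀ t ∈ Icc (0 : ℝ) 1, ∀ x ∈ K, h t x ≠ 0) (h0 : HasLog (h 0) K) :
    HasLog (h 1) K := by
  classical
  obtain ⟨u, hu, hu'⟩ := h0
  let H : C(I × K, {z : ℂ // z ≠ 0}) := ⟨fun p => ⟨h p.1 p.2, hne _ p.1.2 _ p.2.2⟩, by
    refine Continuous.subtype_mk ?_ _
    have : Continuous fun p : I × K => ((p.1 : ℝ), (p.2 : X)) := by fun_prop
    exact hc.comp_continuous this fun p => ⟨p.1.2, p.2.2⟩⟩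
  let f : C(K, ℂ) := ⟨fun x => u x, hu.comp_continuous continuous_subtype_val fun x => x.2⟩
  have H0 : ∀ a, H (0, a) = ⟨_, Complex.exp_ne_zero (f a)⟩ := by
    intro a
    apply Subtype.ext
    simp [H, f, hu' a a.2]
  have lift := Complex.isCoveringMap_exp.liftHomotopy_lifts H f H0
  set G := Complex.isCoveringMap_exp.liftHomotopy H f H0
  refine ⟨fun x => if hx : x ∈ K then G (1, ⟨x, hx⟩) else 0, ?_, ?_⟩
  · rw [continuousOn_iff_continuous_domRestrict]
    have : Continuous fun x : K => G (1, x) := by fun_prop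
    refine this.congr fun x => ?_
    simp
  · intro x hx
    simp only [hx, dite_true]
    have := congrFun lift (1, ⟨x, hx⟩)
    simpa [H] using congrArg Subtype.val this

lemma hasLog_of_starConvex {f : ℂ → ℂ} {K : Set ℂ} {c : ℂ} (hcK : c ∈ K) (hK : StarConvex ℝ c K)
    (hf : ContinuousOn f K) (h0 : ∀ z ∈ K, f z ≠ 0) : HasLog f K := by
  have key : ∀ t ∈ Icc (0 : ℝ) 1, ∀ x ∈ K, c + t • (x - c) ∈ K := by
    intro t ht x hx
    have := hK hx (sub_nonneg.2 ht.2) ht.1 (by ring)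
    convert this using 1
    simp [sub_smul, smul_sub]; ring
  refine (hasLog_of_homotopy (fun t x => f (c + t • (x - c))) ?_ ?_ ?_).congr (g := f) ?_
  · refine hf.comp (Continuous.continuousOn (by fun_prop)) ?_
    rintro ⟨t, x⟩ ⟨ht, hx⟩
    exact key t ht x hx
  · intro t ht x hx
    exact h0 _ (key t ht x hx)
  · exact (hasLog_const (h0 c hcK) K).congr (by simp)
  · simp

lemma hasLog_Icc {f : ℝ → ℂ} (hf : ContinuousOn f (Icc 0 1)) (h0 : ∀ z ∈ Icc (0 : ℝ) 1, f z ≠ 0) :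
    HasLog f (Icc 0 1) := by
  have key : ∀ t ∈ Icc (0 : ℝ) 1, ∀ x ∈ Icc (0 : ℝ) 1, t * x ∈ Icc (0 : ℝ) 1 := by
    intro t ht x hx
    exact ⟨mul_nonneg ht.1 hx.1, mul_le_one₀ ht.2 hx.1 hx.2⟩
  refine (hasLog_of_homotopy (fun t x => f (t * x)) ?_ ?_ ?_).congr (g := f) ?_
  · refine hf.comp (Continuous.continuousOn (by fun_prop)) ?_
    rintro ⟨t, x⟩ ⟨ht, hx⟩
    exact key t ht x hx
  · intro t ht x hx
    exact h0 _ (key t ht x hx)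
  · exact (hasLog_const (h0 0 (by simp)) _).congr (by simp)
  · simp

/-- Two logarithms differ by a constant on a preconnected set. -/
lemma log_sub_eq {K : Set X} (hK : IsPreconnected K) {u w : X → ℂ} (hu : ContinuousOn u K)
    (hw : ContinuousOn w K) (h : ∀ z ∈ K, Complex.exp (u z) = Complex.exp (w z)) {x y : X}
    (hx : x ∈ K) (hy : y ∈ K) : u x - w x = u y - w y := by
  have : DiscreteTopology (AddSubgroup.zmultiples (2 * Real.pi * Complex.I) : Set ℂ) :=
    NormedSpace.discreteTopology_zmultiples _
  refine hK.constant_of_mapsTo (T := (AddSubgroup.zmultiples (2 * Real.pi * Complex.I) : Set ℂ))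
    ⟨this⟩ (hu.sub hw) ?_ hx hy
  intro z hz
  obtain ⟨n, hn⟩ := Complex.exp_eq_exp_iff_exists_int.1 (h z hz)
  refine ⟨n, ?_⟩
  simp [hn]

lemma log_diff_eq {K : Set X} (hK : IsPreconnected K) {u w : X → ℂ} (hu : ContinuousOn u K)
    (hw : ContinuousOn w K) (h : ∀ z ∈ K, Complex.exp (u z) = Complex.exp (w z)) {x y : X}
    (hx : x ∈ K) (hy : y ∈ K) : u x - u y = w x - w y := by
  have := log_sub_eq hK hu hw h hx hy
  linear_combination this

lemma zpow_log_sphere {c : ℂ} {r : ℝ} (hr : 0 < r) {a : ℤ}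
    (h : HasLog (fun z => (z - c) ^ a) (Metric.sphere c r)) : a = 0 := by
  have hm : MapsTo (fun θ : ℝ => c + r * Complex.exp (θ * Complex.I)) univ (Metric.sphere c r) := by
    intro θ _
    simp [Complex.norm_exp_ofReal_mul_I, abs_of_pos hr]
  have hr' : (r : ℂ) ≠ 0 := by exact_mod_cast hr.ne'
  obtain ⟨u, hu, hu'⟩ := h
  have hc : Continuous fun θ : ℝ => c + r * Complex.exp (θ * Complex.I) := by fun_prop
  have := log_diff_eq (K := (univ : Set ℝ)) isPreconnected_univ
    (u := fun θ : ℝ => u (c + r * Complex.exp (θ * Complex.I)))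
    (w := fun θ : ℝ => a * (Complex.log r + θ * Complex.I))
    (hu.comp hc.continuousOn hm) (Continuous.continuousOn (by fun_prop)) (fun θ _ => by
      rw [hu' _ (hm trivial), Complex.exp_int_mul, Complex.exp_add, Complex.exp_log hr']
      simp) (mem_univ (2 * Real.pi)) (mem_univ 0)
  simp only [Complex.ofReal_mul, Complex.ofReal_ofNat, Complex.exp_two_pi_mul_I,
    Complex.ofReal_zero, zero_mul, Complex.exp_zero, sub_self] at this
  have h2 : (a : ℂ) * (2 * Real.pi * Complex.I) = 0 := by linear_combination -this
  simpa [Real.pi_ne_zero] using h2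

lemma HasLog.tietze [NormalSpace X] {f : X → ℂ} {K : Set X} (hK : IsClosed K) (hf : HasLog f K) :
    ∃ u : X → ℂ, Continuous u ∧ ∀ z ∈ K, Complex.exp (u z) = f z := by
  obtain ⟨u, hu, h⟩ := hf
  obtain ⟨g, hg⟩ := ContinuousMap.exists_restrict_eq hK ⟨K.domRestrict u, hu.domRestrict⟩
  refine ⟨g, g.continuous, fun z hz => ?_⟩
  rw [← h z hz]
  congr 1
  exact congrArg (fun f => f ⟨z, hz⟩) hg

/-- Two pieces glue to a continuous function on a union of two relatively closed pieces. -/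
lemma continuousOn_glue {K L : Set X} {u w : X → Y} [DecidablePred (· ∈ K)]
    (hu : ContinuousOn u K) (hw : ContinuousOn w L)
    (hK : ∀ z ∈ L, z ∈ closure K → z ∈ K) (hL : ∀ z ∈ K, z ∈ closure L → z ∈ L)
    (h : ∀ z ∈ K ∩ L, u z = w z) :
    ContinuousOn (fun z => if z ∈ K then u z else w z) (K ∪ L) := by
  have hL' : ∀ z ∈ L, (if z ∈ K then u z else w z) = w z := by
    intro z hz
    split_ifs with hzK
    · exact h z ⟨hzK, hz⟩
    · rfl
  have h1 : ContinuousOn (fun z => if z ∈ K then u z else w z) K :=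
    hu.congr fun z hz => by simp [hz]
  have h2 : ContinuousOn (fun z => if z ∈ K then u z else w z) L := hw.congr hL'
  intro z hz
  refine ContinuousWithinAt.union ?_ ?_
  · by_cases hzK : z ∈ K
    · exact h1 z hzK
    · refine continuousWithinAt_of_notMem_closure fun hc => hzK ?_
      exact hK z (hz.resolve_left hzK) hc
  · by_cases hzL : z ∈ L
    · exact h2 z hzL
    · refine continuousWithinAt_of_notMem_closure fun hc => hzL ?_
      exact hL z (hz.resolve_right hzL) hc

lemma continuousOn_glue_closed {K L : Set X} {u w : X → Y} [DecidablePred (· ∈ K)]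
    (hu : ContinuousOn u K) (hw : ContinuousOn w L) (hK : IsClosed K) (hL : IsClosed L)
    (h : ∀ z ∈ K ∩ L, u z = w z) :
    ContinuousOn (fun z => if z ∈ K then u z else w z) (K ∪ L) :=
  continuousOn_glue hu hw (fun _ _ h => hK.closure_eq ▸ h) (fun _ _ h => hL.closure_eq ▸ h) h

lemma HasLog.union {f : X → ℂ} {K L : Set X} {u w : X → ℂ} (hu : ContinuousOn u K)
    (hw : ContinuousOn w L) (hK : IsClosed K) (hL : IsClosed L) (h : ∀ z ∈ K ∩ L, u z = w z)
    (hu' : ∀ z ∈ K, Complex.exp (u z) = f z) (hw' : ∀ z ∈ L, Complex.exp (w z) = f z) :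
    HasLog f (K ∪ L) := by
  classical
  refine ⟨_, continuousOn_glue_closed hu hw hK hL h, ?_⟩
  intro z hz
  by_cases hzK : z ∈ K
  · simp only [hzK, if_true]; exact hu' z hzK
  · simp only [hzK, if_false]; exact hw' z (hz.resolve_left hzK)

/-- A power of `z - p` on the frontier of a bounded open set containing `p` has no nonvanishing
continuous extension. -/
lemma zpow_extension_eq_zero {U : Set ℂ} (hU : IsOpen U) (hb : Bornology.IsBounded U) {p : ℂ}
    (hp : p ∈ U) {v : ℂ → ℂ} (hv : ContinuousOn v (closure U)) (h0 : ∀ z ∈ closure U, v z ≠ 0)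
    {a : ℤ} (ha : ∀ z ∈ frontier U, v z = (z - p) ^ a) : a = 0 := by
  classical
  obtain ⟨R, hR0, hR⟩ := hb.closure.subset_ball_lt 0 p
  have hne : ∀ z ∈ Uᶜ, z - p ≠ 0 := fun z hz h => hz (sub_eq_zero.1 h ▸ hp)
  have hw : ContinuousOn (fun z : ℂ => (z - p) ^ a) Uᶜ :=
    ContinuousOn.zpow₀ (by fun_prop) _ fun z hz => Or.inl (hne z hz)
  have hc := continuousOn_glue_closed hv hw isClosed_closure hU.isClosed_compl (by
    rintro z ⟨hz, hz'⟩
    exact ha z ⟨hz, by rwa [hU.interior_eq]⟩)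
  have hun : closure U ∪ Uᶜ = univ :=
    eq_univ_of_univ_subset (by
      rw [← union_compl_self U]; exact union_subset_union_left _ subset_closure)
  rw [hun] at hc
  have := hasLog_of_starConvex (mem_univ p) (convex_univ.starConvex (mem_univ p)) hc (by
    intro z _
    split_ifs with hz
    · exact h0 z hz
    · exact zpow_ne_zero _ (hne z fun h => hz (subset_closure h)))
  refine zpow_log_sphere (c := p) hR0 ((this.mono (subset_univ _)).congr fun z hz => ?_)
  rw [if_neg]
  intro hz'
  have := hR hz'
  simp only [Metric.mem_ball, Metric.mem_sphere] at this hz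
  linarith

end Logs

section Arcs

variable {X Y : Type*} [TopologicalSpace X] [TopologicalSpace Y]

lemma continuousOn_of_leftInvOn_compact [T2Space Y] {f : X → Y} {g : Y → X} {K : Set X}
    (hK : IsCompact K) (hf : ContinuousOn f K) (hg : LeftInvOn g f K) :
    ContinuousOn g (f '' K) := by
  rw [continuousOn_iff_isClosed]
  intro t ht
  refine ⟨f '' (K ∩ t), ((hK.inter_right ht).image_of_continuousOn (hf.mono inter_subset_left)).isClosed, ?_⟩
  ext y
  constructor
  · rintro ⟨hy, x, hx, rfl⟩
    refine ⟨⟨x, ⟨hx, ?_⟩, rfl⟩, x, hx, rfl⟩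
    rwa [mem_preimage, hg hx] at hy
  · rintro ⟨⟨x, ⟨hx, hxt⟩, rfl⟩, _⟩
    exact ⟨by rwa [mem_preimage, hg hx], x, hx, rfl⟩

/-- `s` is an arc with end points `x` and `y`. -/
def IsArc (s : Set X) (x y : X) : Prop :=
  ∃ f : ℝ → X, ContinuousOn f (Icc 0 1) ∧ InjOn f (Icc 0 1) ∧ f '' Icc 0 1 = s ∧ f 0 = x ∧ f 1 = y

lemma isArc_of_Icc {a b : ℝ} (hab : a < b) {f : ℝ → X} (hf : ContinuousOn f (Icc a b))
    (hi : InjOn f (Icc a b)) : IsArc (f '' Icc a b) (f a) (f b) := by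
  have himg : (fun t : ℝ => (b - a) * t + a) '' Icc 0 1 = Icc a b := by
    have := Set.image_affine_Icc' (sub_pos.2 hab) a 0 1
    simpa using this
  have hm : MapsTo (fun t : ℝ => (b - a) * t + a) (Icc 0 1) (Icc a b) :=
    himg ▸ mapsTo_image _ _
  refine ⟨fun t => f ((b - a) * t + a), hf.comp (by fun_prop) hm, ?_, ?_, by simp, by simp⟩
  · refine hi.comp (fun s _ t _ h => ?_) hm
    have h' : b - a ≠ 0 := (sub_pos.2 hab).ne'
    simpa [h'] using h
  · rw [← himg, ← image_comp]; rfl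

lemma IsArc.symm {s : Set X} {x y : X} (h : IsArc s x y) : IsArc s y x := by
  obtain ⟨f, hf, hi, hs, rfl, rfl⟩ := h
  have himg : (fun t : ℝ => 1 - t) '' Icc 0 1 = Icc 0 1 := by simp
  have hm : MapsTo (fun t : ℝ => 1 - t) (Icc 0 1) (Icc 0 1) := by
    intro t ht; exact ⟨by linarith [ht.2], by linarith [ht.1]⟩
  refine ⟨fun t => f (1 - t), hf.comp (by fun_prop) hm, hi.comp (fun s _ t _ h => ?_) hm, ?_,
    by simp, by simp⟩
  · simpa using h
  · rw [← hs]; nth_rw 2 [← himg]; rw [← image_comp]; rfl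

lemma IsArc.ne {s : Set X} {x y : X} (h : IsArc s x y) : x ≠ y := by
  obtain ⟨f, hf, hi, hs, rfl, rfl⟩ := h
  intro h
  exact zero_ne_one (hi (by simp) (by simp) h)

lemma IsArc.left_mem {s : Set X} {x y : X} (h : IsArc s x y) : x ∈ s := by
  obtain ⟨f, hf, hi, rfl, rfl, rfl⟩ := h
  exact mem_image_of_mem _ (by simp)

lemma IsArc.right_mem {s : Set X} {x y : X} (h : IsArc s x y) : y ∈ s := h.symm.left_mem

lemma IsArc.ends_subset {s : Set X} {x y : X} (h : IsArc s x y) : {x, y} ⊆ s :=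
  insert_subset h.left_mem (singleton_subset_iff.2 h.right_mem)

lemma IsArc.isCompact {s : Set X} {x y : X} (h : IsArc s x y) : IsCompact s := by
  obtain ⟨f, hf, hi, rfl, rfl, rfl⟩ := h
  exact isCompact_Icc.image_of_continuousOn hf

lemma IsArc.isClosed [T2Space X] {s : Set X} {x y : X} (h : IsArc s x y) : IsClosed s :=
  h.isCompact.isClosed

lemma IsArc.isPreconnected {s : Set X} {x y : X} (h : IsArc s x y) : IsPreconnected s := by
  obtain ⟨f, hf, hi, rfl, rfl, rfl⟩ := h
  exact isPreconnected_Icc.image _ hf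

lemma IsArc.diff_left {s : Set X} {x y : X} (h : IsArc s x y) : IsPreconnected (s \ {x}) := by
  obtain ⟨f, hf, hi, rfl, rfl, rfl⟩ := h
  have : f '' Icc 0 1 \ {f 0} = f '' Ioc 0 1 := by
    rw [← Icc_sdiff_left, (hi.mono subset_rfl).image_sdiff_subset (by simp), image_singleton]
  rw [this]
  exact isPreconnected_Ioc.image _ (hf.mono Ioc_subset_Icc_self)

lemma IsArc.diff_ends {s : Set X} {x y : X} (h : IsArc s x y) :
    IsPreconnected (s \ {x, y}) ∧ (s \ {x, y}).Nonempty ∧ s ⊆ closure (s \ {x, y}) := by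
  obtain ⟨f, hf, hi, rfl, rfl, rfl⟩ := h
  have : f '' Icc 0 1 \ {f 0, f 1} = f '' Ioo 0 1 := by
    rw [← Icc_sdiff_both, (hi.mono subset_rfl).image_sdiff_subset (by
      simp [insert_subset_iff]), image_pair]
  rw [this]
  refine ⟨isPreconnected_Ioo.image _ (hf.mono Ioo_subset_Icc_self),
    (nonempty_Ioo.2 one_pos).image _, ?_⟩
  have h2 : Icc (0 : ℝ) 1 = closure (Ioo 0 1) := (closure_Ioo zero_ne_one).symm
  nth_rw 1 [h2]
  exact ContinuousOn.image_closure (h2 ▸ hf)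

lemma IsArc.image {s : Set X} {x y : X} (h : IsArc s x y) {g : X → Y} (hg : ContinuousOn g s)
    (hgi : InjOn g s) : IsArc (g '' s) (g x) (g y) := by
  obtain ⟨f, hf, hi, rfl, rfl, rfl⟩ := h
  exact ⟨g ∘ f, hg.comp hf (mapsTo_image _ _), hgi.comp hi (mapsTo_image _ _), image_comp _ _ _,
    rfl, rfl⟩

lemma IsArc.split {s : Set X} {x y z : X} (h : IsArc s x y) (hz : z ∈ s) (hx : z ≠ x)
    (hy : z ≠ y) : ∃ s₁ s₂, IsArc s₁ x z ∧ IsArc s₂ z y ∧ s₁ ∪ s₂ = s ∧ s₁ ∩ s₂ = {z} := by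
  obtain ⟨f, hf, hi, rfl, rfl, rfl⟩ := h
  obtain ⟨c, hc, rfl⟩ := hz
  have h0 : 0 < c := hc.1.lt_of_ne (by rintro rfl; exact hx rfl)
  have h1 : c < 1 := hc.2.lt_of_ne (by rintro rfl; exact hy rfl)
  have hs1 : Icc 0 c ⊆ Icc (0 : ℝ) 1 := Icc_subset_Icc le_rfl hc.2
  have hs2 : Icc c 1 ⊆ Icc (0 : ℝ) 1 := Icc_subset_Icc hc.1 le_rfl
  refine ⟨_, _, isArc_of_Icc h0 (hf.mono hs1) (hi.mono hs1),
    isArc_of_Icc h1 (hf.mono hs2) (hi.mono hs2), ?_, ?_⟩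
  · rw [← image_union, Icc_union_Icc_eq_Icc hc.1 hc.2]
  · rw [← hi.image_inter hs1 hs2, Icc_inter_Icc_eq_singleton hc.1 hc.2, image_singleton]

lemma IsArc.trans {s t : Set X} {x y z : X} (h : IsArc s x y) (h' : IsArc t y z)
    (hst : s ∩ t = {y}) : IsArc (s ∪ t) x z := by
  classical
  obtain ⟨f, hf, hi, hs, rfl, rfl⟩ := h
  obtain ⟨g, hg, hgi, ht, hg0, rfl⟩ := h'
  have hm : MapsTo (fun u : ℝ => u - 1) (Icc 1 2) (Icc 0 1) := by
    intro u hu; exact ⟨by linarith [hu.1], by linarith [hu.2]⟩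
  have hg' : ContinuousOn (fun u : ℝ => g (u - 1)) (Icc 1 2) := hg.comp (by fun_prop) hm
  have hgimg : (fun u : ℝ => g (u - 1)) '' Icc 1 2 = t := by
    have : (fun u : ℝ => u - 1) '' Icc 1 2 = Icc 0 1 := by
      rw [Set.image_sub_const_Icc]; norm_num
    rw [← ht, ← this, ← image_comp]; rfl
  have hu : Icc (0 : ℝ) 1 ∪ Icc 1 2 = Icc 0 2 := Icc_union_Icc_eq_Icc (by norm_num) (by norm_num)
  have hc := continuousOn_glue_closed hf hg' isClosed_Icc isClosed_Icc (by
    rw [Icc_inter_Icc_eq_singleton (by norm_num) (by norm_num)]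
    rintro u rfl; simp [hg0])
  have hR : ∀ u ∈ Icc (1 : ℝ) 2, (if u ∈ Icc (0 : ℝ) 1 then f u else g (u - 1)) = g (u - 1) := by
    intro u hu
    split_ifs with h
    · have : u = 1 := le_antisymm h.2 hu.1
      subst this; simp [hg0]
    · rfl
  have hL : ∀ u ∈ Icc (0 : ℝ) 1, (if u ∈ Icc (0 : ℝ) 1 then f u else g (u - 1)) = f u :=
    fun u hu => if_pos hu
  rw [hu] at hc
  have hinj : InjOn (fun u => if u ∈ Icc (0 : ℝ) 1 then f u else g (u - 1)) (Icc 0 2) := by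
    have cross : ∀ u ∈ Icc (0 : ℝ) 1, ∀ v ∈ Icc (1 : ℝ) 2, f u = g (v - 1) → u = v := by
      intro u hu v hv h
      have : f u ∈ s ∩ t := ⟨hs ▸ mem_image_of_mem _ hu, h ▸ ht ▸ mem_image_of_mem _ (hm hv)⟩
      rw [hst] at this
      have h1 : u = 1 := hi hu (by simp) this
      have h2 : v - 1 = 0 := hgi (hm hv) (by simp) (by rw [hg0, ← h]; exact this)
      linarith
    rw [← hu]
    rintro u (hu | hu) v (hv | hv) h
    · simp only [hL u hu, hL v hv] at h; exact hi hu hv h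
    · simp only [hL u hu, hR v hv] at h; exact cross u hu v hv h
    · simp only [hR u hu, hL v hv] at h; exact (cross v hv u hu h.symm).symm
    · simp only [hR u hu, hR v hv] at h
      linarith [hgi (hm hu) (hm hv) h]
  have := isArc_of_Icc (by norm_num) hc hinj
  convert this using 1
  · rw [← hu, image_union]
    congr 1
    · rw [← hs]; exact (image_congr hL).symm
    · rw [← hgimg]; exact (image_congr hR).symm
  · simp
  · rw [hR 2 (by norm_num)]; norm_num

lemma IsArc.eq_of_preconnected [T2Space X] {s t : Set X} {x y : X} (h : IsArc s x y)
    (ht : IsPreconnected t) (hts : t ⊆ s) (hx : x ∈ t) (hy : y ∈ t) : t = s := by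
  refine hts.antisymm fun z hz => ?_
  by_contra hzt
  obtain ⟨s₁, s₂, h1, h2, hu, hi⟩ := h.split hz (fun h => hzt (h ▸ hx)) (fun h => hzt (h ▸ hy))
  have hxs2 : x ∉ s₂ := fun h' => by
    have : x ∈ s₁ ∩ s₂ := ⟨h1.left_mem, h'⟩
    rw [hi] at this; exact hzt (this ▸ hx)
  have hys1 : y ∉ s₁ := fun h' => by
    have : y ∈ s₁ ∩ s₂ := ⟨h', h2.right_mem⟩
    rw [hi] at this; exact hzt (this ▸ hy)
  obtain ⟨w, hw, hw1, hw2⟩ := ht _ _ h2.isClosed.isOpen_compl h1.isClosed.isOpen_compl (by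
    intro w hw
    by_contra hcon
    have : w ∈ s₁ ∩ s₂ := by
      simp only [mem_union, mem_compl_iff, not_or, not_not] at hcon
      exact ⟨hcon.2, hcon.1⟩
    rw [hi] at this; exact hzt (this ▸ hw)) ⟨x, hx, hxs2⟩ ⟨y, hy, hys1⟩
  have := hts hw
  rw [← hu] at this
  exact this.elim hw2 hw1

lemma IsArc.eq_of_subset [T2Space X] {s t : Set X} {x y : X} (h : IsArc s x y)
    (ht : IsArc t x y) (hts : t ⊆ s) : t = s :=
  h.eq_of_preconnected ht.isPreconnected hts ht.left_mem ht.right_mem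

/-- Any two distinct points of an arc span a subarc. -/
lemma IsArc.sub {s : Set X} {x y u v : X} (h : IsArc s x y) (hu : u ∈ s) (hv : v ∈ s)
    (huv : u ≠ v) : ∃ t ⊆ s, IsArc t u v ∧ t ∩ {x, y} ⊆ {u, v} := by
  have key : ∀ f : ℝ → X, ContinuousOn f (Icc 0 1) → InjOn f (Icc 0 1) → f '' Icc 0 1 = s →
      ∀ a ∈ Icc (0 : ℝ) 1, ∀ b ∈ Icc (0 : ℝ) 1, a < b →
      ∃ t ⊆ s, IsArc t (f a) (f b) ∧ t ∩ {f 0, f 1} ⊆ {f a, f b} := by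
    intro f hf hi hs a ha b hb hab
    have hsub : Icc a b ⊆ Icc 0 1 := Icc_subset_Icc ha.1 hb.2
    refine ⟨f '' Icc a b, hs ▸ image_mono hsub, isArc_of_Icc hab (hf.mono hsub) (hi.mono hsub), ?_⟩
    rintro _ ⟨⟨c, hc, rfl⟩, h | h⟩
    · have : c = 0 := hi (hsub hc) (by simp) h
      left; congr 1; linarith [hc.1, ha.1]
    · have : c = 1 := hi (hsub hc) (by simp) h
      right; rw [mem_singleton_iff]; congr 1; linarith [hc.2, hb.2]
  obtain ⟨f, hf, hi, hs, rfl, rfl⟩ := h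
  obtain ⟨a, ha, rfl⟩ := hs.symm ▸ hu
  obtain ⟨b, hb, rfl⟩ := hs.symm ▸ hv
  rcases lt_or_gt_of_ne (fun h : a = b => huv (h ▸ rfl)) with hab | hab
  · exact key f hf hi hs a ha b hb hab
  · obtain ⟨t, h1, h2, h3⟩ := key f hf hi hs b hb a ha hab
    exact ⟨t, h1, h2.symm, h3.trans (by rw [pair_comm])⟩

/-- `C` is the union of two arcs from `x` to `y` meeting only at their ends. -/
def JSplit (C : Set X) (x y : X) (b₁ b₂ : Set X) : Prop :=
  IsArc b₁ x y ∧ IsArc b₂ x y ∧ b₁ ∩ b₂ = {x, y} ∧ b₁ ∪ b₂ = C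

/-- Simple closed curves. -/
def IsJordan (C : Set X) : Prop := ∃ x y b₁ b₂, JSplit C x y b₁ b₂

lemma JSplit.swap {C : Set X} {x y : X} {b₁ b₂ : Set X} (h : JSplit C x y b₁ b₂) :
    JSplit C x y b₂ b₁ :=
  ⟨h.2.1, h.1, by rw [inter_comm, h.2.2.1], by rw [union_comm, h.2.2.2]⟩

lemma JSplit.symm {C : Set X} {x y : X} {b₁ b₂ : Set X} (h : JSplit C x y b₁ b₂) :
    JSplit C y x b₁ b₂ :=
  ⟨h.1.symm, h.2.1.symm, by rw [pair_comm, h.2.2.1], h.2.2.2⟩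

lemma JSplit.isJordan {C : Set X} {x y : X} {b₁ b₂ : Set X} (h : JSplit C x y b₁ b₂) :
    IsJordan C := ⟨_, _, _, _, h⟩

lemma JSplit.left_mem {C : Set X} {x y : X} {b₁ b₂ : Set X} (h : JSplit C x y b₁ b₂) :
    x ∈ C := h.2.2.2 ▸ Or.inl h.1.left_mem

lemma JSplit.right_mem {C : Set X} {x y : X} {b₁ b₂ : Set X} (h : JSplit C x y b₁ b₂) :
    y ∈ C := h.symm.left_mem

lemma JSplit.move_aux {C : Set X} {x y z : X} {b₁ b₂ : Set X} (h : JSplit C x y b₁ b₂)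
    (hz : z ∈ b₁) (hx : z ≠ x) (hy : z ≠ y) : ∃ c₁ c₂, JSplit C z y c₁ c₂ := by
  obtain ⟨s₁, s₂, h1, h2, hu, hi⟩ := h.1.split hz hx hy
  have hb : b₁ ∩ b₂ = {x, y} := h.2.2.1
  have hs1 : s₁ ⊆ b₁ := hu ▸ subset_union_left
  have hs2 : s₂ ⊆ b₁ := hu ▸ subset_union_right
  have hys1 : y ∉ s₁ := fun h' => by
    have : y ∈ s₁ ∩ s₂ := ⟨h', h2.right_mem⟩
    rw [hi] at this; exact hy this.symm
  have hxs2 : x ∉ s₂ := fun h' => by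
    have : x ∈ s₁ ∩ s₂ := ⟨h1.left_mem, h'⟩
    rw [hi] at this; exact hx this.symm
  have h3 : s₁ ∩ b₂ = {x} := by
    ext w; constructor
    · rintro ⟨hw, hw'⟩
      have : w ∈ b₁ ∩ b₂ := ⟨hs1 hw, hw'⟩
      rw [hb] at this
      rcases this with rfl | h'
      · rfl
      · exact absurd (h' ▸ hw) hys1
    · rintro rfl; exact ⟨h1.left_mem, h.2.1.left_mem⟩
  have h4 : s₂ ∩ b₂ = {y} := by
    ext w; constructor
    · rintro ⟨hw, hw'⟩
      have : w ∈ b₁ ∩ b₂ := ⟨hs2 hw, hw'⟩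
      rw [hb] at this
      rcases this with h' | h'
      · exact absurd (h' ▸ hw) hxs2
      · exact h'
    · rintro rfl; exact ⟨h2.right_mem, h.2.1.right_mem⟩
  refine ⟨s₂, s₁ ∪ b₂, h2, h1.symm.trans h.2.1 h3, ?_, ?_⟩
  · rw [inter_union_distrib_left, inter_comm s₂ s₁, hi, h4]; rfl
  · rw [← h.2.2.2, ← hu]
    ext; simp only [mem_union]; tauto

lemma JSplit.move {C : Set X} {x y z : X} {b₁ b₂ : Set X} (h : JSplit C x y b₁ b₂)
    (hz : z ∈ C) (hy : z ≠ y) : ∃ c₁ c₂, JSplit C z y c₁ c₂ := by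
  by_cases hx : z = x
  · subst hx; exact ⟨_, _, h⟩
  rw [← h.2.2.2] at hz
  rcases hz with hz | hz
  · exact h.move_aux hz hx hy
  · exact h.swap.move_aux hz hx hy

/-- A simple closed curve can be split at any two distinct points. -/
lemma IsJordan.split {C : Set X} (h : IsJordan C) {u v : X} (hu : u ∈ C) (hv : v ∈ C)
    (huv : u ≠ v) : ∃ b₁ b₂, JSplit C u v b₁ b₂ := by
  obtain ⟨x, y, b₁, b₂, h⟩ := h
  by_cases huy : u = y
  · subst huy
    obtain ⟨c₁, c₂, h⟩ := h.move hv huv.symm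
    exact ⟨_, _, h.symm⟩
  · obtain ⟨c₁, c₂, h⟩ := h.move hu huy
    obtain ⟨c₁, c₂, h⟩ := h.symm.move hv huv.symm
    exact ⟨_, _, h.symm⟩

lemma IsJordan.isCompact {C : Set X} (h : IsJordan C) : IsCompact C := by
  obtain ⟨x, y, b₁, b₂, h1, h2, h3, rfl⟩ := h
  exact h1.isCompact.union h2.isCompact

lemma IsJordan.isClosed [T2Space X] {C : Set X} (h : IsJordan C) : IsClosed C :=
  h.isCompact.isClosed

lemma IsJordan.isPreconnected {C : Set X} (h : IsJordan C) : IsPreconnected C := by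
  obtain ⟨x, y, b₁, b₂, h1, h2, h3, rfl⟩ := h
  exact h1.isPreconnected.union x h1.left_mem h2.left_mem h2.isPreconnected

lemma IsJordan.nonempty {C : Set X} (h : IsJordan C) : C.Nonempty := by
  obtain ⟨x, y, b₁, b₂, h⟩ := h
  exact ⟨x, h.left_mem⟩

lemma IsJordan.exists_ne {C : Set X} (h : IsJordan C) (z : X) : ∃ w ∈ C, w ≠ z := by
  obtain ⟨x, y, b₁, b₂, h⟩ := h
  by_cases hz : z = x
  · exact ⟨y, h.right_mem, by rw [hz]; exact h.1.ne.symm⟩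
  · exact ⟨x, h.left_mem, fun h => hz h.symm⟩

lemma IsJordan.diff_singleton {C : Set X} (h : IsJordan C) (z : X) :
    IsPreconnected (C \ {z}) := by
  by_cases hz : z ∈ C
  · obtain ⟨w, hw, hwz⟩ := h.exists_ne z
    obtain ⟨b₁, b₂, h1, h2, h3, rfl⟩ := h.split hz hw hwz.symm
    rw [union_sdiff_distrib]
    exact h1.diff_left.union w ⟨h1.right_mem, hwz⟩ ⟨h2.right_mem, hwz⟩ h2.diff_left
  · rw [sdiff_singleton_eq_self hz]; exact h.isPreconnected

lemma JSplit.arc_eq [T2Space X] {C : Set X} {x y : X} {b₁ b₂ a : Set X} (h : JSplit C x y b₁ b₂)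
    (ha : IsArc a x y) (haC : a ⊆ C) : a = b₁ ∨ a = b₂ := by
  obtain ⟨h1, h2, h3, rfl⟩ := h
  obtain ⟨hc, hne, -⟩ := ha.diff_ends
  have key : ∀ b, IsArc b x y → a \ {x, y} ⊆ b → a = b := by
    intro b hb hab
    refine hb.eq_of_subset ha fun z hz => ?_
    by_cases hz' : z ∈ ({x, y} : Set X)
    · exact hb.ends_subset hz'
    · exact hab ⟨hz, hz'⟩
  have := isPreconnected_iff_subset_of_disjoint_closed.1 hc b₁ b₂ h1.isClosed h2.isClosed
    (sdiff_subset.trans haC) (by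
      rw [h3]; ext z; simp only [mem_inter_iff, mem_sdiff, mem_empty_iff_false]; tauto)
  rcases this with h | h
  · exact Or.inl (key _ h1 h)
  · exact Or.inr (key _ h2 h)

end Arcs

section Winding

variable {X Y : Type*} [TopologicalSpace X] [TopologicalSpace Y]

lemma IsArc.exists_param_inv [T2Space X] {b : Set X} {x y : X} (h : IsArc b x y) :
    ∃ (f : ℝ → X) (τ : X → ℝ), ContinuousOn f (Icc 0 1) ∧ ContinuousOn τ b ∧ f '' Icc 0 1 = b ∧
      f 0 = x ∧ f 1 = y ∧ (∀ t ∈ Icc (0 : ℝ) 1, τ (f t) = t) ∧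
      (∀ z ∈ b, τ z ∈ Icc (0 : ℝ) 1 ∧ f (τ z) = z) := by
  obtain ⟨f, hf, hi, hs, h0, h1⟩ := h
  have hl : LeftInvOn (Function.invFunOn f (Icc 0 1)) f (Icc 0 1) := hi.leftInvOn_invFunOn
  refine ⟨f, Function.invFunOn f (Icc 0 1), hf,
    hs ▸ continuousOn_of_leftInvOn_compact isCompact_Icc hf hl, hs, h0, h1, fun t ht => hl ht,
    fun z hz => ?_⟩
  rw [← hs] at hz
  exact ⟨Function.invFunOn_mem hz, Function.invFunOn_eq hz⟩

lemma IsArc.hasLog [T2Space X] {b : Set X} {x y : X} (h : IsArc b x y) {f : X → ℂ}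
    (hf : ContinuousOn f b) (h0 : ∀ z ∈ b, f z ≠ 0) : HasLog f b := by
  obtain ⟨g, τ, hg, hτ, hgb, -, -, -, hgτ⟩ := h.exists_param_inv
  have hm : MapsTo g (Icc 0 1) b := hgb ▸ mapsTo_image _ _
  refine ((hasLog_Icc (hf.comp hg hm) fun t ht => h0 _ (hm ht)).comp hτ
    (fun z hz => (hgτ z hz).1)).congr fun z hz => ?_
  simp [(hgτ z hz).2]

/-- The increment along `b`, from `y` to `x`, of a logarithm of `f`. -/
noncomputable def incr (f : X → ℂ) (b : Set X) (x y : X) : ℂ :=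
  open Classical in if h : HasLog f b then h.choose x - h.choose y else 0

lemma incr_eq {f : X → ℂ} {b : Set X} (hb : IsPreconnected b) {x y : X} (hx : x ∈ b) (hy : y ∈ b)
    {u : X → ℂ} (hu : ContinuousOn u b) (h : ∀ z ∈ b, Complex.exp (u z) = f z) :
    incr f b x y = u x - u y := by
  have hl : HasLog f b := ⟨u, hu, h⟩
  rw [incr, dif_pos hl]
  exact log_diff_eq hb hl.choose_spec.1 hu
    (fun z hz => (hl.choose_spec.2 z hz).trans (h z hz).symm) hx hy

lemma IsArc.exp_incr {b : Set X} {x y : X} (hb : IsArc b x y) {f : X → ℂ} (hf : HasLog f b) :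
    Complex.exp (incr f b x y) = f x / f y := by
  obtain ⟨u, hu, h⟩ := hf
  rw [incr_eq hb.isPreconnected hb.left_mem hb.right_mem hu h, Complex.exp_sub,
    h _ hb.left_mem, h _ hb.right_mem]

lemma IsArc.incr_mul_zpow {b : Set X} {x y : X} (hb : IsArc b x y) {f g : X → ℂ} (hf : HasLog f b)
    (hg : HasLog g b) (m n : ℤ) :
    incr (fun z => f z ^ m * g z ^ n) b x y = m * incr f b x y + n * incr g b x y := by
  obtain ⟨u, hu, h⟩ := hf
  obtain ⟨w, hw, h'⟩ := hg
  rw [incr_eq hb.isPreconnected hb.left_mem hb.right_mem hu h,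
    incr_eq hb.isPreconnected hb.left_mem hb.right_mem hw h',
    incr_eq hb.isPreconnected hb.left_mem hb.right_mem (u := fun z => m * u z + n * w z)
      ((continuousOn_const.mul hu).add (continuousOn_const.mul hw)) (fun z hz => by
        rw [Complex.exp_add, Complex.exp_int_mul, Complex.exp_int_mul, h z hz, h' z hz])]
  ring

lemma IsArc.incr_congr {b : Set X} {x y : X} (hb : IsArc b x y) {f g : X → ℂ} (hf : HasLog f b)
    (h : ∀ z ∈ b, f z = g z) : incr g b x y = incr f b x y := by
  obtain ⟨u, hu, h'⟩ := hf
  rw [incr_eq hb.isPreconnected hb.left_mem hb.right_mem hu h',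
    incr_eq hb.isPreconnected hb.left_mem hb.right_mem hu
      (fun z hz => (h' z hz).trans (h z hz))]

lemma IsArc.incr_comp {b : Set X} {x y : X} (hb : IsArc b x y) {c : Set Y} {x' y' : Y}
    (hc : IsArc c x' y') {g : X → Y} (hg : ContinuousOn g b) (hm : MapsTo g b c) (hx : g x = x')
    (hy : g y = y') {f : Y → ℂ} (hf : HasLog f c) :
    incr (fun z => f (g z)) b x y = incr f c x' y' := by
  obtain ⟨u, hu, h⟩ := hf
  rw [incr_eq hc.isPreconnected hc.left_mem hc.right_mem hu h,
    incr_eq hb.isPreconnected hb.left_mem hb.right_mem (u := fun z => u (g z)) (hu.comp hg hm)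
      (fun z hz => h _ (hm hz)), hx, hy]

/-- The winding of `f` along the closed curve `b₁ ∪ b₂`. -/
noncomputable def wind (f : X → ℂ) (b₁ b₂ : Set X) (x y : X) : ℂ := incr f b₁ x y - incr f b₂ x y

lemma JSplit.exists_int [T2Space X] {C : Set X} {x y : X} {b₁ b₂ : Set X} (h : JSplit C x y b₁ b₂)
    {f : X → ℂ} (hf : ContinuousOn f C) (h0 : ∀ z ∈ C, f z ≠ 0) :
    ∃ n : ℤ, wind f b₁ b₂ x y = n * (2 * Real.pi * Complex.I) := by
  have h1 := h.1.exp_incr (h.1.hasLog (hf.mono (h.2.2.2 ▸ subset_union_left))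
    fun z hz => h0 z (h.2.2.2 ▸ Or.inl hz))
  have h2 := h.2.1.exp_incr (h.2.1.hasLog (hf.mono (h.2.2.2 ▸ subset_union_right))
    fun z hz => h0 z (h.2.2.2 ▸ Or.inr hz))
  obtain ⟨n, hn⟩ := Complex.exp_eq_exp_iff_exists_int.1 (h1.trans h2.symm)
  exact ⟨n, by rw [wind, hn]; ring⟩

lemma JSplit.hasLog_iff [T2Space X] {C : Set X} {x y : X} {b₁ b₂ : Set X} (h : JSplit C x y b₁ b₂)
    {f : X → ℂ} (hf : ContinuousOn f C) (h0 : ∀ z ∈ C, f z ≠ 0) :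
    HasLog f C ↔ wind f b₁ b₂ x y = 0 := by
  have hs1 : b₁ ⊆ C := h.2.2.2 ▸ subset_union_left
  have hs2 : b₂ ⊆ C := h.2.2.2 ▸ subset_union_right
  constructor
  · rintro ⟨u, hu, hu'⟩
    rw [wind, incr_eq h.1.isPreconnected h.1.left_mem h.1.right_mem (hu.mono hs1)
      (fun z hz => hu' z (hs1 hz)), incr_eq h.2.1.isPreconnected h.2.1.left_mem h.2.1.right_mem
      (hu.mono hs2) (fun z hz => hu' z (hs2 hz)), sub_self]
  · intro hw
    obtain ⟨u, hu, hu'⟩ := h.1.hasLog (hf.mono hs1) fun z hz => h0 z (hs1 hz)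
    obtain ⟨w, hw, hw'⟩ := h.2.1.hasLog (hf.mono hs2) fun z hz => h0 z (hs2 hz)
    rw [wind, incr_eq h.1.isPreconnected h.1.left_mem h.1.right_mem hu hu',
      incr_eq h.2.1.isPreconnected h.2.1.left_mem h.2.1.right_mem hw hw'] at *
    rw [← h.2.2.2]
    refine HasLog.union hu (w := fun z => w z + (u x - w x)) (hw.add continuousOn_const)
      h.1.isClosed h.2.1.isClosed ?_ hu' ?_
    · rw [h.2.2.1]
      rintro z (rfl | rfl)
      · ring
      · linear_combination -‹u x - u z - (w x - w z) = 0›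
    · intro z hz
      rw [Complex.exp_add, Complex.exp_sub, hu' x h.1.left_mem, hw' x h.2.1.left_mem, div_self
        (h0 x h.left_mem), mul_one, hw' z hz]

lemma JSplit.wind_mul_zpow [T2Space X] {C : Set X} {x y : X} {b₁ b₂ : Set X}
    (h : JSplit C x y b₁ b₂) {f g : X → ℂ} (hf : ContinuousOn f C) (hf0 : ∀ z ∈ C, f z ≠ 0)
    (hg : ContinuousOn g C) (hg0 : ∀ z ∈ C, g z ≠ 0) (m n : ℤ) :
    wind (fun z => f z ^ m * g z ^ n) b₁ b₂ x y =
      m * wind f b₁ b₂ x y + n * wind g b₁ b₂ x y := by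
  have hs1 : b₁ ⊆ C := h.2.2.2 ▸ subset_union_left
  have hs2 : b₂ ⊆ C := h.2.2.2 ▸ subset_union_right
  have l1 : ∀ {f : X → ℂ}, ContinuousOn f C → (∀ z ∈ C, f z ≠ 0) → HasLog f b₁ :=
    fun hf hf0 => h.1.hasLog (hf.mono hs1) fun z hz => hf0 z (hs1 hz)
  have l2 : ∀ {f : X → ℂ}, ContinuousOn f C → (∀ z ∈ C, f z ≠ 0) → HasLog f b₂ :=
    fun hf hf0 => h.2.1.hasLog (hf.mono hs2) fun z hz => hf0 z (hs2 hz)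
  rw [wind, h.1.incr_mul_zpow (l1 hf hf0) (l1 hg hg0), h.2.1.incr_mul_zpow (l2 hf hf0) (l2 hg hg0),
    wind, wind]
  ring

lemma IsArc.exists_map [T2Space X] {b : Set X} {x y : X} (h : IsArc b x y) {c : Set Y} {x' y' : Y}
    (h' : IsArc c x' y') :
    ∃ g : X → Y, ContinuousOn g b ∧ InjOn g b ∧ g '' b = c ∧ g x = x' ∧ g y = y' := by
  obtain ⟨f, τ, hf, hτ, hfb, rfl, rfl, hτf, hfτ⟩ := h.exists_param_inv
  obtain ⟨g, hg, hi, rfl, rfl, rfl⟩ := h'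
  have hm : MapsTo τ b (Icc 0 1) := fun z hz => (hfτ z hz).1
  refine ⟨g ∘ τ, hg.comp hτ hm, hi.comp (fun z hz w hw h => ?_) hm, ?_, ?_, ?_⟩
  · rw [← (hfτ z hz).2, ← (hfτ w hw).2, h]
  · rw [image_comp]
    congr 1
    ext t; constructor
    · rintro ⟨z, hz, rfl⟩; exact hm hz
    · intro ht; exact ⟨f t, hfb ▸ mem_image_of_mem _ ht, hτf t ht⟩
  · simp [hτf 0 (by simp)]
  · simp [hτf 1 (by simp)]

lemma JSplit.exists_map [T2Space X] {C : Set X} {x y : X} {b₁ b₂ : Set X} (h : JSplit C x y b₁ b₂)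
    {C' : Set Y} {x' y' : Y} {c₁ c₂ : Set Y} (h' : JSplit C' x' y' c₁ c₂) :
    ∃ g : X → Y, ContinuousOn g C ∧ InjOn g C ∧ g '' C = C' ∧ g x = x' ∧ g y = y' ∧
      g '' b₁ = c₁ ∧ g '' b₂ = c₂ := by
  classical
  obtain ⟨g₁, hg1, hi1, him1, hx1, hy1⟩ := h.1.exists_map h'.1
  obtain ⟨g₂, hg2, hi2, him2, hx2, hy2⟩ := h.2.1.exists_map h'.2.1
  have hag : ∀ z ∈ b₁ ∩ b₂, g₁ z = g₂ z := by
    rw [h.2.2.1]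
    rintro z (rfl | rfl)
    · rw [hx1, hx2]
    · rw [hy1, hy2]
  have hc := continuousOn_glue_closed hg1 hg2 h.1.isClosed h.2.1.isClosed hag
  set g := fun z => if z ∈ b₁ then g₁ z else g₂ z
  have e1 : ∀ z ∈ b₁, g z = g₁ z := fun z hz => if_pos hz
  have e2 : ∀ z ∈ b₂, g z = g₂ z := fun z hz => by
    by_cases hz' : z ∈ b₁
    · rw [e1 z hz']; exact hag z ⟨hz', hz⟩
    · exact if_neg hz'
  have i1 : g '' b₁ = c₁ := by rw [← him1]; exact image_congr e1
  have i2 : g '' b₂ = c₂ := by rw [← him2]; exact image_congr e2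
  have cross : ∀ z ∈ b₁, ∀ w ∈ b₂, g z = g w → z = w := by
    intro z hz w hw hzw
    have : g z ∈ c₁ ∩ c₂ := ⟨i1 ▸ mem_image_of_mem _ hz, hzw ▸ i2 ▸ mem_image_of_mem _ hw⟩
    rw [h'.2.2.1] at this
    rcases this with hzx | hzy
    · have a1 : z = x := hi1 hz h.1.left_mem (by rw [← e1 z hz, hzx, hx1])
      have a2 : w = x := hi2 hw h.2.1.left_mem (by rw [← e2 w hw, ← hzw, hzx, hx2])
      rw [a1, a2]
    · have a1 : z = y := hi1 hz h.1.right_mem (by rw [← e1 z hz, hzy, hy1])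
      have a2 : w = y := hi2 hw h.2.1.right_mem (by rw [← e2 w hw, ← hzw, hzy, hy2])
      rw [a1, a2]
  refine ⟨g, h.2.2.2 ▸ hc, ?_, ?_, by rw [e1 x h.1.left_mem, hx1], by rw [e1 y h.1.right_mem, hy1],
    i1, i2⟩
  · rw [← h.2.2.2]
    rintro z (hz | hz) w (hw | hw) hzw
    · exact hi1 hz hw (by rw [← e1 z hz, ← e1 w hw, hzw])
    · exact cross z hz w hw hzw
    · exact (cross w hw z hz hzw.symm).symm
    · exact hi2 hz hw (by rw [← e2 z hz, ← e2 w hw, hzw])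
  · rw [← h.2.2.2, ← h'.2.2.2, image_union, i1, i2]

end Winding

section Circle

lemma exists_circle_split (c : ℂ) {r : ℝ} (hr : 0 < r) :
    ∃ b₁ b₂, JSplit (Metric.sphere c r) (c - r) (c + r) b₁ b₂ ∧
      wind (fun z => z - c) b₁ b₂ (c - r) (c + r) = 2 * Real.pi * Complex.I := by
  have key : ∀ e : ℝ, e ^ 2 = 1 →
      IsArc {z ∈ Metric.sphere c r | 0 ≤ e * (z - c).im} (c - r) (c + r) := by
    intro e he
    have h := isArc_of_Icc (a := -1) (b := 1) (by norm_num)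
      (f := fun t : ℝ => c + r * ((t : ℂ) + (e * √(1 - t ^ 2) : ℝ) * Complex.I))
      (Continuous.continuousOn (by fun_prop)) (by
        intro s _ t _ h
        have := congrArg Complex.re h
        simpa [hr.ne'] using this)
    convert h using 1
    · ext z
      constructor
      · rintro ⟨hz, hz'⟩
        rw [mem_sphere_iff_norm] at hz
        have h2 : (z - c).re ^ 2 + (z - c).im ^ 2 = r ^ 2 := by
          rw [← hz, ← Complex.normSq_eq_norm_sq, Complex.normSq_apply]; ring
        have h1 : ((z - c).re / r) ^ 2 ≤ 1 := by
          rw [div_pow, div_le_one (by positivity)]; nlinarith [sq_nonneg (z - c).im]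
        refine ⟨(z - c).re / r, abs_le.1 (by rwa [sq_le_one_iff_abs_le_one] at h1), ?_⟩
        have h3 : √(1 - ((z - c).re / r) ^ 2) = e * (z - c).im / r := by
          have h4 : 1 - ((z - c).re / r) ^ 2 = (e * (z - c).im / r) ^ 2 := by
            field_simp
            linear_combination -h2 - (z - c).im ^ 2 * he
          rw [h4, Real.sqrt_sq (by positivity)]
        apply Complex.ext
        · simp; field_simp; ring
        · simp only [h3]; simp; field_simp; linear_combination (z.im - c.im) * he
      · rintro ⟨t, ht, rfl⟩
        have h1 : 0 ≤ 1 - t ^ 2 := by nlinarith [ht.1, ht.2]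
        refine ⟨?_, ?_⟩
        · rw [mem_sphere_iff_norm, add_sub_cancel_left, norm_mul, Complex.norm_real,
            Real.norm_of_nonneg hr.le, Complex.norm_add_mul_I, mul_pow, he, Real.sq_sqrt h1]
          simp
        · simp
          have := Real.sqrt_nonneg (1 - t ^ 2)
          have : e * (r * (e * √(1 - t ^ 2))) = r * √(1 - t ^ 2) := by
            linear_combination r * √(1 - t ^ 2) * he
          rw [this]; positivity
    · simp; ring
    · simp
  have A1 := key 1 (by norm_num)
  have A2 := key (-1) (by norm_num)
  have hr' : (r : ℂ) ≠ 0 := by exact_mod_cast hr.ne'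
  have hne : ∀ z ∈ Metric.sphere c r, z - c ≠ 0 := by
    intro z hz h
    rw [mem_sphere_iff_norm, h, norm_zero] at hz
    exact hr.ne hz
  have slit : ∀ w : ℂ, w ≠ 0 → 0 ≤ w.re → w ∈ Complex.slitPlane := by
    intro w hw hre
    rcases hre.lt_or_eq with h | h
    · exact Or.inl h
    · exact Or.inr fun h' => hw (Complex.ext h.symm h')
  have exp2 : Complex.exp (Real.pi / 2 * Complex.I) = Complex.I := Complex.exp_pi_div_two_mul_I
  have hJ : JSplit (Metric.sphere c r) (c - r) (c + r)
      {z ∈ Metric.sphere c r | 0 ≤ 1 * (z - c).im}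
      {z ∈ Metric.sphere c r | 0 ≤ -1 * (z - c).im} := by
    refine ⟨A1, A2, ?_, ?_⟩
    · refine Subset.antisymm ?_ (subset_inter A1.ends_subset A2.ends_subset)
      rintro z ⟨⟨hz, h1⟩, -, h2⟩
      have h3 : (z - c).im = 0 := by linarith
      rw [mem_sphere_iff_norm] at hz
      have h4 : (z - c).re ^ 2 + (z - c).im ^ 2 = r ^ 2 := by
        rw [← hz, ← Complex.normSq_eq_norm_sq, Complex.normSq_apply]; ring
      rw [h3] at h4
      have h5 : ((z - c).re - r) * ((z - c).re + r) = 0 := by linear_combination h4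
      rcases mul_eq_zero.1 h5 with h | h
      · right
        have : z - c = r := Complex.ext (by simp; linarith [Complex.sub_re z c]) (by simpa using h3)
        rw [mem_singleton_iff]; linear_combination this
      · left
        have : z - c = -r := Complex.ext (by simp; linarith [Complex.sub_re z c]) (by simpa using h3)
        linear_combination this
    · ext z
      simp only [mem_union, mem_sep_iff, ← and_or_left, and_iff_left_iff_imp]
      intro _
      rcases le_total 0 (z - c).im with h | h
      · left; linarith
      · right; linarith
  refine ⟨_, _, hJ, ?_⟩
  have hI : Complex.exp (Real.pi / 2 * Complex.I) = Complex.I := Complex.exp_pi_div_two_mul_I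
  have key2 : ∀ (e : ℝ) (w : ℂ), e ^ 2 = 1 → w = -e * Complex.I → ∀ (b : Set ℂ),
      IsArc b (c - r) (c + r) → (∀ z ∈ b, z ∈ Metric.sphere c r ∧ 0 ≤ e * (z - c).im) →
      incr (fun z => z - c) b (c - r) (c + r) = Complex.log (w * (-r)) - Complex.log (w * r) := by
    intro e w he hw b hb hbe
    have hw0 : w ≠ 0 := by
      rw [hw]; intro h; simp at h; rw [h] at he; norm_num at he
    rw [incr_eq hb.isPreconnected hb.left_mem hb.right_mem
      (u := fun z => Complex.log (w * (z - c)) - Complex.log w)]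
    · simp
    · refine ContinuousOn.sub (ContinuousOn.clog (by fun_prop) fun z hz => ?_) continuousOn_const
      obtain ⟨h1, h2⟩ := hbe z hz
      refine slit _ (mul_ne_zero hw0 (hne z h1)) ?_
      rw [hw]; simpa using h2
    · intro z hz
      rw [Complex.exp_sub, Complex.exp_log (mul_ne_zero hw0 (hne z (hbe z hz).1)),
        Complex.exp_log hw0]
      field_simp
  rw [wind, key2 1 (-Complex.I) (by norm_num) (by simp) _ A1 (fun z hz => hz),
    key2 (-1) Complex.I (by norm_num) (by simp) _ A2 (fun z hz => hz)]
  have e1 : Complex.I * (-(r : ℂ)) = r * -Complex.I := by ring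
  have e2 : -Complex.I * (-(r : ℂ)) = r * Complex.I := by ring
  have hI' : -Complex.I ≠ 0 := neg_ne_zero.2 Complex.I_ne_zero
  rw [e1, e2, mul_comm _ (r : ℂ), mul_comm _ (r : ℂ), Complex.log_ofReal_mul hr hI',
    Complex.log_ofReal_mul hr Complex.I_ne_zero, Complex.log_I, Complex.log_neg_I]
  ring

end Circle

section Jordan

variable {X Y : Type*} [TopologicalSpace X] [TopologicalSpace Y]

/-- The bounded side of a closed plane set. -/
def inner (C : Set ℂ) : Set ℂ := {p | p ∉ C ∧ ¬ HasLog (fun z => z - p) C}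

/-- The set of points around which `C` does not wind. -/
def outer (C : Set ℂ) : Set ℂ := {p | HasLog (fun z => z - p) C}

lemma sub_ne_zero_of_notMem {C : Set ℂ} {p : ℂ} (hp : p ∉ C) : ∀ z ∈ C, z - p ≠ 0 :=
  fun _ hz h => hp (sub_eq_zero.1 h ▸ hz)

lemma continuousOn_sub_const' (C : Set ℂ) (p : ℂ) : ContinuousOn (fun z => z - p) C := by
  fun_prop

lemma mem_slitPlane_of_re_nonneg {w : ℂ} (hw : w ≠ 0) (h : 0 ≤ w.re) : w ∈ Complex.slitPlane := by
  rcases h.lt_or_eq with h | h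
  · exact Or.inl h
  · exact Or.inr fun h' => hw (Complex.ext h.symm h')

lemma mem_slitPlane_one_sub {w : ℂ} (h : ‖w‖ < 1) : 1 - w ∈ Complex.slitPlane := by
  left
  have := Complex.re_le_norm w
  simp; linarith

lemma compl_inner (C : Set ℂ) : (inner C)ᶜ = C ∪ outer C := by
  ext p; simp [inner, outer]; tauto

lemma outer_inter (C : Set ℂ) : Disjoint (outer C) C :=
  disjoint_left.2 fun p hp hpC => hp.ne_zero hpC (sub_self p)

lemma continuousAt_incr {b : Set ℂ} {x y p : ℂ} (hb : IsArc b x y) (hp : p ∉ b) :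
    ContinuousAt (fun q => incr (fun z => z - q) b x y) p := by
  obtain ⟨u, hu, hu'⟩ := hb.hasLog (continuousOn_sub_const' b p) (sub_ne_zero_of_notMem hp)
  obtain ⟨δ, hδ, hball⟩ := Metric.isOpen_iff.1 hb.isClosed.isOpen_compl p hp
  have hd : ∀ z ∈ b, δ ≤ ‖z - p‖ := fun z hz => by
    by_contra h
    exact hball (by rw [Metric.mem_ball, dist_eq_norm]; linarith) hz
  have hsl : ∀ q ∈ Metric.ball p δ, ∀ z ∈ b, 1 - (q - p) / (z - p) ∈ Complex.slitPlane := by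
    intro q hq z hz
    apply mem_slitPlane_one_sub
    rw [norm_div, div_lt_one (lt_of_lt_of_le hδ (hd z hz))]
    rw [Metric.mem_ball, dist_eq_norm] at hq
    exact hq.trans_le (hd z hz)
  have key : ∀ q ∈ Metric.ball p δ, incr (fun z => z - q) b x y =
      (u x + Complex.log (1 - (q - p) / (x - p))) - (u y + Complex.log (1 - (q - p) / (y - p))) := by
    intro q hq
    refine incr_eq hb.isPreconnected hb.left_mem hb.right_mem
      (u := fun z => u z + Complex.log (1 - (q - p) / (z - p))) (hu.add ?_) ?_
    · refine ContinuousOn.clog ?_ (hsl q hq)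
      exact continuousOn_const.sub (continuousOn_const.div (by fun_prop) (sub_ne_zero_of_notMem hp))
    · intro z hz
      rw [Complex.exp_add, hu' z hz, Complex.exp_log (Complex.slitPlane_ne_zero (hsl q hq z hz))]
      have := sub_ne_zero_of_notMem hp z hz
      field_simp; ring
  have hx := hsl p (Metric.mem_ball_self hδ) x hb.left_mem
  have hy := hsl p (Metric.mem_ball_self hδ) y hb.right_mem
  refine ContinuousAt.congr ?_ (Filter.eventuallyEq_of_mem (Metric.ball_mem_nhds p hδ)
    (fun q hq => (key q hq).symm))
  refine ContinuousAt.sub ?_ ?_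
  · exact continuousAt_const.add (ContinuousAt.clog (by fun_prop) hx)
  · exact continuousAt_const.add (ContinuousAt.clog (by fun_prop) hy)

lemma JSplit.continuousOn_wind {C : Set ℂ} {x y : ℂ} {b₁ b₂ : Set ℂ} (h : JSplit C x y b₁ b₂) :
    ContinuousOn (fun q => wind (fun z => z - q) b₁ b₂ x y) Cᶜ := by
  intro p hp
  exact ((continuousAt_incr h.1 fun h' => hp (h.2.2.2 ▸ Or.inl h')).sub
    (continuousAt_incr h.2.1 fun h' => hp (h.2.2.2 ▸ Or.inr h'))).continuousWithinAt

lemma JSplit.mem_outer_iff {C : Set ℂ} {x y : ℂ} {b₁ b₂ : Set ℂ} (h : JSplit C x y b₁ b₂)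
    {p : ℂ} (hp : p ∉ C) : p ∈ outer C ↔ wind (fun z => z - p) b₁ b₂ x y = 0 :=
  h.hasLog_iff (continuousOn_sub_const' _ _) (sub_ne_zero_of_notMem hp)

lemma JSplit.wind_eq {C : Set ℂ} {x y : ℂ} {b₁ b₂ : Set ℂ} (h : JSplit C x y b₁ b₂)
    {K : Set ℂ} (hK : IsPreconnected K) (hKC : K ⊆ Cᶜ) {p q : ℂ} (hp : p ∈ K) (hq : q ∈ K) :
    wind (fun z => z - p) b₁ b₂ x y = wind (fun z => z - q) b₁ b₂ x y := by
  have : DiscreteTopology (AddSubgroup.zmultiples (2 * Real.pi * Complex.I) : Set ℂ) :=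
    NormedSpace.discreteTopology_zmultiples _
  refine hK.constant_of_mapsTo (T := (AddSubgroup.zmultiples (2 * Real.pi * Complex.I) : Set ℂ))
    ⟨this⟩ (h.continuousOn_wind.mono hKC) ?_ hp hq
  intro z hz
  obtain ⟨n, hn⟩ := h.exists_int (continuousOn_sub_const' _ z) (sub_ne_zero_of_notMem (hKC hz))
  exact ⟨n, by simp [hn]⟩

lemma IsJordan.isOpen_outer {C : Set ℂ} (hC : IsJordan C) : IsOpen (outer C) := by
  obtain ⟨x, y, b₁, b₂, h⟩ := id hC
  rw [Metric.isOpen_iff]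
  intro p hp
  have hpC : p ∉ C := fun hpC => disjoint_left.1 (outer_inter C) hp hpC
  obtain ⟨δ, hδ, hball⟩ := Metric.isOpen_iff.1 hC.isClosed.isOpen_compl p hpC
  refine ⟨δ, hδ, fun q hq => (h.mem_outer_iff (hball hq)).2 ?_⟩
  rw [h.wind_eq (convex_ball p δ).isPreconnected hball hq (Metric.mem_ball_self hδ)]
  exact (h.mem_outer_iff hpC).1 hp

lemma inner_eq (C : Set ℂ) : inner C = Cᶜ \ outer C := rfl

lemma IsJordan.isOpen_inner {C : Set ℂ} (hC : IsJordan C) : IsOpen (inner C) := by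
  obtain ⟨x, y, b₁, b₂, h⟩ := id hC
  rw [Metric.isOpen_iff]
  intro p hp
  obtain ⟨δ, hδ, hball⟩ := Metric.isOpen_iff.1 hC.isClosed.isOpen_compl p hp.1
  refine ⟨δ, hδ, fun q hq => ⟨hball hq, fun hq' => hp.2 ((h.mem_outer_iff hp.1).2 ?_)⟩⟩
  rw [← h.wind_eq (convex_ball p δ).isPreconnected hball hq (Metric.mem_ball_self hδ)]
  exact (h.mem_outer_iff (hball hq)).1 hq'

lemma mem_outer_of_norm {C : Set ℂ} {R : ℝ} (hC : C ⊆ Metric.ball 0 R) {p : ℂ}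
    (hR : 0 < R) (hp : R ≤ ‖p‖) : p ∈ outer C := by
  have hp0 : p ≠ 0 := norm_pos_iff.1 (hR.trans_le hp)
  refine ((hasLog_const (neg_ne_zero.2 hp0) C).mul
    (hasLog_slitPlane (f := fun z => 1 - z / p) (by fun_prop) fun z hz => ?_)).congr fun z _ => ?_
  · apply mem_slitPlane_one_sub
    have := hC hz
    rw [mem_ball_zero_iff] at this
    rw [norm_div, div_lt_one (by linarith)]; linarith
  · field_simp; ring

lemma IsJordan.exists_inner_subset_ball {C : Set ℂ} (hC : IsJordan C) :
    ∃ R : ℝ, 0 < R ∧ C ∪ inner C ⊆ Metric.ball 0 R := by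
  obtain ⟨R, hR, hCR⟩ := hC.isCompact.isBounded.subset_ball_lt 0 0
  refine ⟨R, hR, union_subset hCR fun p hp => ?_⟩
  by_contra h
  exact hp.2 (mem_outer_of_norm hCR hR (by simpa using h))

lemma IsJordan.isCompact_closedInner {C : Set ℂ} (hC : IsJordan C) : IsCompact (C ∪ inner C) := by
  obtain ⟨R, hR, h⟩ := hC.exists_inner_subset_ball
  refine Metric.isCompact_of_isClosed_isBounded ?_ (Metric.isBounded_ball.subset h)
  have : C ∪ inner C = (outer C)ᶜ := by
    ext p
    have : p ∈ outer C → p ∉ C := fun h => disjoint_left.1 (outer_inter C) h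
    simp only [mem_union, inner_eq, mem_sdiff, mem_compl_iff]
    tauto
  rw [this]
  exact hC.isOpen_outer.isClosed_compl

lemma IsJordan.isBounded_inner {C : Set ℂ} (hC : IsJordan C) : Bornology.IsBounded (inner C) :=
  hC.isCompact_closedInner.isBounded.subset subset_union_right

/-- A bounded open set containing `p` cannot have frontier inside a closed set on which
`z - p` has a logarithm. -/
lemma not_hasLog_of_frontier {U K : Set ℂ} (hU : IsOpen U) (hb : Bornology.IsBounded U)
    {p : ℂ} (hp : p ∈ U) (hK : IsClosed K) (hf : frontier U ⊆ K)
    (hl : HasLog (fun z => z - p) K) : False := by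
  obtain ⟨u, hu, hu'⟩ := hl.tietze hK
  have := zpow_extension_eq_zero hU hb hp (v := fun z => Complex.exp (u z)) (a := 1)
    (by fun_prop) (fun z _ => Complex.exp_ne_zero _) (fun z hz => by rw [hu' z (hf hz), zpow_one])
  omega

lemma IsJordan.isPreconnected_inner {C : Set ℂ} (hC : IsJordan C) : IsPreconnected (inner C) := by
  obtain ⟨x, y, b₁, b₂, h⟩ := id hC
  intro U V hU hV hUV ⟨p, hp, hpU⟩ ⟨q, hq, hqV⟩
  by_contra hcon
  set U' := inner C ∩ U
  set V' := inner C ∩ V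
  have hU' : IsOpen U' := hC.isOpen_inner.inter hU
  have hV' : IsOpen V' := hC.isOpen_inner.inter hV
  have hd : Disjoint U' V' := disjoint_left.2 fun z h1 h2 => hcon ⟨z, h1.1, h1.2, h2.2⟩
  have hcl : closure U' ⊆ V'ᶜ :=
    closure_minimal (fun z hz => disjoint_left.1 hd hz) hV'.isClosed_compl
  have hcl2 : closure U' ⊆ C ∪ inner C :=
    closure_minimal (fun z hz => Or.inr hz.1) hC.isCompact_closedInner.isClosed
  have hfr : frontier U' ⊆ C := by
    intro z hz
    rw [hU'.frontier_eq] at hz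
    rcases hcl2 hz.1 with h1 | h1
    · exact h1
    · exfalso
      rcases hUV h1 with h2 | h2
      · exact hz.2 ⟨h1, h2⟩
      · exact hcl hz.1 ⟨h1, h2⟩
  have hpc := sub_ne_zero_of_notMem hp.1
  have hqc := sub_ne_zero_of_notMem hq.1
  have cp := continuousOn_sub_const' C p
  have cq := continuousOn_sub_const' C q
  obtain ⟨m, hm⟩ := h.exists_int cp hpc
  obtain ⟨n, hn⟩ := h.exists_int cq hqc
  have hlog : HasLog (fun z => (z - p) ^ n * (z - q) ^ (-m)) C := by
    rw [h.hasLog_iff]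
    · rw [h.wind_mul_zpow cp hpc cq hqc, hm, hn]; push_cast; ring
    · exact (cp.zpow₀ _ fun z hz => Or.inl (hpc z hz)).mul
        (cq.zpow₀ _ fun z hz => Or.inl (hqc z hz))
    · intro z hz
      exact mul_ne_zero (zpow_ne_zero _ (hpc z hz)) (zpow_ne_zero _ (hqc z hz))
  obtain ⟨u, hu, hu'⟩ := hlog.tietze hC.isClosed
  have hqcl : ∀ z ∈ closure U', z - q ≠ 0 := by
    intro z hz h0
    rw [sub_eq_zero] at h0
    exact hcl hz (h0 ▸ ⟨hq, hqV⟩)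
  have h0 := zpow_extension_eq_zero hU' (hC.isBounded_inner.subset inter_subset_left) ⟨hp, hpU⟩
    (v := fun z => Complex.exp (u z) * (z - q) ^ m) (a := n)
    (ContinuousOn.mul (by fun_prop)
      ((continuousOn_sub_const' _ _).zpow₀ _ fun z hz => Or.inl (hqcl z hz)))
    (fun z hz => mul_ne_zero (Complex.exp_ne_zero _) (zpow_ne_zero _ (hqcl z hz)))
    (fun z hz => by
      have := hqc z (hfr hz)
      rw [hu' z (hfr hz), mul_assoc, ← zpow_add₀ this]; simp)
  refine hq.2 ((h.hasLog_iff cq hqc).2 ?_)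
  rw [hn, h0]; simp

/-- The winding number around inner points is `± 1`. -/
lemma JSplit.exists_wind {C : Set ℂ} {x y : ℂ} {b₁ b₂ : Set ℂ} (h : JSplit C x y b₁ b₂) :
    (inner C).Nonempty ∧ ∃ d : ℤ, (d = 1 ∨ d = -1) ∧
      ∀ p ∈ inner C, wind (fun z => z - p) b₁ b₂ x y = d * (2 * Real.pi * Complex.I) := by
  classical
  have hC := h.isJordan
  obtain ⟨d, hd, hd0⟩ : ∃ d : ℤ, (∀ p ∈ inner C, wind (fun z => z - p) b₁ b₂ x y =
      d * (2 * Real.pi * Complex.I)) ∧ (d ≠ 0 → (inner C).Nonempty) := by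
    rcases (inner C).eq_empty_or_nonempty with he | ⟨p, hp⟩
    · exact ⟨0, by simp [he], by simp⟩
    · obtain ⟨n, hn⟩ := h.exists_int (continuousOn_sub_const' _ p) (sub_ne_zero_of_notMem hp.1)
      refine ⟨n, fun q hq => ?_, fun _ => ⟨p, hp⟩⟩
      rw [← hn]
      exact h.wind_eq hC.isPreconnected_inner (fun z hz => hz.1) hq hp
  suffices hs : d = 1 ∨ d = -1 by
    refine ⟨hd0 ?_, d, hs, hd⟩
    rcases hs with rfl | rfl <;> norm_num
  have hdall : ∀ p, p ∉ C → ∃ k : ℤ, wind (fun z => z - p) b₁ b₂ x y =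
      k * (d * (2 * Real.pi * Complex.I)) := by
    intro p hp
    by_cases hpo : p ∈ outer C
    · exact ⟨0, by rw [(h.mem_outer_iff hp).1 hpo]; simp⟩
    · exact ⟨1, by rw [hd p ⟨hp, hpo⟩]; simp⟩
  have hxy := h.1.ne
  have hs1 : b₁ ⊆ C := h.2.2.2 ▸ subset_union_left
  have hs2 : b₂ ⊆ C := h.2.2.2 ▸ subset_union_right
  -- a small circle around `x`
  set r : ℝ := dist x y / 2
  have hr : 0 < r := half_pos (dist_pos.2 hxy)
  obtain ⟨c₁, c₂, hc, hw⟩ := exists_circle_split x hr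
  have hxS : ∀ z ∈ Metric.sphere x r, z - x ≠ 0 := by
    intro z hz h0
    rw [mem_sphere_iff_norm, h0, norm_zero] at hz
    exact hr.ne hz
  have hyS : ∀ z ∈ Metric.sphere x r, z - y ≠ 0 := by
    intro z hz h0
    rw [Metric.mem_sphere, sub_eq_zero.1 h0, dist_comm] at hz
    have : r = dist x y / 2 := rfl
    linarith
  have hyl : HasLog (fun z => z - y) (Metric.sphere x r) := by
    refine ((hasLog_const (sub_ne_zero.2 hxy) _).mul
      (hasLog_slitPlane (f := fun z => 1 - (x - z) / (x - y)) (by fun_prop)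
        fun z hz => ?_)).congr fun z _ => ?_
    · apply mem_slitPlane_one_sub
      rw [norm_div, ← dist_eq_norm, ← dist_eq_norm, dist_comm, div_lt_one (dist_pos.2 hxy)]
      rw [Metric.mem_sphere] at hz
      rw [hz]; exact half_lt_self (dist_pos.2 hxy)
    · have := sub_ne_zero.2 hxy
      field_simp; ring
  have cx := continuousOn_sub_const' (Metric.sphere x r) x
  have cy := continuousOn_sub_const' (Metric.sphere x r) y
  have hS1 : (Metric.sphere x r) ⊆ b₁ᶜ ∪ b₂ᶜ := by
    intro z hz
    by_contra hcon
    simp only [mem_union, mem_compl_iff, not_or, not_not] at hcon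
    have : z ∈ b₁ ∩ b₂ := hcon
    rw [h.2.2.1] at this
    rcases this with rfl | rfl
    · exact hxS _ hz (sub_self _)
    · exact hyS _ hz (sub_self _)
  have glue : ∀ {G₁ G₂ : ℂ → ℂ}, ContinuousOn G₁ b₁ᶜ → ContinuousOn G₂ b₂ᶜ →
      (∀ z, z ∉ C → G₁ z = G₂ z) → ContinuousOn (fun z => if z ∈ b₁ᶜ then G₁ z else G₂ z)
        (Metric.sphere x r) := by
    intro G₁ G₂ h1 h2 h12
    have o1 : IsOpen b₁ᶜ := h.1.isClosed.isOpen_compl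
    have o2 : IsOpen b₂ᶜ := h.2.1.isClosed.isOpen_compl
    intro z hz
    refine ContinuousAt.continuousWithinAt ?_
    by_cases hz1 : z ∈ b₁ᶜ
    · exact (h1.continuousAt (o1.mem_nhds hz1)).congr
        (Filter.eventuallyEq_of_mem (o1.mem_nhds hz1) fun w hw => (if_pos hw).symm)
    · have hz2 : z ∈ b₂ᶜ := (hS1 hz).resolve_left hz1
      refine (h2.continuousAt (o2.mem_nhds hz2)).congr
        (Filter.eventuallyEq_of_mem (o2.mem_nhds hz2) fun w hw => ?_)
      by_cases hw1 : w ∈ b₁ᶜ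
      · simp only [hw1, if_true]
        exact (h12 w (by rw [← h.2.2.2]; rintro (h' | h'); exacts [hw1 h', hw h'])).symm
      · exact (if_neg hw1).symm
  set E₁ : ℂ → ℂ := fun q => incr (fun z => z - q) b₁ x y
  set E₂ : ℂ → ℂ := fun q => incr (fun z => z - q) b₂ x y
  have hE1 : ContinuousOn E₁ b₁ᶜ := fun p hp => (continuousAt_incr h.1 hp).continuousWithinAt
  have hE2 : ContinuousOn E₂ b₂ᶜ := fun p hp => (continuousAt_incr h.2.1 hp).continuousWithinAt
  have eE1 : ∀ p ∉ b₁, Complex.exp (E₁ p) = (p - x) / (p - y) := fun p hp => by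
    rw [h.1.exp_incr (h.1.hasLog (continuousOn_sub_const' _ _) (sub_ne_zero_of_notMem hp)),
      ← neg_sub p x, ← neg_sub p y, neg_div_neg_eq]
  have eE2 : ∀ p ∉ b₂, Complex.exp (E₂ p) = (p - x) / (p - y) := fun p hp => by
    rw [h.2.1.exp_incr (h.2.1.hasLog (continuousOn_sub_const' _ _) (sub_ne_zero_of_notMem hp)),
      ← neg_sub p x, ← neg_sub p y, neg_div_neg_eq]
  have hE12 : ∀ z ∉ C, ∃ k : ℤ, E₁ z = E₂ z + k * (d * (2 * Real.pi * Complex.I)) := by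
    intro z hz
    obtain ⟨k, hk⟩ := hdall z hz
    exact ⟨k, by rw [← hk, wind]; ring⟩
  have hdne : d ≠ 0 := by
    rintro rfl
    have hl : HasLog (fun z => (z - x) / (z - y)) (Metric.sphere x r) := by
      refine ⟨_, glue hE1 hE2 fun z hz => ?_, fun z hz => ?_⟩
      · obtain ⟨k, hk⟩ := hE12 z hz
        simpa using hk
      · split_ifs with h'
        · exact eE1 z h'
        · exact eE2 z ((hS1 hz).resolve_left h')
    have := (hl.mul hyl).congr (g := fun z => (z - x) ^ (1 : ℤ)) fun z hz => by
      rw [div_mul_cancel₀ _ (hyS z hz), zpow_one]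
    exact one_ne_zero (zpow_log_sphere hr this)
  have hdne' : (d : ℂ) ≠ 0 := by exact_mod_cast hdne
  have hGc := glue (G₁ := fun z => Complex.exp (E₁ z / d)) (G₂ := fun z => Complex.exp (E₂ z / d))
    (Complex.continuous_exp.comp_continuousOn (hE1.div_const _))
    (Complex.continuous_exp.comp_continuousOn (hE2.div_const _)) (fun z hz => by
      obtain ⟨k, hk⟩ := hE12 z hz
      rw [hk, Complex.exp_eq_exp_iff_exists_int]
      exact ⟨k, by field_simp⟩)
  set G : ℂ → ℂ := fun z => if z ∈ b₁ᶜ then Complex.exp (E₁ z / d) else Complex.exp (E₂ z / d)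
  have hG0 : ∀ z ∈ Metric.sphere x r, G z ≠ 0 := by
    intro z _
    simp only [G]; split_ifs <;> exact Complex.exp_ne_zero _
  have hGd : ∀ z ∈ Metric.sphere x r, G z ^ d = (z - x) ^ (1 : ℤ) * (z - y) ^ (-1 : ℤ) := by
    intro z hz
    have : (z - x) ^ (1 : ℤ) * (z - y) ^ (-1 : ℤ) = (z - x) / (z - y) := by
      simp [div_eq_mul_inv]
    rw [this]
    simp only [G]; split_ifs with h'
    · rw [← Complex.exp_int_mul, mul_div_cancel₀ _ hdne']; exact eE1 z h'
    · rw [← Complex.exp_int_mul, mul_div_cancel₀ _ hdne']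
      exact eE2 z ((hS1 hz).resolve_left h')
  obtain ⟨k, hk⟩ := hc.exists_int hGc hG0
  have w1 := hc.wind_mul_zpow hGc hG0 hGc hG0 d 0
  have w2 := hc.wind_mul_zpow cx hxS cy hyS 1 (-1)
  rw [hw, (hc.hasLog_iff cy hyS).1 hyl] at w2
  have w3 : wind (fun z => G z ^ d * G z ^ (0 : ℤ)) c₁ c₂ (x - r) (x + r) =
      wind (fun z => (z - x) ^ (1 : ℤ) * (z - y) ^ (-1 : ℤ)) c₁ c₂ (x - r) (x + r) := by
    have hl : ∀ c, c = c₁ ∨ c = c₂ → HasLog (fun z => G z ^ d * G z ^ (0 : ℤ)) c := by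
      have hcc : ContinuousOn (fun z => G z ^ d * G z ^ (0 : ℤ)) (Metric.sphere x r) :=
        (hGc.zpow₀ _ fun z hz => Or.inl (hG0 z hz)).mul (hGc.zpow₀ _ fun z hz => Or.inl (hG0 z hz))
      rintro c (rfl | rfl)
      · exact hc.1.hasLog (hcc.mono (hc.2.2.2 ▸ subset_union_left)) fun z hz =>
          mul_ne_zero (zpow_ne_zero _ (hG0 z (hc.2.2.2 ▸ Or.inl hz)))
            (zpow_ne_zero _ (hG0 z (hc.2.2.2 ▸ Or.inl hz)))
      · exact hc.2.1.hasLog (hcc.mono (hc.2.2.2 ▸ subset_union_right)) fun z hz =>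
          mul_ne_zero (zpow_ne_zero _ (hG0 z (hc.2.2.2 ▸ Or.inr hz)))
            (zpow_ne_zero _ (hG0 z (hc.2.2.2 ▸ Or.inr hz)))
    rw [wind, wind, hc.1.incr_congr (g := fun z => (z - x) ^ (1 : ℤ) * (z - y) ^ (-1 : ℤ))
        (hl _ (Or.inl rfl)) (fun z hz => by
          rw [zpow_zero, mul_one]; exact hGd z (hc.2.2.2 ▸ Or.inl hz)),
      hc.2.1.incr_congr (g := fun z => (z - x) ^ (1 : ℤ) * (z - y) ^ (-1 : ℤ))
        (hl _ (Or.inr rfl)) (fun z hz => by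
          rw [zpow_zero, mul_one]; exact hGd z (hc.2.2.2 ▸ Or.inr hz))]
  rw [w1, w2, hk] at w3
  have hpi : (2 * Real.pi * Complex.I) ≠ 0 := by simp [Real.pi_ne_zero]
  have h1 : (d : ℂ) * k = 1 := by
    apply mul_right_cancel₀ hpi
    linear_combination w3
  have h2 : d * k = 1 := by exact_mod_cast h1
  exact Int.eq_one_or_neg_one_of_mul_eq_one h2

end Jordan

section JordanTheta

variable {X : Type*} [TopologicalSpace X]

lemma IsArc.exists_sub_diff [T2Space X] {b : Set X} {x y : X} (h : IsArc b x y) {B : Set X}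
    (hB : B ∈ 𝓝 x) : ∃ t v, IsArc t v y ∧ t ⊆ b \ {x} ∧ b \ B ⊆ t := by
  obtain ⟨f, hf, hi, rfl, rfl, rfl⟩ := h
  have h0 : f ⁻¹' B ∈ 𝓝[Icc 0 1] (0 : ℝ) := hf 0 ⟨le_rfl, zero_le_one⟩ hB
  rw [mem_nhdsWithin_iff_exists_mem_nhds_inter] at h0
  obtain ⟨u, hu, hu'⟩ := h0
  obtain ⟨ε, hε, hεu⟩ := Metric.mem_nhds_iff.1 hu
  set δ := min (ε / 2) (1 / 2) with hδ
  have hδ0 : 0 < δ := by positivity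
  have hδ1 : δ < 1 := (min_le_right _ _).trans_lt (by norm_num)
  have hδε : δ < ε := (min_le_left _ _).trans_lt (by linarith)
  have hsub : Icc δ 1 ⊆ Icc (0 : ℝ) 1 := Icc_subset_Icc_left hδ0.le
  refine ⟨f '' Icc δ 1, f δ, isArc_of_Icc hδ1 (hf.mono hsub) (hi.mono hsub), ?_, ?_⟩
  · rintro _ ⟨s, hs, rfl⟩
    refine ⟨mem_image_of_mem _ (hsub hs), fun h => ?_⟩
    have := hi (hsub hs) ⟨le_rfl, zero_le_one⟩ h
    linarith [hs.1]
  · rintro _ ⟨⟨s, hs, rfl⟩, hsB⟩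
    refine mem_image_of_mem _ ⟨?_, hs.2⟩
    by_contra! hlt
    refine hsB (hu' ⟨hεu ?_, hs⟩)
    rw [Metric.mem_ball, Real.dist_eq, sub_zero, abs_of_nonneg hs.1]; linarith

lemma IsJordan.exists_arc_diff [T2Space X] {C : Set X} (hC : IsJordan C) {z : X} (hz : z ∈ C)
    {B : Set X} (hB : B ∈ 𝓝 z) : ∃ a u v, IsArc a u v ∧ a ⊆ C ∧ C \ B ⊆ a := by
  obtain ⟨w, hw, hwz⟩ := hC.exists_ne z
  obtain ⟨b₁, b₂, h₁, h₂, hi, rfl⟩ := hC.split hz hw hwz.symm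
  obtain ⟨t₁, v₁, ht₁, hs₁, hd₁⟩ := h₁.exists_sub_diff hB
  obtain ⟨t₂, v₂, ht₂, hs₂, hd₂⟩ := h₂.exists_sub_diff hB
  refine ⟨t₁ ∪ t₂, v₁, v₂, ht₁.trans ht₂.symm ?_, ?_, ?_⟩
  · refine Subset.antisymm (fun q hq => ?_) (singleton_subset_iff.2 ⟨ht₁.right_mem, ht₂.right_mem⟩)
    have : q ∈ ({z, w} : Set X) := hi ▸ ⟨(hs₁ hq.1).1, (hs₂ hq.2).1⟩
    exact this.resolve_left (hs₁ hq.1).2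
  · exact union_subset_union (hs₁.trans sdiff_subset) (hs₂.trans sdiff_subset)
  · rw [union_sdiff_distrib]; exact union_subset_union hd₁ hd₂

lemma IsJordan.hasLog_diff_nhds [T2Space X] {C : Set X} (hC : IsJordan C) {z : X} (hz : z ∈ C)
    {B : Set X} (hB : B ∈ 𝓝 z) {f : X → ℂ} (hf : ContinuousOn f C) (h0 : ∀ z ∈ C, f z ≠ 0) :
    HasLog f (C \ B) := by
  obtain ⟨a, u, v, ha, haC, hCa⟩ := hC.exists_arc_diff hz hB
  exact (ha.hasLog (hf.mono haC) fun z hz => h0 z (haC hz)).mono hCa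

lemma IsJordan.nonempty_inner {C : Set ℂ} (hC : IsJordan C) : (inner C).Nonempty := by
  obtain ⟨_, _, _, _, h⟩ := hC
  exact h.exists_wind.1

lemma IsJordan.closure_inner_subset {C : Set ℂ} (hC : IsJordan C) :
    closure (inner C) ⊆ C ∪ inner C :=
  closure_minimal subset_union_right hC.isCompact_closedInner.isClosed

lemma IsJordan.closure_outer_subset {C : Set ℂ} (hC : IsJordan C) :
    closure (outer C) ⊆ C ∪ outer C := by
  rw [← compl_inner]
  exact closure_minimal (compl_inner C ▸ subset_union_right) hC.isOpen_inner.isClosed_compl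

lemma IsJordan.subset_closure_inner {C : Set ℂ} (hC : IsJordan C) : C ⊆ closure (inner C) := by
  intro z hz
  by_contra h
  obtain ⟨p, hp⟩ := hC.nonempty_inner
  have hl := hC.hasLog_diff_nhds hz (isClosed_closure.isOpen_compl.mem_nhds h)
    (continuousOn_sub_const' C p) (sub_ne_zero_of_notMem hp.1)
  rw [sdiff_compl] at hl
  refine not_hasLog_of_frontier hC.isOpen_inner hC.isBounded_inner hp
    (hC.isClosed.inter isClosed_closure) (fun q hq => ⟨?_, hq.1⟩) hl
  exact (hC.closure_inner_subset hq.1).resolve_right fun h' =>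
    hq.2 (hC.isOpen_inner.interior_eq.symm ▸ h')

lemma IsJordan.disjoint_inner_closure_outer {C : Set ℂ} (hC : IsJordan C) :
    Disjoint (inner C) (closure (outer C)) :=
  Disjoint.closure_right (disjoint_left.2 fun _ hp hq => hp.2 hq) hC.isOpen_inner

lemma IsJordan.subset_closure_outer {C : Set ℂ} (hC : IsJordan C) : C ⊆ closure (outer C) := by
  intro z hz
  by_contra h
  obtain ⟨p, hp⟩ := hC.nonempty_inner
  set U := (closure (outer C))ᶜ with hU
  have hUo : IsOpen U := isClosed_closure.isOpen_compl
  have hl := hC.hasLog_diff_nhds hz (hUo.mem_nhds h)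
    (continuousOn_sub_const' C p) (sub_ne_zero_of_notMem hp.1)
  have hUs : U ⊆ C ∪ inner C := by
    intro q hq
    by_contra hq'
    have : q ∈ (inner C)ᶜ := fun h => hq' (Or.inr h)
    rw [compl_inner] at this
    exact this.elim (fun h => hq' (Or.inl h)) fun h => hq (subset_closure h)
  refine not_hasLog_of_frontier hUo (hC.isCompact_closedInner.isBounded.subset hUs)
    (disjoint_left.1 hC.disjoint_inner_closure_outer hp)
    (K := C \ U) (by rw [hU, sdiff_compl]; exact hC.isClosed.inter isClosed_closure)
    (fun q hq => ⟨?_, fun h' => hq.2 (hUo.interior_eq.symm ▸ h')⟩) hl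
  rw [hU, frontier_compl] at hq
  have h1 := frontier_closure_subset hq
  exact (hC.closure_outer_subset h1.1).resolve_right fun h' =>
    h1.2 (hC.isOpen_outer.interior_eq.symm ▸ h')

lemma mem_outer_of_re {C : Set ℂ} {p c : ℂ} (hp : p ∉ C) (hc : c ≠ 0)
    (h : ∀ z ∈ C, 0 ≤ (c * (z - p)).re) : p ∈ outer C := by
  refine ((hasLog_const (inv_ne_zero hc) C).mul
    (hasLog_slitPlane (f := fun z => c * (z - p)) (by fun_prop) fun z hz => ?_)).congr fun z _ => ?_
  · exact mem_slitPlane_of_re_nonneg (mul_ne_zero hc (sub_ne_zero_of_notMem hp z hz)) (h z hz)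
  · field_simp

lemma inner_subset_im_pos {C : Set ℂ} (h : C ⊆ {z | 0 ≤ z.im}) : inner C ⊆ {z | 0 < z.im} := by
  intro p hp
  by_contra hp'
  rw [mem_ofPred_eq, not_lt] at hp'
  refine hp.2 (mem_outer_of_re hp.1 (c := -Complex.I) (by simp) fun z hz => ?_)
  have : 0 ≤ z.im := h hz
  simp; linarith

/-- A Jordan curve together with its inside is a retract of the plane. -/
lemma IsJordan.exists_retraction {C : Set ℂ} (hC : IsJordan C) :
    ∃ r : ℂ → ℂ, Continuous r ∧ (∀ z ∈ C ∪ inner C, r z = z) ∧ ∀ z, r z ∈ C ∪ inner C := by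
  classical
  obtain ⟨x, y, b₁, b₂, h⟩ := id hC
  obtain ⟨⟨p, hp⟩, d, hd, hw⟩ := h.exists_wind
  obtain ⟨c₁, c₂, hc, hcw⟩ := exists_circle_split 0 one_pos
  obtain ⟨g, hg, hgi, hgC, hgx, hgy, hg₁, hg₂⟩ := h.exists_map hc
  have hg0 : ∀ z ∈ C, g z ≠ 0 := fun z hz h0 => by
    have : g z ∈ Metric.sphere (0 : ℂ) 1 := hgC ▸ mem_image_of_mem g hz
    simp [h0] at this
  have hs0 : ∀ z ∈ Metric.sphere (0 : ℂ) 1, z - 0 ≠ 0 := fun z hz h0 => by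
    rw [sub_zero] at h0; simp [h0] at hz
  have hsub : b₁ ⊆ C ∧ b₂ ⊆ C := ⟨h.2.2.2 ▸ subset_union_left, h.2.2.2 ▸ subset_union_right⟩
  have hwg : wind g b₁ b₂ x y = 2 * Real.pi * Complex.I := by
    have e1 := h.1.incr_comp hc.1 (hg.mono hsub.1) (fun z hz => hg₁ ▸ mem_image_of_mem g hz) hgx hgy
      (hc.1.hasLog (f := fun z => z - 0) (by fun_prop) fun z hz =>
        hs0 z (hc.2.2.2 ▸ Or.inl hz))
    have e2 := h.2.1.incr_comp hc.2.1 (hg.mono hsub.2) (fun z hz => hg₂ ▸ mem_image_of_mem g hz)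
      hgx hgy (hc.2.1.hasLog (f := fun z => z - 0) (by fun_prop) fun z hz =>
        hs0 z (hc.2.2.2 ▸ Or.inr hz))
    rw [← hcw, wind, wind, ← e1, ← e2]
    simp only [sub_zero]
  have hcp := continuousOn_sub_const' C p
  have hp0 := sub_ne_zero_of_notMem hp.1
  have hwt := h.wind_mul_zpow hg hg0 hcp hp0 1 (-d)
  rw [hwg, hw p hp] at hwt
  have hlog : HasLog (fun z => g z ^ (1 : ℤ) * (z - p) ^ (-d)) C := by
    refine (h.hasLog_iff (f := fun z => g z ^ (1 : ℤ) * (z - p) ^ (-d)) ((hg.zpow₀ _ fun z hz => Or.inl (hg0 z hz)).mul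
      (hcp.zpow₀ _ fun z hz => Or.inl (hp0 z hz))) fun z hz =>
        mul_ne_zero (zpow_ne_zero _ (hg0 z hz)) (zpow_ne_zero _ (hp0 z hz))).2 ?_
    rw [hwt]
    rcases hd with rfl | rfl <;> push_cast <;> ring
  obtain ⟨u, hu, hu'⟩ := hlog.tietze hC.isClosed
  set F : ℂ → ℂ := fun z => Complex.exp (u z) * (z - p) ^ d with hF
  have hFc : ContinuousOn F (inner C)ᶜ := by
    refine (Complex.continuous_exp.comp hu).continuousOn.mul (ContinuousOn.zpow₀ (by fun_prop) _ ?_)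
    exact fun z hz => Or.inl (sub_ne_zero.2 fun h => hz (h ▸ hp))
  have hF0 : ∀ z ∈ (inner C)ᶜ, F z ≠ 0 := fun z hz =>
    mul_ne_zero (Complex.exp_ne_zero _) (zpow_ne_zero _ (sub_ne_zero.2 fun h => hz (h ▸ hp)))
  have hFC : ∀ z ∈ C, F z = g z := fun z hz => by
    simp only [hF]; rw [hu' z hz, zpow_one, mul_assoc, ← zpow_add₀ (hp0 z hz)]; simp
  set g' := Function.invFunOn g C
  have hg'l : LeftInvOn g' g C := hgi.leftInvOn_invFunOn
  have hg'c : ContinuousOn g' (Metric.sphere 0 1) :=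
    hgC ▸ continuousOn_of_leftInvOn_compact hC.isCompact hg hg'l
  have hρ : ∀ z ∈ (inner C)ᶜ, F z / ‖F z‖ ∈ Metric.sphere (0 : ℂ) 1 := fun z hz => by
    simp [hF0 z hz]
  have hL : ContinuousOn (fun z => g' (F z / ‖F z‖)) (inner C)ᶜ := by
    refine hg'c.comp (hFc.div ?_ fun z hz => ?_) hρ
    · exact Complex.continuous_ofReal.comp_continuousOn hFc.norm
    · exact_mod_cast norm_ne_zero_iff.2 (hF0 z hz)
  have hglue := continuousOn_glue_closed (u := id) continuousOn_id hL
    hC.isCompact_closedInner.isClosed hC.isOpen_inner.isClosed_compl (by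
      rintro z ⟨hz | hz, hz'⟩
      · have : ‖g z‖ = 1 := by
          have : g z ∈ Metric.sphere (0 : ℂ) 1 := hgC ▸ mem_image_of_mem g hz
          simpa using this
        simp only [id, hFC z hz, this]
        simpa using (hg'l hz).symm
      · exact absurd hz hz')
  refine ⟨fun z => if z ∈ C ∪ inner C then z else g' (F z / ‖F z‖), ?_,
    fun z hz => if_pos hz, fun z => ?_⟩
  · rw [← continuousOn_univ]
    refine hglue.mono fun z _ => ?_
    by_cases h : z ∈ inner C
    exacts [Or.inl (Or.inr h), Or.inr h]
  · dsimp only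
    split_ifs with hz
    · exact hz
    · left
      have hz' : z ∈ (inner C)ᶜ := fun h => hz (Or.inr h)
      obtain ⟨w, hw, hw'⟩ := hgC.symm ▸ hρ z hz'
      rw [← hw', hg'l hw]; exact hw

/-- A closed Jordan domain deformation retracts onto any arc in its boundary curve. -/
lemma IsJordan.exists_sdr {C A : Set ℂ} {x y : ℂ} (hC : IsJordan C) (hA : IsArc A x y)
    (hAC : A ⊆ C) : ∃ h : ℝ → ℂ → ℂ, Continuous (fun q : ℝ × ℂ => h q.1 q.2) ∧
      (∀ z ∈ C ∪ inner C, h 0 z = z) ∧ (∀ t z, h t z ∈ C ∪ inner C) ∧ (∀ z, h 1 z ∈ A) ∧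
      ∀ t, ∀ z ∈ A, h t z = z := by
  obtain ⟨r, hr, hrE, hrm⟩ := hC.exists_retraction
  obtain ⟨f, τ, hf, hτ, hfA, -, -, -, hτA⟩ := hA.exists_param_inv
  obtain ⟨τ', hτ'⟩ := ContinuousMap.exists_restrict_eq hA.isClosed ⟨A.domRestrict τ, hτ.domRestrict⟩
  have hτ'' : ∀ z ∈ A, τ' z = τ z := fun z hz => congrArg (fun F => F ⟨z, hz⟩) hτ'
  set r₀ : ℂ → ℂ := fun z => f (max 0 (min 1 (τ' z)))
  have hcl : ∀ s : ℝ, max 0 (min 1 s) ∈ Icc (0 : ℝ) 1 := fun s =>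
    ⟨le_max_left _ _, max_le zero_le_one (min_le_left _ _)⟩
  have hr₀ : Continuous r₀ := by
    refine hf.comp_continuous ?_ fun z => hcl _
    have := τ'.continuous
    fun_prop
  have hr₀A : ∀ z, r₀ z ∈ A := fun z => hfA ▸ mem_image_of_mem f (hcl _)
  have hr₀f : ∀ z ∈ A, r₀ z = z := fun z hz => by
    have h1 := (hτA z hz).1
    simp only [r₀]; rw [hτ'' z hz, min_eq_right h1.2, max_eq_right h1.1, (hτA z hz).2]
  refine ⟨fun t z => r ((1 - t) * z + t * r₀ z), by fun_prop, fun z hz => ?_, fun t z => hrm _,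
    fun z => ?_, fun t z hz => ?_⟩
  · simpa using hrE z hz
  · simp only [Complex.ofReal_one, sub_self, zero_mul, one_mul, zero_add]
    rw [hrE _ (Or.inl (hAC (hr₀A z)))]; exact hr₀A z
  · dsimp only
    rw [hr₀f z hz]
    have : (1 - (t : ℂ)) * z + t * z = z := by ring
    rw [this]; exact hrE z (Or.inl (hAC hz))

variable {C a b₁ b₂ : Set ℂ} {x y : ℂ}

lemma JSplit.theta_left {X : Type*} [TopologicalSpace X] {C a b₁ b₂ : Set X} {x y : X}
    (h : JSplit C x y b₁ b₂) (ha : IsArc a x y) (haC : a ∩ C ⊆ {x, y}) :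
    JSplit (a ∪ b₁) x y a b₁ :=
  ⟨ha, h.1, Subset.antisymm (fun _ hz => haC ⟨hz.1, h.2.2.2 ▸ Or.inl hz.2⟩)
    (subset_inter ha.ends_subset h.1.ends_subset), rfl⟩

lemma inter_ends_of_diff_subset_inner (haC : a \ {x, y} ⊆ inner C) : a ∩ C ⊆ {x, y} := by
  rintro z ⟨hz, hzC⟩
  by_contra h
  exact (haC ⟨hz, h⟩).1 hzC

lemma JSplit.theta_inner_subset (h : JSplit C x y b₁ b₂) (ha : IsArc a x y)
    (haC : a \ {x, y} ⊆ inner C) : inner (a ∪ b₁) ⊆ inner C := by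
  have hC := h.isJordan
  have hC₁ := (h.theta_left ha (inter_ends_of_diff_subset_inner haC)).isJordan
  have hout : Disjoint (inner (a ∪ b₁)) (outer C) := by
    rw [disjoint_left]
    intro p hp hp'
    refine not_hasLog_of_frontier (hC₁.isOpen_inner.inter hC.isOpen_outer)
      (hC₁.isBounded_inner.subset inter_subset_left) ⟨hp, hp'⟩ hC.isClosed (fun z hz => ?_) hp'
    have hzU : z ∉ inner (a ∪ b₁) ∩ outer C := fun h' =>
      hz.2 ((hC₁.isOpen_inner.inter hC.isOpen_outer).interior_eq.symm ▸ h')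
    have h1 := hC₁.closure_inner_subset (closure_mono inter_subset_left hz.1)
    have h2' := closure_mono inter_subset_right hz.1
    have h2 := hC.closure_outer_subset h2'
    rcases h1 with (h1 | h1) | h1
    · by_cases he : z ∈ ({x, y} : Set ℂ)
      · rcases he with rfl | rfl
        exacts [h.left_mem, h.right_mem]
      · exact absurd h2' (disjoint_left.1 hC.disjoint_inner_closure_outer (haC ⟨h1, he⟩))
    · exact h.2.2.2 ▸ Or.inl h1
    · exact h2.resolve_right fun h' => hzU ⟨h1, h'⟩
  intro p hp
  by_contra hpi
  have hpi' : p ∈ C ∪ outer C := compl_inner C ▸ hpi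
  rcases hpi' with hpC | hpo
  · obtain ⟨q, hq, hq'⟩ := mem_closure_iff.1 (hC.subset_closure_outer hpC) _ hC₁.isOpen_inner hp
    exact disjoint_left.1 hout hq hq'
  · exact disjoint_left.1 hout hp hpo

/-- An arc across a Jordan domain cuts it into two Jordan domains. -/
lemma JSplit.theta (h : JSplit C x y b₁ b₂) (ha : IsArc a x y) (haC : a \ {x, y} ⊆ inner C) :
    inner C \ a = inner (a ∪ b₁) ∪ inner (a ∪ b₂) ∧
      Disjoint (inner (a ∪ b₁)) (inner (a ∪ b₂)) := by
  have hae := inter_ends_of_diff_subset_inner haC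
  have h₁ := h.theta_left ha hae
  have h₂ := h.swap.theta_left ha hae
  obtain ⟨-, d, hd, hw⟩ := h.exists_wind
  obtain ⟨-, d₁, hd₁, hw₁⟩ := h₁.exists_wind
  obtain ⟨-, d₂, hd₂, hw₂⟩ := h₂.exists_wind
  have hs₁ := h.theta_inner_subset ha haC
  have hs₂ := h.swap.theta_inner_subset ha haC
  have hpi : (2 * Real.pi * Complex.I) ≠ 0 := by simp [Real.pi_ne_zero]
  have hval : ∀ p, wind (fun z => z - p) b₁ b₂ x y =
      wind (fun z => z - p) a b₂ x y - wind (fun z => z - p) a b₁ x y := fun p => by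
    simp only [wind]; ring
  have key : ∀ p ∈ inner C, p ∉ a → ¬ (p ∈ inner (a ∪ b₁) ↔ p ∈ inner (a ∪ b₂)) := by
    intro p hp hpa hiff
    have hn₁ : p ∉ a ∪ b₁ := fun h' => h'.elim hpa fun h' => hp.1 (h.2.2.2 ▸ Or.inl h')
    have hn₂ : p ∉ a ∪ b₂ := fun h' => h'.elim hpa fun h' => hp.1 (h.2.2.2 ▸ Or.inr h')
    have hv := hval p
    rw [hw p hp] at hv
    by_cases hp₁ : p ∈ inner (a ∪ b₁)
    · rw [hw₁ p hp₁, hw₂ p (hiff.1 hp₁)] at hv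
      have : (d : ℂ) = d₂ - d₁ := mul_right_cancel₀ hpi (by linear_combination hv)
      have : d = d₂ - d₁ := by exact_mod_cast this
      omega
    · have h1 : p ∈ outer (a ∪ b₁) := by_contra fun h' => hp₁ ⟨hn₁, h'⟩
      have h2 : p ∈ outer (a ∪ b₂) := by_contra fun h' => hp₁ (hiff.2 ⟨hn₂, h'⟩)
      rw [(h₁.mem_outer_iff hn₁).1 h1, (h₂.mem_outer_iff hn₂).1 h2, sub_zero] at hv
      have := (mul_eq_zero.1 hv).resolve_right hpi
      have : d = 0 := by exact_mod_cast this
      omega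
  constructor
  · ext p
    constructor
    · rintro ⟨hp, hpa⟩
      have := key p hp hpa
      by_contra h'
      rw [mem_union] at h'
      tauto
    · rintro (hp | hp)
      · exact ⟨hs₁ hp, fun h' => hp.1 (Or.inl h')⟩
      · exact ⟨hs₂ hp, fun h' => hp.1 (Or.inl h')⟩
  · rw [disjoint_left]
    intro p hp hp'
    exact key p (hs₁ hp) (fun h' => hp.1 (Or.inl h')) (iff_of_true hp hp')

end JordanTheta

section Disc

variable {X Y : Type*} [TopologicalSpace X] [TopologicalSpace Y]

lemma JSplit.image {C : Set X} {x y : X} {b₁ b₂ : Set X} (h : JSplit C x y b₁ b₂) {g : X → Y}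
    (hg : ContinuousOn g C) (hi : InjOn g C) :
    JSplit (g '' C) (g x) (g y) (g '' b₁) (g '' b₂) := by
  have h₁ : b₁ ⊆ C := h.2.2.2 ▸ subset_union_left
  have h₂ : b₂ ⊆ C := h.2.2.2 ▸ subset_union_right
  refine ⟨h.1.image (hg.mono h₁) (hi.mono h₁), h.2.1.image (hg.mono h₂) (hi.mono h₂), ?_, ?_⟩
  · rw [← hi.image_inter h₁ h₂, h.2.2.1, image_pair]
  · rw [← image_union, h.2.2.2]

lemma IsJordan.image {C : Set X} (h : IsJordan C) {g : X → Y}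
    (hg : ContinuousOn g C) (hi : InjOn g C) : IsJordan (g '' C) := by
  obtain ⟨x, y, b₁, b₂, h⟩ := h
  exact (h.image hg hi).isJordan

/-- `F` is an open disc in `X`, bounded by the Jordan curve `J`. -/
def IsDisc (F J : Set X) : Prop :=
  ∃ (φ : ℂ → X) (C : Set ℂ), IsJordan C ∧ ContinuousOn φ (C ∪ inner C) ∧
    InjOn φ (C ∪ inner C) ∧ φ '' inner C = F ∧ φ '' C = J ∧ IsOpen F

variable {F J : Set X}

lemma IsDisc.isOpen (h : IsDisc F J) : IsOpen F := by
  obtain ⟨_, _, _, _, _, _, _, h⟩ := h; exact h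

lemma IsDisc.isPreconnected (h : IsDisc F J) : IsPreconnected F := by
  obtain ⟨φ, C, hC, hφ, -, rfl, -, -⟩ := h
  exact hC.isPreconnected_inner.image _ (hφ.mono subset_union_right)

lemma IsDisc.nonempty (h : IsDisc F J) : F.Nonempty := by
  obtain ⟨φ, C, hC, hφ, -, rfl, -, -⟩ := h
  exact hC.nonempty_inner.image _

lemma IsDisc.disjoint (h : IsDisc F J) : Disjoint F J := by
  obtain ⟨φ, C, hC, hφ, hi, rfl, rfl, -⟩ := h
  rw [disjoint_left]
  rintro _ ⟨p, hp, rfl⟩ ⟨q, hq, hqp⟩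
  exact hp.1 (hi (Or.inl hq) (Or.inr hp) hqp ▸ hq)

lemma IsDisc.isJordan (h : IsDisc F J) : IsJordan J := by
  obtain ⟨φ, C, hC, hφ, hi, rfl, rfl, -⟩ := h
  exact hC.image (hφ.mono subset_union_left) (hi.mono subset_union_left)

lemma IsDisc.isCompact (h : IsDisc F J) : IsCompact (F ∪ J) := by
  obtain ⟨φ, C, hC, hφ, hi, rfl, rfl, -⟩ := h
  rw [← image_union, union_comm]
  exact hC.isCompact_closedInner.image_of_continuousOn hφ

lemma IsDisc.subset_closure (h : IsDisc F J) : J ⊆ closure F := by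
  obtain ⟨φ, C, hC, hφ, hi, rfl, rfl, -⟩ := h
  rintro _ ⟨p, hp, rfl⟩
  have h1 : ContinuousWithinAt φ (inner C) p :=
    (hφ p (Or.inl hp)).mono subset_union_right
  exact h1.mem_closure_image (hC.subset_closure_inner hp)

lemma IsDisc.closure_eq [T2Space X] (h : IsDisc F J) : closure F = F ∪ J :=
  Subset.antisymm (closure_minimal subset_union_left h.isCompact.isClosed)
    (union_subset _root_.subset_closure h.subset_closure)

lemma isOpen_image_of_injOn_compact [T2Space Y] {φ : X → Y} {E D W : Set X} (hE : IsCompact E)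
    (hφ : ContinuousOn φ E) (hi : InjOn φ E) (hD : D ⊆ E) (hDo : IsOpen (φ '' D)) (hW : IsOpen W)
    (hWD : W ⊆ D) : IsOpen (φ '' W) := by
  have : φ '' W = φ '' D ∩ (φ '' (E \ W))ᶜ := by
    apply Subset.antisymm
    · rintro _ ⟨p, hp, rfl⟩
      refine ⟨mem_image_of_mem _ (hWD hp), ?_⟩
      rintro ⟨q, hq, hqp⟩
      exact hq.2 (hi hq.1 (hD (hWD hp)) hqp ▸ hp)
    · rintro _ ⟨⟨p, hp, rfl⟩, hn⟩
      by_contra hp'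
      exact hn ⟨p, ⟨hD hp, fun h => hp' ⟨p, h, rfl⟩⟩, rfl⟩
  rw [this]
  exact hDo.inter ((hE.diff hW).image_of_continuousOn (hφ.mono sdiff_subset)).isClosed.isOpen_compl

lemma IsDisc.exists_sdr [T2Space X] (h : IsDisc F J) {A : Set X} {x y : X} (hA : IsArc A x y)
    (hAJ : A ⊆ J) : ∃ H : ℝ → X → X, ContinuousOn (fun q : ℝ × X => H q.1 q.2) (univ ×ˢ (F ∪ J)) ∧
      (∀ z ∈ F ∪ J, H 0 z = z) ∧ (∀ t, ∀ z ∈ F ∪ J, H t z ∈ F ∪ J) ∧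
      (∀ z ∈ F ∪ J, H 1 z ∈ A) ∧ ∀ t, ∀ z ∈ A, H t z = z := by
  obtain ⟨φ, C, hC, hφ, hi, rfl, rfl, -⟩ := h
  rw [← image_union, union_comm]
  set ψ := Function.invFunOn φ (C ∪ inner C)
  have hψ : LeftInvOn ψ φ (C ∪ inner C) := hi.leftInvOn_invFunOn
  have hψc : ContinuousOn ψ (φ '' (C ∪ inner C)) :=
    continuousOn_of_leftInvOn_compact hC.isCompact_closedInner hφ hψ
  have hsub : φ '' C ⊆ φ '' (C ∪ inner C) := image_mono subset_union_left
  have hAi : InjOn ψ A := by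
    intro u hu v hv huv
    obtain ⟨p, hp, rfl⟩ := hsub (hAJ hu)
    obtain ⟨q, hq, rfl⟩ := hsub (hAJ hv)
    rw [hψ hp, hψ hq] at huv
    rw [huv]
  have hA' := hA.image (hψc.mono (hAJ.trans hsub)) hAi
  have hA'C : ψ '' A ⊆ C := by
    rintro _ ⟨z, hz, rfl⟩
    obtain ⟨p, hp, rfl⟩ := hAJ hz
    rw [hψ (Or.inl hp)]; exact hp
  obtain ⟨h, hh, h0, hm, h1, hfix⟩ := hC.exists_sdr hA' hA'C
  refine ⟨fun t z => φ (h t (ψ z)), ?_, ?_, ?_, ?_, ?_⟩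
  · refine hφ.comp (hh.comp_continuousOn (continuousOn_fst.prodMk (hψc.comp continuousOn_snd ?_)))
      fun q _ => hm _ _
    exact fun q hq => hq.2
  · rintro _ ⟨p, hp, rfl⟩
    simp only [hψ hp, h0 p hp]
  · rintro t _ ⟨p, hp, rfl⟩
    exact mem_image_of_mem _ (hm _ _)
  · rintro z ⟨p, hp, rfl⟩
    obtain ⟨w, hw, hw'⟩ := h1 (ψ (φ p))
    obtain ⟨q, hq, rfl⟩ := hAJ hw
    simp only [← hw', hψ (Or.inl hq)]; exact hw
  · intro t z hz
    obtain ⟨p, hp, rfl⟩ := hAJ hz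
    simp only
    rw [hfix t _ (mem_image_of_mem _ hz), hψ (Or.inl hp)]

/-- An arc across a disc cuts it into two discs. -/
lemma IsDisc.theta [T2Space X] (h : IsDisc F J) {x y : X} {b₁ b₂ a : Set X}
    (hJ : JSplit J x y b₁ b₂) (ha : IsArc a x y) (haF : a \ {x, y} ⊆ F) :
    ∃ F₁ F₂, IsDisc F₁ (a ∪ b₁) ∧ IsDisc F₂ (a ∪ b₂) ∧ F \ a = F₁ ∪ F₂ ∧ Disjoint F₁ F₂ := by
  obtain ⟨φ, C, hC, hφ, hi, rfl, rfl, hF⟩ := h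
  set E := C ∪ inner C
  set ψ := Function.invFunOn φ E
  have hψ : LeftInvOn ψ φ E := hi.leftInvOn_invFunOn
  have hψc : ContinuousOn ψ (φ '' E) :=
    continuousOn_of_leftInvOn_compact hC.isCompact_closedInner hφ hψ
  have hr : ∀ z ∈ φ '' E, φ (ψ z) = z := by rintro _ ⟨p, hp, rfl⟩; rw [hψ hp]
  have hψi : InjOn ψ (φ '' E) := fun u hu v hv huv => by rw [← hr u hu, huv, hr v hv]
  have hCE : C ⊆ E := subset_union_left
  have haE : a ⊆ φ '' E := by
    intro z hz
    by_cases he : z ∈ ({x, y} : Set X)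
    · rcases he with rfl | rfl
      exacts [image_mono hCE hJ.left_mem, image_mono hCE hJ.right_mem]
    · exact image_mono subset_union_right (haF ⟨hz, he⟩)
  have hψC : ψ '' (φ '' C) = C := by
    rw [← image_comp]
    exact (image_congr fun p hp => hψ (hCE hp)).trans (image_id _)
  have hJ' := hJ.image (hψc.mono (image_mono hCE)) (hψi.mono (image_mono hCE))
  rw [hψC] at hJ'
  have ha' := ha.image (hψc.mono haE) (hψi.mono haE)
  have haC : ψ '' a \ {ψ x, ψ y} ⊆ inner C := by
    rintro _ ⟨⟨z, hz, rfl⟩, hne⟩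
    obtain ⟨p, hp, rfl⟩ := haF ⟨hz, fun h => hne (by rcases h with rfl | rfl <;> simp)⟩
    rw [hψ (Or.inr hp)]; exact hp
  have hsub : ∀ s ⊆ φ '' E, φ '' (ψ '' s) = s := fun s hs => by
    rw [← image_comp]
    exact (image_congr fun p hp => hr p (hs hp)).trans (image_id _)
  have hb₁ : b₁ ⊆ φ '' E := fun z hz => image_mono hCE (hJ.2.2.2 ▸ Or.inl hz)
  have hb₂ : b₂ ⊆ φ '' E := fun z hz => image_mono hCE (hJ.2.2.2 ▸ Or.inr hz)
  obtain ⟨hun, hdisj⟩ := hJ'.theta ha' haC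
  have hae := inter_ends_of_diff_subset_inner haC
  have mk : ∀ b c, JSplit C (ψ x) (ψ y) (ψ '' b) c → b ⊆ φ '' E →
      IsDisc (φ '' inner (ψ '' a ∪ ψ '' b)) (a ∪ b) := by
    intro b c hbc hbE
    have hin := hbc.theta_inner_subset ha' haC
    have hJc := (hbc.theta_left ha' hae).isJordan
    have hs : ψ '' a ∪ ψ '' b ∪ inner (ψ '' a ∪ ψ '' b) ⊆ E := by
      refine union_subset (union_subset ?_ ?_) (hin.trans subset_union_right)
      · rintro _ ⟨z, hz, rfl⟩
        obtain ⟨p, hp, rfl⟩ := haE hz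
        rwa [hψ hp]
      · rintro _ ⟨z, hz, rfl⟩
        obtain ⟨p, hp, rfl⟩ := hbE hz
        rwa [hψ hp]
    refine ⟨φ, _, hJc, hφ.mono hs, hi.mono hs, rfl, ?_, ?_⟩
    · rw [image_union, hsub a haE, hsub b hbE]
    · exact isOpen_image_of_injOn_compact hC.isCompact_closedInner hφ hi subset_union_right hF
        hJc.isOpen_inner hin
  refine ⟨_, _, mk b₁ _ hJ' hb₁, mk b₂ _ hJ'.swap hb₂, ?_, ?_⟩
  · rw [← image_union, ← hun]
    apply Subset.antisymm
    · rintro _ ⟨⟨p, hp, rfl⟩, hpa⟩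
      refine ⟨p, ⟨hp, ?_⟩, rfl⟩
      rintro ⟨z, hz, rfl⟩
      rw [hr z (haE hz)] at hpa
      exact hpa hz
    · rintro _ ⟨p, ⟨hp, hpa⟩, rfl⟩
      refine ⟨mem_image_of_mem _ hp, fun h => hpa ⟨_, h, hψ (Or.inr hp)⟩⟩
  · rw [disjoint_left]
    rintro _ ⟨p, hp, rfl⟩ ⟨q, hq, hqp⟩
    have hp' := hJ'.theta_inner_subset ha' haC hp
    have hq' := hJ'.swap.theta_inner_subset ha' haC hq
    exact disjoint_left.1 hdisj hp (hi (Or.inr hq') (Or.inr hp') hqp ▸ hq)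

end Disc

section Ears

variable {X : Type*} [TopologicalSpace X]

lemma exists_gap {K : Set X} (hK : IsClosed K) {f : ℝ → X} {c d t : ℝ}
    (hf : ContinuousOn f (Icc c d)) (ht : t ∈ Icc c d) (hc : f c ∈ K) (hd : f d ∈ K)
    (htK : f t ∉ K) : ∃ α β, c ≤ α ∧ α < t ∧ t < β ∧ β ≤ d ∧ f α ∈ K ∧ f β ∈ K ∧
      ∀ s ∈ Ioo α β, f s ∉ K := by
  have h1 : IsCompact (Icc c t ∩ f ⁻¹' K) :=
    isCompact_Icc.of_isClosed_subset ((hf.mono (Icc_subset_Icc_right ht.2)).preimage_isClosed_of_isClosed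
      isClosed_Icc hK) inter_subset_left
  have h2 : IsCompact (Icc t d ∩ f ⁻¹' K) :=
    isCompact_Icc.of_isClosed_subset ((hf.mono (Icc_subset_Icc_left ht.1)).preimage_isClosed_of_isClosed
      isClosed_Icc hK) inter_subset_left
  obtain ⟨α, ⟨⟨hα1, hα2⟩, hαK⟩, hα⟩ := h1.exists_isGreatest ⟨c, ⟨le_rfl, ht.1⟩, hc⟩
  obtain ⟨β, ⟨⟨hβ1, hβ2⟩, hβK⟩, hβ⟩ := h2.exists_isLeast ⟨d, ⟨ht.2, le_rfl⟩, hd⟩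
  refine ⟨α, β, hα1, hα2.lt_of_ne fun h => htK (h ▸ hαK), hβ1.lt_of_ne fun h => htK (h ▸ hβK),
    hβ2, hαK, hβK, fun s hs hsK => ?_⟩
  rcases le_total s t with h | h
  · exact absurd (hα ⟨⟨hα1.trans hs.1.le, h⟩, hsK⟩) (not_le.2 hs.1)
  · exact absurd (hβ ⟨⟨h, hs.2.le.trans hβ2⟩, hsK⟩) (not_le.2 hs.2)

lemma IsArc.exists_ear {s K : Set X} {x y z : X} (h : IsArc s x y) (hK : IsClosed K) (hx : x ∈ K)
    (hy : y ∈ K) (hz : z ∈ s) (hzK : z ∉ K) :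
    ∃ e u v, IsArc e u v ∧ e ⊆ s ∧ z ∈ e ∧ e ∩ K = {u, v} := by
  obtain ⟨f, hf, hi, rfl, rfl, rfl⟩ := h
  obtain ⟨t, ht, rfl⟩ := hz
  obtain ⟨α, β, hα, hαt, htβ, hβ, hαK, hβK, hgap⟩ := exists_gap hK hf ht hx hy hzK
  have hsub : Icc α β ⊆ Icc 0 1 := Icc_subset_Icc hα hβ
  have hlt := hαt.trans htβ
  refine ⟨f '' Icc α β, f α, f β, isArc_of_Icc hlt (hf.mono hsub) (hi.mono hsub),
    image_mono hsub, mem_image_of_mem _ ⟨hαt.le, htβ.le⟩, Subset.antisymm ?_ ?_⟩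
  · rintro _ ⟨⟨r, hr, rfl⟩, hrK⟩
    rcases hr.1.eq_or_lt with h | h
    · exact Or.inl (h ▸ rfl)
    rcases hr.2.eq_or_lt with h' | h'
    · exact Or.inr (h' ▸ rfl)
    · exact absurd hrK (hgap r ⟨h, h'⟩)
  · rintro _ (rfl | rfl)
    exacts [⟨mem_image_of_mem _ ⟨le_rfl, hlt.le⟩, hαK⟩, ⟨mem_image_of_mem _ ⟨hlt.le, le_rfl⟩, hβK⟩]

lemma IsJordan.exists_ear {C K : Set X} {x y z : X} (h : IsJordan C) (hK : IsClosed K)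
    (hx : x ∈ C ∩ K) (hy : y ∈ C ∩ K) (hxy : x ≠ y) (hz : z ∈ C) (hzK : z ∉ K) :
    ∃ e u v, IsArc e u v ∧ e ⊆ C ∧ z ∈ e ∧ e ∩ K = {u, v} := by
  obtain ⟨b₁, b₂, h₁, h₂, hi, rfl⟩ := h.split hx.1 hy.1 hxy
  rcases hz with hz | hz
  · obtain ⟨e, u, v, he, hes, hze, heK⟩ := h₁.exists_ear hK hx.2 hy.2 hz hzK
    exact ⟨e, u, v, he, hes.trans subset_union_left, hze, heK⟩
  · obtain ⟨e, u, v, he, hes, hze, heK⟩ := h₂.exists_ear hK hx.2 hy.2 hz hzK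
    exact ⟨e, u, v, he, hes.trans subset_union_right, hze, heK⟩

lemma subset_closure_diff_finite [T2Space X] {s V : Set X} (hs : IsPreconnected s)
    (hsc : IsClosed s) (hn : s.Nontrivial) (hV : V.Finite) : s ⊆ closure (s \ V) := by
  have h1 : (s \ V).Nonempty := by
    by_contra h
    rw [not_nonempty_iff_eq_empty, sdiff_eq_empty] at h
    exact hs.infinite_of_nontrivial hn (hV.subset h)
  have h2 : IsClosed (s ∩ (V \ closure (s \ V))) :=
    hsc.inter (hV.subset sdiff_subset).isClosed
  have := isPreconnected_iff_subset_of_disjoint_closed.1 hs _ _ (isClosed_closure (s := s \ V)) h2 ?_ ?_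
  · refine this.resolve_right fun h => ?_
    obtain ⟨z, hz⟩ := h1
    exact (h hz.1).2.2 (subset_closure hz)
  · intro z hz
    by_cases h : z ∈ closure (s \ V)
    · exact Or.inl h
    · refine Or.inr ⟨hz, ?_, h⟩
      by_contra hzV
      exact h (subset_closure ⟨hz, hzV⟩)
  · rw [eq_empty_iff_forall_notMem]
    rintro z ⟨-, h, h'⟩
    exact h'.2.2 h

lemma IsArc.nontrivial {s : Set X} {x y : X} (h : IsArc s x y) : s.Nontrivial :=
  ⟨x, h.left_mem, y, h.right_mem, h.ne⟩

lemma IsArc.subset_closure_diff [T2Space X] {s V : Set X} {x y : X} (h : IsArc s x y)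
    (hV : V.Finite) : s ⊆ closure (s \ V) :=
  subset_closure_diff_finite h.isPreconnected h.isClosed h.nontrivial hV

lemma IsJordan.nontrivial {C : Set X} (h : IsJordan C) : C.Nontrivial := by
  obtain ⟨x, y, b₁, b₂, h⟩ := h
  exact ⟨x, h.left_mem, y, h.right_mem, h.1.ne⟩

lemma IsJordan.subset_closure_diff [T2Space X] {C V : Set X} (h : IsJordan C)
    (hV : V.Finite) : C ⊆ closure (C \ V) :=
  subset_closure_diff_finite h.isPreconnected h.isClosed h.nontrivial hV

/-- The relative interior of a subarc is open in the arc. -/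
lemma IsArc.isClosed_diff_sub [T2Space X] {a s : Set X} {x y u v : X} (ha : IsArc a x y)
    (hs : IsArc s u v) (hsa : s ⊆ a) : IsClosed (a \ (s \ {u, v})) := by
  obtain ⟨f, τ, hf, hτ, rfl, rfl, rfl, hl, hr⟩ := ha.exists_param_inv
  have hi : InjOn f (Icc 0 1) := fun p hp q hq h => by rw [← hl p hp, h, hl q hq]
  wlog hlt : τ u ≤ τ v generalizing u v
  · rw [pair_comm]; exact this hs.symm (le_of_not_ge hlt)
  have hu := hr u (hsa hs.left_mem)
  have hv := hr v (hsa hs.right_mem)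
  have hlt' : τ u < τ v := hlt.lt_of_ne fun h => hs.ne (by rw [← hu.2, h, hv.2])
  have hsub : Icc (τ u) (τ v) ⊆ Icc 0 1 := Icc_subset_Icc hu.1.1 hv.1.2
  have harc : IsArc (f '' Icc (τ u) (τ v)) u v := by
    have := isArc_of_Icc hlt' (hf.mono hsub) (hi.mono hsub)
    rwa [hu.2, hv.2] at this
  have hse : f '' Icc (τ u) (τ v) = s := by
    refine hs.eq_of_subset harc ?_
    have h1 : IsPreconnected (τ '' s) := hs.isPreconnected.image _ (hτ.mono hsa)
    have h2 := h1.Icc_subset (mem_image_of_mem τ hs.left_mem) (mem_image_of_mem τ hs.right_mem)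
    rintro _ ⟨t, ht, rfl⟩
    obtain ⟨z, hz, hzt⟩ := h2 ht
    rw [← hzt, (hr z (hsa hz)).2]; exact hz
  have : f '' Icc 0 1 \ (s \ {u, v}) = f '' (Icc 0 1 \ Ioo (τ u) (τ v)) := by
    rw [← hse]
    apply Subset.antisymm
    · rintro _ ⟨⟨t, ht, rfl⟩, hn⟩
      refine mem_image_of_mem _ ⟨ht, fun h => hn ⟨mem_image_of_mem _ (Ioo_subset_Icc_self h), ?_⟩⟩
      rintro (h' | h')
      · rw [← h', hl t ht] at h; exact lt_irrefl _ h.1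
      · rw [mem_singleton_iff] at h'; rw [← h', hl t ht] at h; exact lt_irrefl _ h.2
    · rintro _ ⟨t, ⟨ht, hn⟩, rfl⟩
      refine ⟨mem_image_of_mem _ ht, ?_⟩
      rintro ⟨⟨r, hr', hrt⟩, hne⟩
      have := hi (hsub hr') ht hrt
      subst this
      refine hn ⟨hr'.1.lt_of_ne fun h => hne ?_, hr'.2.lt_of_ne fun h => hne ?_⟩
      · rw [← h, hu.2]; exact Or.inl rfl
      · rw [h, hv.2]; exact Or.inr rfl
  rw [this]
  exact ((isCompact_Icc.diff isOpen_Ioo).image_of_continuousOn (hf.mono sdiff_subset)).isClosed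

end Ears

section Unions

variable {X : Type*} {T : Set X} {𝒜 𝓑 : Set (Set X)}

/-- `T` is a union of members of `𝒜`. -/
def IsUnionOf (𝒜 : Set (Set X)) (T : Set X) : Prop := ∃ 𝓑 ⊆ 𝒜, ⋃₀ 𝓑 = T

lemma isUnionOf_of_subset (h : 𝓑 ⊆ 𝒜) : IsUnionOf 𝒜 (⋃₀ 𝓑) := ⟨𝓑, h, rfl⟩

lemma isUnionOf_of_mem {a : Set X} (h : a ∈ 𝒜) : IsUnionOf 𝒜 a :=
  ⟨{a}, singleton_subset_iff.2 h, sUnion_singleton a⟩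

lemma IsUnionOf.subset (h : IsUnionOf 𝒜 T) : T ⊆ ⋃₀ 𝒜 := by
  obtain ⟨𝓑, h, rfl⟩ := h
  exact sUnion_subset_sUnion h

lemma isUnionOf_sUnion {𝒯 : Set (Set X)} (h : ∀ T ∈ 𝒯, IsUnionOf 𝒜 T) : IsUnionOf 𝒜 (⋃₀ 𝒯) := by
  refine ⟨{a ∈ 𝒜 | a ⊆ ⋃₀ 𝒯}, sep_subset _ _, Subset.antisymm (sUnion_subset fun a ha => ha.2) ?_⟩
  rintro z ⟨T, hT, hz⟩
  obtain ⟨𝓑, h𝓑, rfl⟩ := h T hT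
  obtain ⟨b, hb, hzb⟩ := hz
  exact ⟨b, ⟨h𝓑 hb, (subset_sUnion_of_mem hb).trans (subset_sUnion_of_mem hT)⟩, hzb⟩

lemma IsUnionOf.union {T' : Set X} (h : IsUnionOf 𝒜 T) (h' : IsUnionOf 𝒜 T') :
    IsUnionOf 𝒜 (T ∪ T') := by
  rw [← sUnion_pair]
  exact isUnionOf_sUnion fun t ht => by rcases ht with rfl | rfl <;> assumption

lemma IsUnionOf.trans (h : IsUnionOf 𝒜 T) (h' : ∀ a ∈ 𝒜, IsUnionOf 𝓑 a) : IsUnionOf 𝓑 T := by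
  obtain ⟨𝒞, h, rfl⟩ := h
  exact isUnionOf_sUnion fun t ht => h' t (h ht)

lemma IsUnionOf.mono (h : IsUnionOf 𝒜 T) (h' : 𝒜 ⊆ 𝓑) : IsUnionOf 𝓑 T :=
  h.trans fun _ ha => isUnionOf_of_mem (h' ha)

/-- The arcs of `𝒜'` are obtained by subdividing those of `𝒜`. -/
structure Subdiv (𝒜 𝒜' : Set (Set X)) : Prop where
  le : ∀ a' ∈ 𝒜', ∃ a ∈ 𝒜, a' ⊆ a
  cover : ∀ a ∈ 𝒜, IsUnionOf 𝒜' a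

lemma Subdiv.refl (𝒜 : Set (Set X)) : Subdiv 𝒜 𝒜 :=
  ⟨fun a ha => ⟨a, ha, Subset.rfl⟩, fun _ ha => isUnionOf_of_mem ha⟩

lemma Subdiv.trans {𝒜 𝓑 𝒞 : Set (Set X)} (h : Subdiv 𝒜 𝓑) (h' : Subdiv 𝓑 𝒞) : Subdiv 𝒜 𝒞 := by
  refine ⟨fun c hc => ?_, fun a ha => (h.cover a ha).trans h'.cover⟩
  obtain ⟨b, hb, hcb⟩ := h'.le c hc
  obtain ⟨a, ha, hba⟩ := h.le b hb
  exact ⟨a, ha, hcb.trans hba⟩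

lemma Subdiv.sUnion_eq (h : Subdiv 𝒜 𝓑) : ⋃₀ 𝓑 = ⋃₀ 𝒜 := by
  apply Subset.antisymm
  · refine sUnion_subset fun b hb => ?_
    obtain ⟨a, ha, hba⟩ := h.le b hb
    exact hba.trans (subset_sUnion_of_mem ha)
  · exact sUnion_subset fun a ha => (h.cover a ha).subset

end Unions

section Graphs

variable {X : Type*} [TopologicalSpace X]

/-- Near `z`, the set `a` has empty interior and a complement consisting of at most two connected
pieces, and of one piece if `z ∈ D`. -/
def FlatAt (D a : Set X) (z : X) : Prop :=
  z ∈ closure aᶜ ∧ ∀ W ∈ 𝓝 z, ∃ B ∈ 𝓝 z, B ⊆ W ∧ ∃ P₁ P₂ : Set X, IsPreconnected P₁ ∧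
    IsPreconnected P₂ ∧ B \ a = P₁ ∪ P₂ ∧ (z ∈ D → P₁ = P₂)

lemma FlatAt.congr {D a a' : Set X} {z : X} (h : FlatAt D a z) {N : Set X} (hN : N ∈ 𝓝 z)
    (haa : a ∩ N = a' ∩ N) : FlatAt D a' z := by
  have hiff : ∀ w ∈ N, w ∈ a ↔ w ∈ a' := fun w hw =>
    ⟨fun h => (haa ▸ ⟨h, hw⟩ : w ∈ a' ∩ N).1, fun h => (haa.symm ▸ ⟨h, hw⟩ : w ∈ a ∩ N).1⟩
  constructor
  · rw [mem_closure_iff_nhds]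
    intro t ht
    obtain ⟨w, hw, hwa⟩ := mem_closure_iff_nhds.1 h.1 _ (Filter.inter_mem ht hN)
    exact ⟨w, hw.1, fun h => hwa ((hiff w hw.2).2 h)⟩
  · intro W hW
    obtain ⟨B, hB, hBW, P₁, P₂, h₁, h₂, hP, hD⟩ := h.2 _ (Filter.inter_mem hW hN)
    refine ⟨B, hB, hBW.trans inter_subset_left, P₁, P₂, h₁, h₂, ?_, hD⟩
    rw [← hP]
    ext w
    exact and_congr_right fun hw => not_congr (hiff w (hBW hw).2).symm

lemma FlatAt.subarc [T2Space X] {D a s : Set X} {x y u v z : X} (ha : IsArc a x y) (hs : IsArc s u v)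
    (hsa : s ⊆ a) (hz : z ∈ s) (hzu : z ∉ ({u, v} : Set X)) (h : FlatAt D a z) : FlatAt D s z := by
  refine h.congr (N := (a \ (s \ {u, v}))ᶜ)
    ((ha.isClosed_diff_sub hs hsa).isOpen_compl.mem_nhds fun h' => h'.2 ⟨hz, hzu⟩) ?_
  ext w
  constructor
  · rintro ⟨h1, h2⟩
    refine ⟨?_, h2⟩
    by_contra h3
    exact h2 ⟨h1, fun h => h3 h.1⟩
  · exact fun ⟨h1, h2⟩ => ⟨hsa h1, h2⟩

/-- A finite graph in `X`, with vertex set `V` and edge set `𝒜`. -/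
structure GraphFam (D V : Set X) (𝒜 : Set (Set X)) : Prop where
  finV : V.Finite
  finA : 𝒜.Finite
  arc : ∀ a ∈ 𝒜, ∃ x y, IsArc a x y ∧ a ∩ V = {x, y}
  inter : ∀ a ∈ 𝒜, ∀ b ∈ 𝒜, a ≠ b → a ∩ b ⊆ V
  flat : ∀ a ∈ 𝒜, ∀ z ∈ a \ V, FlatAt D a z

variable {D V T : Set X} {𝒜 𝓑 : Set (Set X)}

namespace GraphFam

lemma mono (h : GraphFam D V 𝒜) (hs : 𝓑 ⊆ 𝒜) : GraphFam D V 𝓑 :=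
  ⟨h.finV, h.finA.subset hs, fun a ha => h.arc a (hs ha),
    fun a ha b hb => h.inter a (hs ha) b (hs hb), fun a ha => h.flat a (hs ha)⟩

lemma isClosed_edge [T2Space X] (h : GraphFam D V 𝒜) {a : Set X} (ha : a ∈ 𝒜) : IsClosed a := by
  obtain ⟨x, y, h, -⟩ := h.arc a ha
  exact h.isClosed

lemma isClosed_of_isUnionOf [T2Space X] (h : GraphFam D V 𝒜) (hT : IsUnionOf 𝒜 T) :
    IsClosed T := by
  obtain ⟨𝓑, hB, rfl⟩ := hT
  rw [sUnion_eq_biUnion]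
  exact (h.finA.subset hB).isClosed_biUnion fun a ha => h.isClosed_edge (hB ha)

lemma isClosed_sUnion [T2Space X] (h : GraphFam D V 𝒜) : IsClosed (⋃₀ 𝒜) :=
  h.isClosed_of_isUnionOf (isUnionOf_of_subset Subset.rfl)

lemma subset_of_mem (h : GraphFam D V 𝒜) (hT : IsUnionOf 𝒜 T) {a : Set X} (ha : a ∈ 𝒜) {z : X}
    (hz : z ∈ a) (hzT : z ∈ T) (hzV : z ∉ V) : a ⊆ T := by
  obtain ⟨𝓑, hB, rfl⟩ := hT
  obtain ⟨b, hb, hzb⟩ := hzT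
  by_cases hab : a = b
  · exact hab ▸ subset_sUnion_of_mem hb
  · exact absurd (h.inter a ha b (hB hb) hab ⟨hz, hzb⟩) hzV

lemma subset_closure_edge [T2Space X] (h : GraphFam D V 𝒜) {a : Set X} (ha : a ∈ 𝒜) :
    a ⊆ closure (a \ V) := by
  obtain ⟨x, y, hxy, -⟩ := h.arc a ha
  exact hxy.subset_closure_diff h.finV

lemma edge_diff [T2Space X] (h : GraphFam D V 𝒜) {a : Set X} (ha : a ∈ 𝒜) :
    IsPreconnected (a \ V) ∧ (a \ V).Nonempty := by
  obtain ⟨x, y, hxy, hV⟩ := h.arc a ha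
  rw [← sdiff_inter_self_eq_sdiff, inter_comm, hV]
  exact ⟨hxy.diff_ends.1, hxy.diff_ends.2.1⟩

lemma edge_subset_of_arc [T2Space X] (h : GraphFam D V 𝒜) {s : Set X} {x y : X} (hs : IsArc s x y)
    (hx : x ∈ V) (hy : y ∈ V) (hsA : s ⊆ ⋃₀ 𝒜) {a : Set X} (ha : a ∈ 𝒜) {z : X} (hz : z ∈ s)
    (hza : z ∈ a) (hzV : z ∉ V) : a ⊆ s := by
  obtain ⟨e, u, v, he, hes, hze, heV⟩ := hs.exists_ear h.finV.isClosed hx hy hz hzV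
  obtain ⟨p, q, hpq, haV⟩ := h.arc a ha
  have hea : e \ {u, v} ⊆ a := by
    have hcl : IsClosed (⋃₀ (𝒜 \ {a})) :=
      h.isClosed_of_isUnionOf (isUnionOf_of_subset sdiff_subset)
    refine (isPreconnected_iff_subset_of_disjoint_closed.1 he.diff_ends.1 _ _ hpq.isClosed hcl ?_ ?_).resolve_right ?_
    · intro w hw
      obtain ⟨b, hb, hwb⟩ := hsA (hes hw.1)
      by_cases hab : b = a
      · exact Or.inl (hab ▸ hwb)
      · exact Or.inr ⟨b, ⟨hb, hab⟩, hwb⟩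
    · rw [eq_empty_iff_forall_notMem]
      rintro w ⟨hw, hwa, b, ⟨hb, hab⟩, hwb⟩
      exact hw.2 (heV ▸ ⟨hw.1, h.inter b hb a ha hab ⟨hwb, hwa⟩⟩)
    · intro hsub
      obtain ⟨b, ⟨hb, hab⟩, hzb⟩ := hsub ⟨hze, fun h' => hzV (heV.symm ▸ h' : z ∈ e ∩ V).2⟩
      exact hzV (h.inter b hb a ha hab ⟨hzb, hza⟩)
  have hea' : e ⊆ a := he.diff_ends.2.2.trans (closure_minimal hea hpq.isClosed)
  have hu : u ∈ ({p, q} : Set X) := haV ▸ ⟨hea' he.left_mem, (heV.symm ▸ Or.inl rfl : u ∈ e ∩ V).2⟩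
  have hv : v ∈ ({p, q} : Set X) := haV ▸ ⟨hea' he.right_mem, (heV.symm ▸ Or.inr rfl : v ∈ e ∩ V).2⟩
  have : e = a := by
    rcases hu with rfl | rfl <;> rcases hv with rfl | rfl
    · exact absurd rfl he.ne
    · exact hpq.eq_of_subset he hea'
    · exact hpq.symm.eq_of_subset he hea'
    · exact absurd rfl he.ne
  exact this ▸ hes

lemma isUnionOf_arc [T2Space X] (h : GraphFam D V 𝒜) {s : Set X} {x y : X} (hs : IsArc s x y)
    (hx : x ∈ V) (hy : y ∈ V) (hsA : s ⊆ ⋃₀ 𝒜) : IsUnionOf 𝒜 s := by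
  refine ⟨{a ∈ 𝒜 | a ⊆ s}, sep_subset _ _, Subset.antisymm (sUnion_subset fun a ha => ha.2) ?_⟩
  have hcl : IsClosed (⋃₀ {a ∈ 𝒜 | a ⊆ s}) :=
    h.isClosed_of_isUnionOf (isUnionOf_of_subset (sep_subset _ _))
  refine (hs.subset_closure_diff h.finV).trans (closure_minimal ?_ hcl)
  rintro z ⟨hz, hzV⟩
  obtain ⟨a, ha, hza⟩ := hsA hz
  exact ⟨a, ⟨ha, h.edge_subset_of_arc hs hx hy hsA ha hz hza hzV⟩, hza⟩

lemma isUnionOf_arc' [T2Space X] (h : GraphFam D V 𝒜) (hT : IsUnionOf 𝒜 T) {s : Set X} {x y : X}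
    (hs : IsArc s x y) (hx : x ∈ V) (hy : y ∈ V) (hsT : s ⊆ T) : IsUnionOf 𝒜 s := by
  obtain ⟨𝓑, hB, rfl⟩ := hT
  exact ((h.mono hB).isUnionOf_arc hs hx hy hsT).mono hB

/-! ### Enlarging graphs -/

lemma addArc [T2Space X] (h : GraphFam D V 𝒜) {s : Set X} {x y : X} (hs : IsArc s x y)
    (hV : s ∩ V = {x, y}) (hA : s ∩ ⋃₀ 𝒜 ⊆ V) (hf : ∀ z ∈ s \ V, FlatAt D s z) :
    GraphFam D V (insert s 𝒜) := by
  refine ⟨h.finV, h.finA.insert s, ?_, ?_, ?_⟩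
  · rintro a (rfl | ha)
    exacts [⟨x, y, hs, hV⟩, h.arc a ha]
  · rintro a (rfl | ha) b (rfl | hb) hab
    · exact absurd rfl hab
    · exact fun z hz => hA ⟨hz.1, b, hb, hz.2⟩
    · exact fun z hz => hA ⟨hz.2, a, ha, hz.1⟩
    · exact h.inter a ha b hb hab
  · rintro a (rfl | ha)
    exacts [hf, h.flat a ha]

lemma addVertex [T2Space X] (h : GraphFam D V 𝒜) (z : X) :
    ∃ 𝒜', GraphFam D (insert z V) 𝒜' ∧ Subdiv 𝒜 𝒜' := by
  by_cases hzV : z ∈ V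
  · exact ⟨𝒜, by rwa [insert_eq_of_mem hzV], Subdiv.refl 𝒜⟩
  have hd : ∀ {w : X}, w ∉ insert z V → w ∉ V := fun h h' => h (Or.inr h')
  by_cases hz : z ∈ ⋃₀ 𝒜
  swap
  · refine ⟨𝒜, ⟨h.finV.insert z, h.finA, fun a ha => ?_, fun a ha b hb hab =>
      (h.inter a ha b hb hab).trans (subset_insert _ _), fun a ha w hw =>
        h.flat a ha w ⟨hw.1, hd hw.2⟩⟩, Subdiv.refl 𝒜⟩
    obtain ⟨x, y, hxy, haV⟩ := h.arc a ha
    exact ⟨x, y, hxy, by rw [inter_insert_of_notMem fun h => hz ⟨a, ha, h⟩, haV]⟩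
  obtain ⟨a, ha, hza⟩ := hz
  obtain ⟨x, y, hxy, haV⟩ := h.arc a ha
  have hxV : x ∈ V := (haV.symm ▸ Or.inl rfl : x ∈ a ∩ V).2
  have hyV : y ∈ V := (haV.symm ▸ Or.inr rfl : y ∈ a ∩ V).2
  obtain ⟨s₁, s₂, h₁, h₂, hun, hin⟩ := hxy.split hza (fun h => hzV (h ▸ hxV)) fun h => hzV (h ▸ hyV)
  have hs₁ : s₁ ⊆ a := hun ▸ subset_union_left
  have hs₂ : s₂ ⊆ a := hun ▸ subset_union_right
  have e₁ : s₁ ∩ insert z V = {x, z} := by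
    ext w
    constructor
    · rintro ⟨hw, rfl | hwV⟩
      · exact Or.inr rfl
      · rcases (haV ▸ ⟨hs₁ hw, hwV⟩ : w ∈ ({x, y} : Set X)) with rfl | rfl
        · exact Or.inl rfl
        · exact Or.inr (hin ▸ ⟨hw, h₂.right_mem⟩ : w ∈ ({z} : Set X))
    · rintro (rfl | rfl)
      exacts [⟨h₁.left_mem, Or.inr hxV⟩, ⟨h₁.right_mem, Or.inl rfl⟩]
  have e₂ : s₂ ∩ insert z V = {z, y} := by
    ext w
    constructor
    · rintro ⟨hw, rfl | hwV⟩
      · exact Or.inl rfl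
      · rcases (haV ▸ ⟨hs₂ hw, hwV⟩ : w ∈ ({x, y} : Set X)) with rfl | rfl
        · exact Or.inl (hin ▸ ⟨h₁.left_mem, hw⟩ : w ∈ ({z} : Set X))
        · exact Or.inr rfl
    · rintro (rfl | rfl)
      exacts [⟨h₂.left_mem, Or.inl rfl⟩, ⟨h₂.right_mem, Or.inr hyV⟩]
  have hz' : ∀ b ∈ 𝒜, b ≠ a → z ∉ b := fun b hb hba hzb => hzV (h.inter b hb a ha hba ⟨hzb, hza⟩)
  have hcase : ∀ {b}, b ∈ insert s₁ (insert s₂ (𝒜 \ {a})) →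
      (b = s₁ ∨ b = s₂) ∨ (b ∈ 𝒜 ∧ b ≠ a) := by
    rintro b (rfl | rfl | hb)
    exacts [Or.inl (Or.inl rfl), Or.inl (Or.inr rfl), Or.inr hb]
  have hsa : ∀ {b}, (b = s₁ ∨ b = s₂) → b ⊆ a := by rintro b (rfl | rfl) <;> assumption
  refine ⟨insert s₁ (insert s₂ (𝒜 \ {a})), ⟨h.finV.insert z,
    ((h.finA.subset sdiff_subset).insert _).insert _, ?_, ?_, ?_⟩, ?_, ?_⟩
  · rintro b (rfl | rfl | ⟨hb, hba⟩)
    · exact ⟨x, z, h₁, e₁⟩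
    · exact ⟨z, y, h₂, e₂⟩
    · obtain ⟨p, q, hpq, hbV⟩ := h.arc b hb
      exact ⟨p, q, hpq, by rw [inter_insert_of_notMem (hz' b hb hba), hbV]⟩
  · intro b hb c hc hbc
    rcases hcase hb with hb' | hb' <;> rcases hcase hc with hc' | hc'
    · have : b ∩ c = {z} := by
        rcases hb' with rfl | rfl <;> rcases hc' with rfl | rfl
        · exact absurd rfl hbc
        · exact hin
        · rw [inter_comm]; exact hin
        · exact absurd rfl hbc
      rw [this]; exact singleton_subset_iff.2 (Or.inl rfl)
    · exact fun w hw => Or.inr (h.inter c hc'.1 a ha hc'.2 ⟨hw.2, hsa hb' hw.1⟩)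
    · exact fun w hw => Or.inr (h.inter b hb'.1 a ha hb'.2 ⟨hw.1, hsa hc' hw.2⟩)
    · exact (h.inter b hb'.1 c hc'.1 hbc).trans (subset_insert _ _)
  · rintro b (rfl | rfl | ⟨hb, hba⟩) w hw
    · exact (h.flat a ha w ⟨hs₁ hw.1, hd hw.2⟩).subarc hxy h₁ hs₁ hw.1
        fun h' => hw.2 (e₁.symm ▸ h' : w ∈ b ∩ insert z V).2
    · exact (h.flat a ha w ⟨hs₂ hw.1, hd hw.2⟩).subarc hxy h₂ hs₂ hw.1
        fun h' => hw.2 (e₂.symm ▸ h' : w ∈ b ∩ insert z V).2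
    · exact h.flat b hb w ⟨hw.1, hd hw.2⟩
  · intro b hb
    rcases hcase hb with hb' | hb'
    exacts [⟨a, ha, hsa hb'⟩, ⟨b, hb'.1, Subset.rfl⟩]
  · intro b hb
    by_cases hba : b = a
    · subst hba
      refine ⟨{s₁, s₂}, ?_, by rw [sUnion_pair, hun]⟩
      rintro c (rfl | rfl)
      exacts [Or.inl rfl, Or.inr (Or.inl rfl)]
    · exact isUnionOf_of_mem (Or.inr (Or.inr ⟨hb, hba⟩))

lemma addVertices [T2Space X] (h : GraphFam D V 𝒜) {W : Set X} (hW : W.Finite) :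
    ∃ 𝒜', GraphFam D (W ∪ V) 𝒜' ∧ Subdiv 𝒜 𝒜' := by
  induction W, hW using Set.Finite.induction_on with
  | empty => exact ⟨𝒜, by rwa [empty_union], Subdiv.refl 𝒜⟩
  | insert _ _ ih =>
    obtain ⟨𝒜₁, h₁, hs₁⟩ := ih
    obtain ⟨𝒜₂, h₂, hs₂⟩ := h₁.addVertex _
    exact ⟨𝒜₂, by rwa [insert_union], hs₁.trans hs₂⟩

end GraphFam

end Graphs

section Cycles

variable {X : Type*} [TopologicalSpace X] {D V T : Set X} {𝒜 𝓑 : Set (Set X)}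

namespace GraphFam

/-- `v` can be reached from `x` along an arc of edges. -/
def Reach (𝒜 : Set (Set X)) (x v : X) : Prop :=
  v = x ∨ ∃ s, IsUnionOf 𝒜 s ∧ IsArc s x v

lemma Reach.step [T2Space X] (h : GraphFam D V 𝒜) {x v w : X} (hx : x ∈ V) (hr : Reach 𝒜 x v)
    {e : Set X} (he : e ∈ 𝒜) (hvw : IsArc e v w) (hV : e ∩ V = {v, w}) : Reach 𝒜 x w := by
  have hvV : v ∈ V := (hV.symm ▸ Or.inl rfl : v ∈ e ∩ V).2
  have hwV : w ∈ V := (hV.symm ▸ Or.inr rfl : w ∈ e ∩ V).2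
  by_cases hwx : w = x
  · exact Or.inl hwx
  rcases hr with rfl | ⟨s, hs, hsx⟩
  · exact Or.inr ⟨e, isUnionOf_of_mem he, hvw⟩
  by_cases hws : w ∈ s
  · obtain ⟨t, hts, ht, -⟩ := hsx.sub hsx.left_mem hws (Ne.symm hwx)
    exact Or.inr ⟨t, h.isUnionOf_arc' hs ht hx hwV hts, ht⟩
  · refine Or.inr ⟨s ∪ e, hs.union (isUnionOf_of_mem he), hsx.trans hvw ?_⟩
    refine Subset.antisymm (fun z hz => ?_)
      (singleton_subset_iff.2 ⟨hsx.right_mem, hvw.left_mem⟩)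
    by_cases hzV : z ∈ V
    · rcases (hV ▸ ⟨hz.2, hzV⟩ : z ∈ ({v, w} : Set X)) with rfl | rfl
      · rfl
      · exact absurd hz.1 hws
    · exact absurd (h.subset_of_mem hs he hz.2 hz.1 hzV hvw.right_mem) hws

/-- Edges of which some vertex is reachable from `x`. -/
def star (V : Set X) (𝒜 : Set (Set X)) (x : X) : Set (Set X) :=
  {a ∈ 𝒜 | ∃ v ∈ a ∩ V, Reach 𝒜 x v}

lemma reach_of_mem_star [T2Space X] (h : GraphFam D V 𝒜) {x v : X} (hx : x ∈ V) {a : Set X}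
    (ha : a ∈ star V 𝒜 x) (hv : v ∈ a ∩ V) : Reach 𝒜 x v := by
  obtain ⟨ha, w, hw, hr⟩ := ha
  obtain ⟨p, q, hpq, hV⟩ := h.arc a ha
  rw [hV] at hv hw
  rcases hv with rfl | rfl <;> rcases hw with rfl | rfl
  · exact hr
  · exact hr.step h hx ha hpq.symm (by rw [hV, pair_comm])
  · exact hr.step h hx ha hpq hV
  · exact hr

lemma disjoint_star [T2Space X] (h : GraphFam D V 𝒜) {x : X} (hx : x ∈ V) :
    Disjoint (⋃₀ star V 𝒜 x) (⋃₀ (𝒜 \ star V 𝒜 x)) := by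
  rw [disjoint_left]
  rintro z ⟨a, ha, hza⟩ ⟨b, hb, hzb⟩
  have hzV : z ∈ V := h.inter a ha.1 b hb.1 (fun hab => hb.2 (hab ▸ ha)) ⟨hza, hzb⟩
  exact hb.2 ⟨hb.1, z, ⟨hzb, hzV⟩, h.reach_of_mem_star hx ha ⟨hza, hzV⟩⟩

/-- If a function on a graph has no logarithm, then it has none on some cycle. -/
lemma exists_cycle [T2Space X] (h : GraphFam D V 𝒜) {f : X → ℂ} (hf : ContinuousOn f (⋃₀ 𝒜))
    (h0 : ∀ z ∈ ⋃₀ 𝒜, f z ≠ 0) (hl : ¬ HasLog f (⋃₀ 𝒜)) :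
    ∃ C, IsUnionOf 𝒜 C ∧ IsJordan C ∧ ¬ HasLog f C := by
  classical
  have hfin := h.finA
  induction 𝒜, hfin using Set.Finite.induction_on with
  | empty => exact absurd ⟨fun _ => 0, by simp, by simp⟩ hl
  | @insert a 𝒜 haA hfin ih =>
    have h' := h.mono (subset_insert a 𝒜)
    have hsub : ⋃₀ 𝒜 ⊆ ⋃₀ insert a 𝒜 := sUnion_subset_sUnion (subset_insert _ _)
    by_cases hl' : HasLog f (⋃₀ 𝒜)
    swap
    · obtain ⟨C, hC, hC'⟩ := ih h' (hf.mono hsub) (fun z hz => h0 z (hsub hz)) hl'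
      exact ⟨C, hC.mono (subset_insert _ _), hC'⟩
    obtain ⟨u, hu, hu'⟩ := hl'
    have hamem : a ∈ insert a 𝒜 := Or.inl rfl
    have haS : a ⊆ ⋃₀ insert a 𝒜 := subset_sUnion_of_mem hamem
    obtain ⟨x, y, hxy, haV⟩ := h.arc a hamem
    have hxV : x ∈ V := (haV.symm ▸ Or.inl rfl : x ∈ a ∩ V).2
    have hyV : y ∈ V := (haV.symm ▸ Or.inr rfl : y ∈ a ∩ V).2
    have hcap : a ∩ ⋃₀ 𝒜 ⊆ {x, y} := by
      rintro z ⟨hza, b, hb, hzb⟩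
      exact haV ▸ ⟨hza, h.inter a hamem b (Or.inr hb) (fun h => haA (h ▸ hb)) ⟨hza, hzb⟩⟩
    by_cases hr : ∃ s, IsUnionOf 𝒜 s ∧ IsArc s x y
    · obtain ⟨s, hs, hsxy⟩ := hr
      have hJ : JSplit (a ∪ s) x y a s := ⟨hxy, hsxy, Subset.antisymm
        (fun z hz => hcap ⟨hz.1, hs.subset hz.2⟩)
        (subset_inter hxy.ends_subset hsxy.ends_subset), rfl⟩
      refine ⟨a ∪ s, (isUnionOf_of_mem hamem).union (hs.mono (subset_insert _ _)), hJ.isJordan, ?_⟩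
      rintro ⟨w, hw, hw'⟩
      apply hl
      rw [sUnion_insert]
      set c := u x - w x with hc
      have hconst : ∀ z ∈ s, u z - w z = c := fun z hz =>
        log_sub_eq hsxy.isPreconnected (hu.mono hs.subset) (hw.mono subset_union_right)
          (fun z hz => by rw [hu' z (hs.subset hz), hw' z (Or.inr hz)]) hz hsxy.left_mem
      have hexp : Complex.exp c = 1 := by
        rw [hc, Complex.exp_sub, hu' x (hs.subset hsxy.left_mem), hw' x (Or.inl hxy.left_mem),
          div_self (h0 x (haS hxy.left_mem))]
      refine HasLog.union (u := fun z => w z + c) ((hw.mono subset_union_left).add continuousOn_const)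
        hu hxy.isClosed h'.isClosed_sUnion ?_ ?_ hu'
      · intro z hz
        rcases hcap hz with rfl | rfl
        · simp [hc]
        · have := hconst z hsxy.right_mem
          simp only [← this]; ring
      · intro z hz
        rw [Complex.exp_add, hexp, mul_one, hw' z (Or.inl hz)]
    · exfalso
      apply hl
      rw [sUnion_insert]
      obtain ⟨w, hw, hw'⟩ := hxy.hasLog (hf.mono haS) fun z hz => h0 z (haS hz)
      set K := ⋃₀ star V 𝒜 x
      set L := ⋃₀ (𝒜 \ star V 𝒜 x)
      have hKL : ⋃₀ 𝒜 = K ∪ L := by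
        rw [← sUnion_union, union_sdiff_cancel (show star V 𝒜 x ⊆ 𝒜 from sep_subset _ _)]
      have hK : IsClosed K := h'.isClosed_of_isUnionOf (isUnionOf_of_subset (sep_subset _ _))
      have hL : IsClosed L := h'.isClosed_of_isUnionOf (isUnionOf_of_subset sdiff_subset)
      have hd : Disjoint K L := h'.disjoint_star hxV
      have hyK : y ∉ K := by
        rintro ⟨b, hb, hyb⟩
        rcases h'.reach_of_mem_star hxV hb ⟨hyb, hyV⟩ with h | h
        · exact hxy.ne h.symm
        · exact hr h
      have hxL : x ∉ L := by
        rintro ⟨b, hb, hxb⟩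
        exact hb.2 ⟨hb.1, x, ⟨hxb, hxV⟩, Or.inl rfl⟩
      set c : X → ℂ := fun z => if z ∈ K then w x - u x else w y - u y with hc
      have hadj : ∀ p ∈ ⋃₀ 𝒜, p ∈ a → Complex.exp (w p - u p) = 1 := by
        intro p hp hpa
        rw [Complex.exp_sub, hw' p hpa, hu' p hp, div_self (h0 p (haS hpa))]
      set u₁ : X → ℂ := fun z => u z + if x ∈ ⋃₀ 𝒜 then w x - u x else 0
      set u₂ : X → ℂ := fun z => u z + if y ∈ ⋃₀ 𝒜 then w y - u y else 0
      have hKs : K ⊆ ⋃₀ 𝒜 := hKL ▸ subset_union_left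
      have hLs : L ⊆ ⋃₀ 𝒜 := hKL ▸ subset_union_right
      have hv := continuousOn_glue_closed (u := u₁) (w := u₂)
        ((hu.mono hKs).add continuousOn_const) ((hu.mono hLs).add continuousOn_const) hK hL
        (fun z hz => absurd hz.2 (disjoint_left.1 hd hz.1))
      rw [← hKL] at hv
      refine HasLog.union hw hv hxy.isClosed h'.isClosed_sUnion ?_ hw' ?_
      · intro z hz
        rcases hcap hz with rfl | rfl
        · have : z ∈ K := (hKL ▸ hz.2 : z ∈ K ∪ L).resolve_right hxL
          simp only [if_pos this, u₁, if_pos hz.2]; ring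
        · simp only [if_neg hyK, u₂, if_pos hz.2]; ring
      · intro z hz
        have e1 : Complex.exp (u₁ z) = f z := by
          simp only [u₁]
          split_ifs with hx
          · rw [Complex.exp_add, hadj x hx hxy.left_mem, mul_one, hu' z hz]
          · rw [add_zero, hu' z hz]
        have e2 : Complex.exp (u₂ z) = f z := by
          simp only [u₂]
          split_ifs with hx
          · rw [Complex.exp_add, hadj y hx hxy.right_mem, mul_one, hu' z hz]
          · rw [add_zero, hu' z hz]
        split_ifs
        exacts [e1, e2]

end GraphFam

end Cycles

section Small

variable {X : Type*} [MetricSpace X] {D V : Set X} {𝒜 : Set (Set X)}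

lemma IsArc.exists_fine {a : Set X} {x y : X} (h : IsArc a x y) {η : ℝ} (hη : 0 < η) :
    ∃ W : Set X, W.Finite ∧ W ⊆ a ∧ ∀ t ⊆ a \ W, IsPreconnected t →
      ∀ p ∈ t, ∀ q ∈ t, dist p q < η := by
  obtain ⟨f, τ, hf, hτ, rfl, -, -, -, hr⟩ := h.exists_param_inv
  have hfu := isCompact_Icc.uniformContinuousOn_of_continuous hf
  obtain ⟨δ, hδ, hfδ⟩ := Metric.uniformContinuousOn_iff.1 hfu η hη
  obtain ⟨n, hn⟩ := exists_nat_one_div_lt hδ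
  set N : ℝ := n + 1 with hN
  have hN0 : 0 < N := by positivity
  refine ⟨(fun k : ℕ => f (k / N)) '' {k | k ≤ n + 1}, (finite_le_nat _).image _, ?_, ?_⟩
  · rintro _ ⟨k, hk, rfl⟩
    refine mem_image_of_mem _ ⟨by positivity, ?_⟩
    rw [div_le_one hN0, hN]; exact_mod_cast hk
  · intro t ht htc
    have hts : t ⊆ f '' Icc 0 1 := ht.trans sdiff_subset
    have hτt : IsPreconnected (τ '' t) := htc.image _ (hτ.mono hts)
    have key : ∀ p ∈ t, ∀ q ∈ t, τ p ≤ τ q → dist p q < η := by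
      intro p hp q hq hpq
      have hp' := hr p (hts hp)
      have hq' := hr q (hts hq)
      rw [← hp'.2, ← hq'.2]
      apply hfδ _ hp'.1 _ hq'.1
      rw [dist_comm, Real.dist_eq, abs_of_nonneg (by linarith)]
      by_contra! hlt
      set k := ⌈τ p * N⌉₊
      have h1 : τ p * N ≤ k := Nat.le_ceil _
      have h2 : (k : ℝ) < τ p * N + 1 := Nat.ceil_lt_add_one (mul_nonneg hp'.1.1 hN0.le)
      have h3 : τ p ≤ k / N := by rwa [le_div_iff₀ hN0]
      have h4 : (k : ℝ) / N ≤ τ q := by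
        rw [div_le_iff₀ hN0]
        have : 1 < δ * N := by rwa [div_lt_iff₀ hN0] at hn
        nlinarith
      have h5 : k ≤ n + 1 := by
        apply Nat.ceil_le.2
        push_cast
        exact mul_le_of_le_one_left hN0.le hp'.1.2
      obtain ⟨z, hz, hzk⟩ := hτt.Icc_subset (mem_image_of_mem τ hp) (mem_image_of_mem τ hq) ⟨h3, h4⟩
      refine (ht hz).2 ⟨k, h5, ?_⟩
      dsimp only
      rw [← hzk, (hr z (hts hz)).2]
    intro p hp q hq
    rcases le_total (τ p) (τ q) with h | h
    · exact key p hp q hq h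
    · rw [dist_comm]; exact key q hq p hp h

lemma GraphFam.exists_small (h : GraphFam D V 𝒜) {η : ℝ} (hη : 0 < η) :
    ∃ V' 𝒜', V ⊆ V' ∧ V' ⊆ V ∪ ⋃₀ 𝒜 ∧ GraphFam D V' 𝒜' ∧ Subdiv 𝒜 𝒜' ∧
      ∀ a ∈ 𝒜', ∀ p ∈ a, ∀ q ∈ a, dist p q ≤ η := by
  have hW : ∀ a ∈ 𝒜, ∃ W : Set X, W.Finite ∧ W ⊆ a ∧ ∀ t ⊆ a \ W, IsPreconnected t →
      ∀ p ∈ t, ∀ q ∈ t, dist p q < η := fun a ha => by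
    obtain ⟨x, y, hxy, -⟩ := h.arc a ha
    exact hxy.exists_fine hη
  choose! W hWf hWs hW using hW
  obtain ⟨𝒜', h', hs⟩ := h.addVertices (h.finA.biUnion hWf)
  refine ⟨_, 𝒜', subset_union_right, ?_, h', hs, ?_⟩
  · exact union_subset (iUnion₂_subset fun a ha => (hWs a ha).trans
      ((subset_sUnion_of_mem ha).trans subset_union_right)) subset_union_left
  · intro a ha
    obtain ⟨b, hb, hab⟩ := hs.le a ha
    set V' := (⋃ i ∈ 𝒜, W i) ∪ V
    have h1 := hW b hb (a \ V') (fun z hz => ⟨hab hz.1, fun hzW =>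
      hz.2 (Or.inl (mem_biUnion hb hzW))⟩) (h'.edge_diff ha).1
    have h2 : ∀ p ∈ a, ∀ q ∈ a, (p, q) ∈ closure ((a \ V') ×ˢ (a \ V')) := fun p hp q hq => by
      rw [closure_prod_eq]
      exact ⟨h'.subset_closure_edge ha hp, h'.subset_closure_edge ha hq⟩
    intro p hp q hq
    have hcl : IsClosed {r : X × X | dist r.1 r.2 ≤ η} :=
      isClosed_le (by fun_prop) continuous_const
    exact closure_minimal (fun r hr => (h1 r.1 hr.1 r.2 hr.2).le) hcl (h2 p hp q hq)

end Small

section Paths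

variable {X : Type*} [TopologicalSpace X] [T2Space X] {D V : Set X} {𝒜 : Set (Set X)}

/-- A graph family `𝒜'` on `V'` extends `𝒜` on `V`: every edge of `𝒜` is a union of edges of
`𝒜'`; all vertices lie on edges. -/
structure Extends (D : Set X) (𝒜 : Set (Set X)) (V' : Set X) (𝒜' : Set (Set X)) : Prop where
  graph : GraphFam D V' 𝒜'
  sub : V' ⊆ ⋃₀ 𝒜'
  cover : ∀ a ∈ 𝒜, IsUnionOf 𝒜' a

omit [T2Space X] in
lemma Extends.refl (h : GraphFam D V 𝒜) (hV : V ⊆ ⋃₀ 𝒜) : Extends D 𝒜 V 𝒜 :=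
  ⟨h, hV, fun _ ha => isUnionOf_of_mem ha⟩

omit [T2Space X] in
lemma Extends.trans {V₁ V₂ : Set X} {𝒜₁ 𝒜₂ : Set (Set X)} (h : Extends D 𝒜 V₁ 𝒜₁)
    (h' : Extends D 𝒜₁ V₂ 𝒜₂) : Extends D 𝒜 V₂ 𝒜₂ :=
  ⟨h'.graph, h'.sub, fun a ha => (h.cover a ha).trans h'.cover⟩

omit [T2Space X] in
lemma Extends.sUnion_subset {V₁ : Set X} {𝒜₁ : Set (Set X)} (h : Extends D 𝒜 V₁ 𝒜₁) :
    ⋃₀ 𝒜 ⊆ ⋃₀ 𝒜₁ :=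
  Set.sUnion_subset fun a ha => (h.cover a ha).subset

/-- Paths all of whose interior points are flat. -/
structure FlatPath (D : Set X) (γ : ℝ → X) : Prop where
  cont : ContinuousOn γ (Icc 0 1)
  inj : InjOn γ (Icc 0 1)
  flat : ∀ t ∈ Ioo (0 : ℝ) 1, FlatAt D (γ '' Icc 0 1) (γ t)

lemma GraphFam.addPath (h : GraphFam D V 𝒜) (hV : V ⊆ ⋃₀ 𝒜) {γ : ℝ → X} (hγ : FlatPath D γ)
    {p q : ℝ} (hp : 0 ≤ p) (hpq : p < q) (hq : q ≤ 1) (hd : ∀ t ∈ Ioo p q, γ t ∉ ⋃₀ 𝒜) :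
    ∃ V' 𝒜', Extends D 𝒜 V' 𝒜' ∧ IsUnionOf 𝒜' (γ '' Icc p q) ∧
      ⋃₀ 𝒜' = ⋃₀ 𝒜 ∪ γ '' Icc p q := by
  have hI : Icc p q ⊆ Icc 0 1 := Icc_subset_Icc hp hq
  have hs : IsArc (γ '' Icc p q) (γ p) (γ q) :=
    isArc_of_Icc hpq (hγ.cont.mono hI) (hγ.inj.mono hI)
  have hγ1 : IsArc (γ '' Icc 0 1) (γ 0) (γ 1) :=
    isArc_of_Icc one_pos hγ.cont hγ.inj
  obtain ⟨𝒜₁, h₁, hs₁⟩ := h.addVertices (W := {γ p, γ q}) (by simp)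
  have hoff : ∀ z ∈ γ '' Icc p q, z ∉ ({γ p, γ q} : Set X) → ∃ t ∈ Ioo p q, γ t = z := by
    rintro _ ⟨t, ht, rfl⟩ hz
    refine ⟨t, ⟨lt_of_le_of_ne ht.1 ?_, lt_of_le_of_ne ht.2 ?_⟩, rfl⟩
    · rintro rfl; simp at hz
    · rintro rfl; simp at hz
  have hVs : γ '' Icc p q ∩ ({γ p, γ q} ∪ V) = {γ p, γ q} := by
    apply Subset.antisymm
    · rintro z ⟨hz, hz' | hz'⟩
      · exact hz'
      · by_contra hn
        obtain ⟨t, ht, rfl⟩ := hoff z hz hn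
        exact hd t ht (hV hz')
    · exact fun z hz => ⟨hs.ends_subset hz, Or.inl hz⟩
  have h₂ := h₁.addArc hs hVs (by
    rw [hs₁.sUnion_eq]
    rintro z ⟨hz, hz'⟩
    by_contra hn
    obtain ⟨t, ht, rfl⟩ := hoff z hz fun h => hn (Or.inl h)
    exact hd t ht hz') (by
    rintro z ⟨hz, hz'⟩
    obtain ⟨t, ht, rfl⟩ := hoff z hz fun h => hz' (Or.inl h)
    exact FlatAt.subarc hγ1 hs (image_mono hI) hz (fun h => hz' (Or.inl h))
      (hγ.flat t ⟨hp.trans_lt ht.1, ht.2.trans_le hq⟩))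
  have hU : ⋃₀ insert (γ '' Icc p q) 𝒜₁ = ⋃₀ 𝒜 ∪ γ '' Icc p q := by
    rw [sUnion_insert, hs₁.sUnion_eq, union_comm]
  refine ⟨_, _, ⟨h₂, ?_, fun a ha => (hs₁.cover a ha).mono (subset_insert _ _)⟩,
    isUnionOf_of_mem (mem_insert _ _), hU⟩
  rw [hU]
  exact union_subset (fun z hz => Or.inr (hs.ends_subset hz)) (hV.trans subset_union_left)

lemma GraphFam.addPath' (h : GraphFam D V 𝒜) (hV : V ⊆ ⋃₀ 𝒜) {γ : ℝ → X} (hγ : FlatPath D γ)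
    {p q : ℝ} (hp : 0 ≤ p) (hpq : p ≤ q) (hq : q ≤ 1) (hd : ∀ t ∈ Ioo p q, γ t ∉ ⋃₀ 𝒜)
    {a : Set X} (ha : IsUnionOf 𝒜 a) (hpa : γ p ∈ a ∨ γ q ∈ a) :
    ∃ V' 𝒜', Extends D 𝒜 V' 𝒜' ∧ IsUnionOf 𝒜' (γ '' Icc p q ∪ a) ∧
      ⋃₀ 𝒜' = ⋃₀ 𝒜 ∪ γ '' Icc p q := by
  rcases hpq.lt_or_eq with hlt | rfl
  · obtain ⟨V', 𝒜', h', hu, hU⟩ := h.addPath hV hγ hp hlt hq hd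
    exact ⟨V', 𝒜', h', hu.union (ha.trans h'.cover), hU⟩
  · have : γ '' Icc p p ⊆ a := by simpa using hpa
    refine ⟨V, 𝒜, .refl h hV, ?_, ?_⟩
    · rwa [union_eq_right.2 this]
    · exact (union_eq_left.2 (this.trans ha.subset)).symm

/-- Adding a flat path which, off finitely many points, is locally inside or outside of the graph. -/
lemma GraphFam.addFinPath {γ : ℝ → X} (hγ : FlatPath D γ) (P : Finset ℝ) :
    ∀ {V : Set X} {𝒜 : Set (Set X)} (_ : GraphFam D V 𝒜) (_ : V ⊆ ⋃₀ 𝒜) {p q : ℝ} (_ : 0 ≤ p)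
    (_ : p < q) (_ : q ≤ 1) (_ : ∀ p' q', p ≤ p' → p' < q' → q' ≤ q → Disjoint (Ioo p' q') ↑P →
      γ '' Ioo p' q' ⊆ ⋃₀ 𝒜 ∨ Disjoint (γ '' Ioo p' q') (⋃₀ 𝒜)),
    ∃ V' 𝒜', Extends D 𝒜 V' 𝒜' ∧ ⋃₀ 𝒜' = ⋃₀ 𝒜 ∪ γ '' Icc p q := by
  induction P using Finset.induction_on with
  | empty =>
    intro V 𝒜 h hV p q hp hpq hq hc
    rcases hc p q le_rfl hpq le_rfl (by simp) with hs | hs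
    · refine ⟨V, 𝒜, .refl h hV, (union_eq_left.2 ?_).symm⟩
      have hcl : Icc p q ⊆ closure (Ioo p q) := by rw [closure_Ioo hpq.ne]
      rintro _ ⟨t, ht, rfl⟩
      have h1 := (((hγ.cont.mono (Icc_subset_Icc hp hq)) t ht).mono Ioo_subset_Icc_self)
      have h2 := h1.mem_closure_image (hcl ht)
      exact h.isClosed_sUnion.closure_subset_iff.2 hs h2
    · obtain ⟨V', 𝒜', h', -, hU⟩ := h.addPath hV hγ hp hpq hq fun t ht htA =>
        hs.le_bot ⟨mem_image_of_mem _ ht, htA⟩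
      exact ⟨V', 𝒜', h', hU⟩
  | insert t P htP ih =>
    intro V 𝒜 h hV p q hp hpq hq hc
    by_cases ht : t ∈ Ioo p q
    · obtain ⟨V₁, 𝒜₁, h₁, hU₁⟩ := ih h hV hp ht.1 (ht.2.le.trans hq) fun p' q' h1 h2 h3 h4 =>
        hc p' q' h1 h2 (h3.trans ht.2.le) (by
          rw [Finset.coe_insert, disjoint_insert_right]
          exact ⟨fun hh => absurd hh.2 (not_lt.2 h3), h4⟩)
      obtain ⟨V₂, 𝒜₂, h₂, hU₂⟩ := ih h₁.graph h₁.sub (hp.trans ht.1.le) ht.2 hq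
        fun p' q' h1 h2 h3 h4 => by
          rcases hc p' q' (ht.1.le.trans h1) h2 h3 (by
            rw [Finset.coe_insert, disjoint_insert_right]
            exact ⟨fun hh => absurd hh.1 (not_lt.2 h1), h4⟩) with hs | hs
          · exact Or.inl (hs.trans (hU₁ ▸ subset_union_left))
          · right
            rw [hU₁, disjoint_union_right]
            refine ⟨hs, ?_⟩
            rw [Set.disjoint_left]
            rintro _ ⟨s, hs', rfl⟩ ⟨r, hr, hrs⟩
            have := hγ.inj ⟨hp.trans hr.1, hr.2.trans (ht.2.le.trans hq)⟩
              ⟨by linarith [hs'.1, ht.1], by linarith [hs'.2]⟩ hrs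
            linarith [hr.2, hs'.1]
      refine ⟨V₂, 𝒜₂, h₁.trans h₂, ?_⟩
      rw [hU₂, hU₁, union_assoc, ← image_union, Icc_union_Icc_eq_Icc ht.1.le ht.2.le]
    · exact ih h hV hp hpq hq fun p' q' h1 h2 h3 h4 => hc p' q' h1 h2 h3 (by
          rw [Finset.coe_insert, disjoint_insert_right]
          exact ⟨fun hh => ht ⟨h1.trans_lt hh.1, hh.2.trans_le h3⟩, h4⟩)

end Paths

section Detour

variable {X : Type*} [MetricSpace X] {D V : Set X} {𝒜 : Set (Set X)}

lemma GraphFam.detour_step {γ : ℝ → X} (hγ : FlatPath D γ) {V' : Set X} {𝒜' : Set (Set X)}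
    (h : GraphFam D V 𝒜) (h' : Extends D 𝒜 V' 𝒜') {c d δ μ : ℝ} (hc : 0 ≤ c) (hcd : c < d)
    (hd : d ≤ 1) (hU : ⋃₀ 𝒜' ⊆ ⋃₀ 𝒜 ∪ γ '' Icc 0 c) (hδ : 0 < δ)
    (hη : ∀ a ∈ 𝒜, ∀ p ∈ a, ∀ q ∈ a, dist p q ≤ δ / 4)
    (hμ : ∀ a ∈ 𝒜, ∀ b ∈ 𝒜, Disjoint a b → ∀ p ∈ a, ∀ q ∈ b, μ ≤ dist p q)
    (hcd' : ∀ s ∈ Icc c d, ∀ t ∈ Icc c d, dist (γ s) (γ t) < δ / 4 ∧ dist (γ s) (γ t) < μ) :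
    ∃ V'' 𝒜'' Y, Extends D 𝒜' V'' 𝒜'' ∧ ⋃₀ 𝒜'' ⊆ ⋃₀ 𝒜 ∪ γ '' Icc 0 d ∧ IsUnionOf 𝒜'' Y ∧
      IsPreconnected Y ∧ Y ⊆ Metric.ball (γ c) δ ∧ γ c ∈ Y ∧ γ d ∈ Y := by
  have hI : Icc c d ⊆ Icc 0 1 := Icc_subset_Icc hc hd
  have hcm : c ∈ Icc c d := ⟨le_rfl, hcd.le⟩
  have hdm : d ∈ Icc c d := ⟨hcd.le, le_rfl⟩
  have hcdc : ContinuousOn γ (Icc c d) := hγ.cont.mono hI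
  set Z := Icc c d ∩ γ ⁻¹' (⋃₀ 𝒜) with hZ
  have hZc : IsCompact Z := isCompact_Icc.of_isClosed_subset
    (hcdc.preimage_isClosed_of_isClosed isClosed_Icc h.isClosed_sUnion) inter_subset_left
  have hball : ∀ s ∈ Icc c d, γ s ∈ Metric.ball (γ c) δ := fun s hs => by
    have := (hcd' s hs c hcm).1
    rw [Metric.mem_ball]; linarith
  rcases Z.eq_empty_or_nonempty with he | hne
  · obtain ⟨V'', 𝒜'', h₂, hu, hU₂⟩ := h'.graph.addPath h'.sub hγ hc hcd hd fun t ht htA => by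
      rcases hU htA with h1 | ⟨s, hs, hst⟩
      · exact he.subset (⟨⟨ht.1.le, ht.2.le⟩, h1⟩ : t ∈ Z)
      · have := hγ.inj ⟨hs.1, by linarith [hs.2]⟩ (hI ⟨ht.1.le, ht.2.le⟩) hst
        linarith [hs.2, ht.1]
    refine ⟨V'', 𝒜'', γ '' Icc c d, h₂, ?_, hu, isPreconnected_Icc.image _ hcdc, ?_,
      mem_image_of_mem _ hcm, mem_image_of_mem _ hdm⟩
    · rw [hU₂]
      refine union_subset (hU.trans ?_) ?_
      · exact union_subset_union_right _ (image_mono (Icc_subset_Icc le_rfl hcd.le))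
      · exact (image_mono (Icc_subset_Icc hc le_rfl)).trans subset_union_right
    · rintro _ ⟨s, hs, rfl⟩
      exact hball s hs
  · obtain ⟨t', ht', hmin⟩ := hZc.exists_isLeast hne
    obtain ⟨t'', ht'', hmax⟩ := hZc.exists_isGreatest hne
    have hle : t' ≤ t'' := hmin ht''
    obtain ⟨α, hα, hαt⟩ := ht'.2
    obtain ⟨β, hβ, hβt⟩ := ht''.2
    obtain ⟨V₁, 𝒜₁, h₁, hu₁, hU₁⟩ := h'.graph.addPath' h'.sub hγ (p := c) (q := t') hc ht'.1.1
      (ht'.1.2.trans hd) (fun t ht htA => by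
        rcases hU htA with h1 | ⟨s, hs, hst⟩
        · have := hmin (⟨⟨ht.1.le, ht.2.le.trans ht'.1.2⟩, h1⟩ : t ∈ Z)
          linarith [ht.2]
        · have := hγ.inj ⟨hs.1, by linarith [hs.2]⟩ (hI ⟨ht.1.le, ht.2.le.trans ht'.1.2⟩) hst
          linarith [hs.2, ht.1]) (h'.cover α hα) (Or.inr hαt)
    obtain ⟨V₂, 𝒜₂, h₂, hu₂, hU₂⟩ := h₁.graph.addPath' h₁.sub hγ (p := t'') (q := d)
      (hc.trans ht''.1.1) ht''.1.2 hd (fun t ht htA => by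
        rw [hU₁] at htA
        have hcd0 : t ∈ Icc c d := ⟨ht''.1.1.trans ht.1.le, ht.2.le⟩
        rcases htA with htA | ⟨s, hs, hst⟩
        · rcases hU htA with h1 | ⟨s, hs, hst⟩
          · have := hmax (⟨hcd0, h1⟩ : t ∈ Z)
            linarith [ht.1]
          · have := hγ.inj ⟨hs.1, by linarith [hs.2]⟩ (hI hcd0) hst
            linarith [hs.2, ht.1, ht''.1.1]
        · have := hγ.inj (hI ⟨hs.1, hs.2.trans ht'.1.2⟩) (hI hcd0) hst
          linarith [hs.2, ht.1]) ((h'.cover β hβ).trans h₁.cover) (Or.inl hβt)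
    have hαβ : (α ∩ β).Nonempty := by
      rw [← not_disjoint_iff_nonempty_inter]
      intro hdis
      exact absurd (hμ α hα β hβ hdis _ hαt _ hβt) (not_le.2 (hcd' _ ht'.1 _ ht''.1).2)
    have hpre : ∀ a ∈ 𝒜, IsPreconnected a := fun a ha => by
      obtain ⟨x, y, hxy, -⟩ := h.arc a ha
      exact hxy.isPreconnected
    have hαb : α ⊆ Metric.ball (γ c) δ := fun z hz => by
      have h1 := hη α hα z hz _ hαt
      have h2 := (hcd' _ ht'.1 c hcm).1
      have := dist_triangle z (γ t') (γ c)
      rw [Metric.mem_ball]; linarith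
    have hβb : β ⊆ Metric.ball (γ c) δ := fun z hz => by
      have h1 := hη β hβ z hz _ hβt
      have h2 := (hcd' _ ht''.1 c hcm).1
      have := dist_triangle z (γ t'') (γ c)
      rw [Metric.mem_ball]; linarith
    have hI1 : Icc c t' ⊆ Icc c d := Icc_subset_Icc le_rfl ht'.1.2
    have hI2 : Icc t'' d ⊆ Icc c d := Icc_subset_Icc ht''.1.1 le_rfl
    have hY1 : IsPreconnected (γ '' Icc c t' ∪ α) :=
      (isPreconnected_Icc.image _ (hcdc.mono hI1)).union (γ t')
        (mem_image_of_mem _ ⟨ht'.1.1, le_rfl⟩) hαt (hpre α hα)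
    have hY2 : IsPreconnected (γ '' Icc t'' d ∪ β) :=
      (isPreconnected_Icc.image _ (hcdc.mono hI2)).union (γ t'')
        (mem_image_of_mem _ ⟨le_rfl, ht''.1.2⟩) hβt (hpre β hβ)
    obtain ⟨w, hw1, hw2⟩ := hαβ
    refine ⟨V₂, 𝒜₂, (γ '' Icc c t' ∪ α) ∪ (γ '' Icc t'' d ∪ β), h₁.trans h₂, ?_,
      (hu₁.trans h₂.cover).union hu₂, hY1.union w (Or.inr hw1) (Or.inr hw2) hY2, ?_,
      Or.inl (Or.inl (mem_image_of_mem _ ⟨le_rfl, ht'.1.1⟩)),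
      Or.inr (Or.inl (mem_image_of_mem _ ⟨ht''.1.2, le_rfl⟩))⟩
    · rw [hU₂, hU₁]
      refine union_subset (union_subset (hU.trans ?_) ?_) ?_
      · exact union_subset_union_right _ (image_mono (Icc_subset_Icc le_rfl hcd.le))
      · exact (image_mono (Icc_subset_Icc hc ht'.1.2)).trans subset_union_right
      · exact (image_mono (Icc_subset_Icc (hc.trans ht''.1.1) le_rfl)).trans subset_union_right
    · refine union_subset (union_subset ?_ hαb) (union_subset ?_ hβb)
      · rintro _ ⟨s, hs, rfl⟩
        exact hball s (hI1 hs)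
      · rintro _ ⟨s, hs, rfl⟩
        exact hball s (hI2 hs)

lemma exists_pos_le_dist {𝒜 : Set (Set X)} (hf : 𝒜.Finite) (hc : ∀ a ∈ 𝒜, IsCompact a) :
    ∃ μ > 0, ∀ a ∈ 𝒜, ∀ b ∈ 𝒜, Disjoint a b → ∀ p ∈ a, ∀ q ∈ b, μ ≤ dist p q := by
  have h1 : ∀ a b : Set X, ∃ μ > 0, IsCompact a → IsCompact b → Disjoint a b →
      ∀ p ∈ a, ∀ q ∈ b, μ ≤ dist p q := by
    intro a b
    by_cases h : IsCompact a ∧ IsCompact b ∧ Disjoint a b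
    · obtain ⟨r, hr, hr'⟩ := Metric.exists_pos_forall_lt_edist h.1 h.2.1.isClosed h.2.2
      refine ⟨r, hr, fun _ _ _ p hp q hq => ?_⟩
      have := hr' p hp q hq
      rw [edist_dist] at this
      have h3 := (ENNReal.lt_ofReal_iff_toReal_lt ENNReal.coe_ne_top).1 this
      exact h3.le
    · exact ⟨1, one_pos, fun h1 h2 h3 => absurd ⟨h1, h2, h3⟩ h⟩
  choose μ hμ hμ' using h1
  have hfin : ((fun q : Set X × Set X => μ q.1 q.2) '' (𝒜 ×ˢ 𝒜) ∪ {1}).Finite :=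
    ((hf.prod hf).image _).union (finite_singleton 1)
  obtain ⟨m, hm, hmin⟩ := hfin.exists_minimal ⟨1, Or.inr rfl⟩ |>.imp fun _ h => (And.intro h.1 h.2)
  refine ⟨m, ?_, fun a ha b hb hd p hp q hq => ?_⟩
  · rcases hm with ⟨q, -, rfl⟩ | rfl
    · exact hμ _ _
    · exact one_pos
  · refine le_trans ?_ (hμ' a b (hc a ha) (hc b hb) hd p hp q hq)
    rcases le_total m (μ a b) with h | h
    · exact h
    · exact hmin (Or.inl ⟨(a, b), ⟨ha, hb⟩, rfl⟩) h

lemma GraphFam.detour (h : GraphFam D V 𝒜) (hV : V ⊆ ⋃₀ 𝒜) {γ : ℝ → X} (hγ : FlatPath D γ)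
    (O : ℝ → Set X) (hO : ∀ t ∈ Icc (0 : ℝ) 1, IsOpen (O t) ∧ γ t ∈ O t) :
    ∃ V' 𝒜' T, Extends D 𝒜 V' 𝒜' ∧ IsUnionOf 𝒜' T ∧ T ⊆ ⋃ t ∈ Icc (0 : ℝ) 1, O t ∧
      γ 0 ∈ T ∧ γ 1 ∈ T ∧ ∀ (f : X → ℂ) (u : X → ℂ) (v : ℝ → ℂ),
        (∀ t ∈ Icc (0 : ℝ) 1, HasLog f (O t)) → ContinuousOn u T →
        (∀ z ∈ T, Complex.exp (u z) = f z) → ContinuousOn v (Icc 0 1) →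
        (∀ t ∈ Icc (0 : ℝ) 1, Complex.exp (v t) = f (γ t)) → u (γ 1) - u (γ 0) = v 1 - v 0 := by
  have hK : IsCompact (γ '' Icc 0 1) := isCompact_Icc.image_of_continuousOn hγ.cont
  obtain ⟨δ, hδ, hδ'⟩ := lebesgue_number_lemma_of_metric (ι := Icc (0 : ℝ) 1) (c := fun t => O t)
    hK (fun t => (hO t t.2).1) (by
      rintro _ ⟨t, ht, rfl⟩
      exact mem_iUnion.2 ⟨⟨t, ht⟩, (hO t ht).2⟩)
  obtain ⟨V₁, 𝒜₁, hVV, hVV', h₁, hs₁, hη⟩ := h.exists_small (η := δ / 4) (by positivity)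
  have hV₁ : V₁ ⊆ ⋃₀ 𝒜₁ := by
    rw [hs₁.sUnion_eq]
    exact hVV'.trans (union_subset hV Subset.rfl)
  obtain ⟨μ, hμ, hμ'⟩ := exists_pos_le_dist h₁.finA fun a ha => by
    obtain ⟨x, y, hxy, -⟩ := h₁.arc a ha
    exact hxy.isCompact
  have huc : UniformContinuousOn γ (Icc 0 1) :=
    isCompact_Icc.uniformContinuousOn_of_continuous hγ.cont
  rw [Metric.uniformContinuousOn_iff] at huc
  obtain ⟨ρ, hρ, hρ'⟩ := huc (min (δ / 4) μ) (by positivity)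
  obtain ⟨N, hN⟩ := exists_nat_one_div_lt hρ
  set c : ℕ → ℝ := fun k => k / (N + 1) with hc
  have hN0 : (0 : ℝ) < N + 1 := by positivity
  have hc0 : c 0 = 0 := by simp [hc]
  have hcN : c (N + 1) = 1 := by simp only [hc]; push_cast; field_simp
  have hcs : ∀ k, c (k + 1) = c k + 1 / (N + 1) := fun k => by
    simp only [hc]; push_cast; field_simp
  have hcle : ∀ k, k ≤ N + 1 → c k ≤ 1 := fun k hk => by
    simp only [hc]
    rw [div_le_one hN0]
    exact_mod_cast hk
  have hcnn : ∀ k, 0 ≤ c k := fun k => by positivity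
  have key : ∀ k, k ≤ N + 1 → ∃ V' 𝒜' T, Extends D 𝒜₁ V' 𝒜' ∧ ⋃₀ 𝒜' ⊆ ⋃₀ 𝒜₁ ∪ γ '' Icc 0 (c k) ∧
      IsUnionOf 𝒜' T ∧ T ⊆ ⋃ t ∈ Icc (0 : ℝ) 1, O t ∧ (0 < k → γ 0 ∈ T ∧ γ (c k) ∈ T) ∧
      ∀ (f : X → ℂ) (u : X → ℂ) (v : ℝ → ℂ),
        (∀ t ∈ Icc (0 : ℝ) 1, HasLog f (O t)) → ContinuousOn u T →
        (∀ z ∈ T, Complex.exp (u z) = f z) → ContinuousOn v (Icc 0 1) →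
        (∀ t ∈ Icc (0 : ℝ) 1, Complex.exp (v t) = f (γ t)) →
        u (γ (c k)) - u (γ 0) = v (c k) - v 0 := by
    intro k
    induction k with
    | zero =>
      intro _
      refine ⟨V₁, 𝒜₁, ∅, .refl h₁ hV₁, subset_union_left, ⟨∅, empty_subset _, sUnion_empty⟩,
        empty_subset _, fun h => absurd h (lt_irrefl 0), fun f u v _ _ _ _ _ => ?_⟩
      simp [hc0]
    | succ k ih =>
      intro hk
      obtain ⟨V₂, 𝒜₂, T, h₂, hU₂, hT, hTO, hkT, hlog⟩ := ih (by omega)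
      have hlt : c k < c (k + 1) := by rw [hcs]; linarith [one_div_pos.2 hN0]
      have hI : Icc (c k) (c (k + 1)) ⊆ Icc 0 1 := Icc_subset_Icc (hcnn k) (hcle _ hk)
      have hckI : c k ∈ Icc (c k) (c (k + 1)) := ⟨le_rfl, hlt.le⟩
      have hsmall : ∀ s ∈ Icc (c k) (c (k + 1)), ∀ t ∈ Icc (c k) (c (k + 1)),
          dist (γ s) (γ t) < δ / 4 ∧ dist (γ s) (γ t) < μ := fun s hs t ht =>
        lt_min_iff.1 (hρ' s (hI hs) t (hI ht) (lt_of_le_of_lt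
          (Real.dist_le_of_mem_Icc hs ht) (by rw [hcs]; linarith)))
      obtain ⟨V₃, 𝒜₃, Y, h₃, hU₃, hY, hYp, hYb, hY1, hY2⟩ :=
        h₁.detour_step hγ h₂ (hcnn k) hlt (hcle _ hk) hU₂ hδ hη hμ' hsmall
      obtain ⟨⟨τ, hτ⟩, hτO⟩ := hδ' (γ (c k)) (mem_image_of_mem _ (hI hckI))
      refine ⟨V₃, 𝒜₃, T ∪ Y, h₂.trans h₃, hU₃, (hT.trans h₃.cover).union hY,
        union_subset hTO ((hYb.trans hτO).trans (subset_biUnion_of_mem (u := O) hτ)),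
        fun _ => ⟨?_, Or.inr hY2⟩, fun f u v hf hu hu' hv hv' => ?_⟩
      · rcases Nat.eq_zero_or_pos k with rfl | hk0
        · exact Or.inr (hc0 ▸ hY1)
        · exact Or.inl (hkT hk0).1
      · have e1 := hlog f u v hf (hu.mono subset_union_left) (fun z hz => hu' z (Or.inl hz)) hv hv'
        obtain ⟨w, hw, hw'⟩ := hf τ hτ
        have hYO : Y ⊆ O τ := hYb.trans hτO
        have e2 := log_diff_eq hYp (hu.mono subset_union_right) (hw.mono hYO) (fun z hz => by
          rw [hu' z (Or.inr hz), hw' z (hYO hz)]) hY2 hY1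
        have hm : MapsTo γ (Icc (c k) (c (k + 1))) (O τ) := fun s hs => hτO (by
          have := (hsmall s hs _ hckI).1
          rw [Metric.mem_ball]; linarith)
        have e3 := log_diff_eq isPreconnected_Icc (hv.mono hI) (hw.comp (hγ.cont.mono hI) hm)
          (fun s hs => by rw [hv' s (hI hs), Function.comp_apply, hw' _ (hm hs)])
          (x := c (k + 1)) (y := c k) ⟨hlt.le, le_rfl⟩ hckI
        simp only [Function.comp_apply] at e3
        linear_combination e1 + e2 - e3
  obtain ⟨V', 𝒜', T, h', -, hT, hTO, hT', hlog⟩ := key (N + 1) le_rfl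
  rw [hcN] at hT' hlog
  have hext : Extends D 𝒜 V₁ 𝒜₁ := ⟨h₁, hV₁, hs₁.cover⟩
  exact ⟨V', 𝒜', T, hext.trans h', hT, hTO, (hT' (by omega)).1, (hT' (by omega)).2, hlog⟩

end Detour

section Charts

variable {X Y : Type*} [TopologicalSpace X] [TopologicalSpace Y] {D : Set X}

lemma FlatAt.map {D' s N : Set Y} {a : Set X} {φ : Y → X} {w : Y} (hN : IsOpen N)
    (hc : ContinuousOn φ N) (ho : ∀ W ⊆ N, IsOpen W → IsOpen (φ '' W)) (hw : w ∈ N)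
    (ha : ∀ y ∈ N, φ y ∈ a ↔ y ∈ s) (hD : φ w ∈ D → w ∈ D') (h : FlatAt D' s w) :
    FlatAt D a (φ w) := by
  constructor
  · rw [mem_closure_iff]
    intro U hU hwU
    obtain ⟨y, ⟨hyN, hyU⟩, hys⟩ := mem_closure_iff.1 h.1 _ (hc.isOpen_inter_preimage hN hU)
      ⟨hw, hwU⟩
    exact ⟨φ y, hyU, fun hya => hys ((ha y hyN).1 hya)⟩
  · intro W hW
    have hW' : N ∩ φ ⁻¹' W ∈ 𝓝 w := by
      have := (hc.continuousAt (hN.mem_nhds hw)).preimage_mem_nhds hW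
      exact Filter.inter_mem (hN.mem_nhds hw) this
    obtain ⟨B, hB, hBW, P₁, P₂, hP₁, hP₂, hBs, hP⟩ := h.2 _ hW'
    have hBN : B ⊆ N := hBW.trans inter_subset_left
    have hP₁B : P₁ ⊆ N := (subset_union_left.trans hBs.ge).trans (sdiff_subset.trans hBN)
    have hP₂B : P₂ ⊆ N := (subset_union_right.trans hBs.ge).trans (sdiff_subset.trans hBN)
    refine ⟨φ '' B, ?_, image_subset_iff.2 (hBW.trans inter_subset_right), φ '' P₁, φ '' P₂,
      hP₁.image _ (hc.mono hP₁B), hP₂.image _ (hc.mono hP₂B), ?_, fun hz => by rw [hP (hD hz)]⟩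
    · refine Filter.mem_of_superset ((ho _ (interior_subset.trans hBN) isOpen_interior).mem_nhds
        (mem_image_of_mem _ (mem_interior_iff_mem_nhds.2 hB))) (image_mono interior_subset)
    · rw [← image_union, ← hBs]
      ext x
      constructor
      · rintro ⟨⟨y, hy, rfl⟩, hya⟩
        exact ⟨y, ⟨hy, fun hys => hya ((ha y (hBN hy)).2 hys)⟩, rfl⟩
      · rintro ⟨y, ⟨hy, hys⟩, rfl⟩
        exact ⟨⟨y, hy, rfl⟩, fun hya => hys ((ha y (hBN hy)).1 hya)⟩

/-- Coordinate (half-)discs of a surface with boundary `D`. -/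
structure IsChart (D : Set X) (φ : ℂ → X) (H : Set ℂ) : Prop where
  cont : ContinuousOn φ (Metric.closedBall 0 1 ∩ H)
  inj : InjOn φ (Metric.closedBall 0 1 ∩ H)
  isOpen_image : ∀ W, IsOpen W → W ⊆ Metric.ball 0 1 → IsOpen (φ '' (W ∩ H))
  type : (H = univ ∧ ∀ z ∈ Metric.closedBall 0 1, φ z ∉ D) ∨
    (H = {z | 0 ≤ z.im} ∧ ∀ z ∈ Metric.closedBall 0 1 ∩ H, φ z ∈ D ↔ z.im = 0)

lemma flatAt_real_line (t : ℂ) (ht : t.im = 0) : FlatAt ∅ {z : ℂ | z.im = 0} t := by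
  have hgt : Convex ℝ {z : ℂ | 0 < z.im} := convex_halfSpace_im_gt 0
  have hlt : Convex ℝ {z : ℂ | z.im < 0} := convex_halfSpace_im_lt 0
  constructor
  · rw [Metric.mem_closure_iff]
    intro ε hε
    refine ⟨t + (ε / 2 : ℝ) * Complex.I, ?_, ?_⟩
    · simp [ht, hε.ne']
    · rw [dist_eq_norm]
      simp [abs_of_pos hε]
      linarith
  · intro W hW
    obtain ⟨ε, hε, hb⟩ := Metric.mem_nhds_iff.1 hW
    refine ⟨_, Metric.ball_mem_nhds t hε, hb, Metric.ball t ε ∩ {z | 0 < z.im},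
      Metric.ball t ε ∩ {z | z.im < 0}, ((convex_ball t ε).inter hgt).isPreconnected,
      ((convex_ball t ε).inter hlt).isPreconnected, ?_, fun h => h.elim⟩
    rw [← inter_union_distrib_left]
    ext z
    simp only [mem_sdiff, Set.mem_ofPred_eq, mem_inter_iff, mem_union]
    have : ¬ z.im = 0 ↔ (0 < z.im ∨ z.im < 0) := by rw [← ne_eq, ne_iff_lt_or_gt, or_comm]
    tauto

/-- The parametrized circle of radius one half. -/
noncomputable def halfCircle (ζ : ℂ) : ℂ := 1 / 2 * Complex.exp (Real.pi * Complex.I * ζ)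

lemma halfCircle_continuous : Continuous halfCircle := by
  unfold halfCircle; fun_prop

lemma norm_halfCircle (ζ : ℂ) : ‖halfCircle ζ‖ = 1 / 2 * Real.exp (-(Real.pi * ζ.im)) := by
  simp [halfCircle, Complex.norm_exp]

lemma halfCircle_im (ζ : ℂ) :
    (halfCircle ζ).im = 1 / 2 * (Real.exp (-(Real.pi * ζ.im)) * Real.sin (Real.pi * ζ.re)) := by
  have : (1 / 2 : ℂ) = ((1 / 2 : ℝ) : ℂ) := by norm_num
  rw [halfCircle, this, Complex.im_ofReal_mul, Complex.exp_im]
  simp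

lemma halfCircle_inj {ζ ξ : ℂ} (h : halfCircle ζ = halfCircle ξ) (hre : |ζ.re - ξ.re| < 2) :
    ζ = ξ := by
  have h1 : Complex.exp (Real.pi * Complex.I * ζ) = Complex.exp (Real.pi * Complex.I * ξ) := by
    simpa [halfCircle] using h
  obtain ⟨n, hn⟩ := Complex.exp_eq_exp_iff_exists_int.1 h1
  have hpi : (Real.pi * Complex.I : ℂ) ≠ 0 := by simp [Real.pi_ne_zero]
  have h2 : ζ = ξ + 2 * n := by
    apply mul_left_cancel₀ hpi
    linear_combination hn
  have h3 : ζ.re - ξ.re = 2 * n := by rw [h2]; simp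
  rw [h3] at hre
  have hn0 : n = 0 := by
    rw [abs_lt] at hre
    have h4 : (n : ℝ) < 1 := by linarith
    have h5 : (-1 : ℝ) < n := by linarith
    have h4' : n < 1 := by exact_mod_cast h4
    have h5' : -1 < n := by exact_mod_cast h5
    omega
  simp [h2, hn0]

lemma halfCircle_isOpenMap : IsOpenMap halfCircle := by
  have h : ∀ ζ, HasStrictDerivAt halfCircle
      (1 / 2 * (Complex.exp (Real.pi * Complex.I * ζ) * (Real.pi * Complex.I))) ζ := fun ζ => by
    have h1 : HasStrictDerivAt (fun ζ : ℂ => (Real.pi * Complex.I : ℂ) * ζ) (Real.pi * Complex.I) ζ := by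
      simpa using (hasStrictDerivAt_id ζ).const_mul (Real.pi * Complex.I : ℂ)
    exact (h1.cexp).const_mul (1 / 2 : ℂ)
  exact isOpenMap_of_hasStrictDerivAt h fun ζ => by simp [Real.pi_ne_zero, Complex.exp_ne_zero]

end Charts

namespace IsChart

section

variable {X : Type*} [TopologicalSpace X] {D : Set X} {φ : ℂ → X} {H : Set ℂ}

lemma isClosed_half (h : IsChart D φ H) : IsClosed H := by
  rcases h.type with ⟨rfl, -⟩ | ⟨rfl, -⟩
  · exact isClosed_univ
  · exact isClosed_le continuous_const Complex.continuous_im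

lemma isCompact_dom (h : IsChart D φ H) : IsCompact (Metric.closedBall 0 1 ∩ H) :=
  (isCompact_closedBall 0 1).inter_right h.isClosed_half

lemma mem_half (h : IsChart D φ H) {z : ℂ} (hz : 0 ≤ z.im) : z ∈ H := by
  rcases h.type with ⟨rfl, -⟩ | ⟨rfl, -⟩
  · exact mem_univ z
  · exact hz

lemma exists_inv (h : IsChart D φ H) : ∃ ψ : X → ℂ, LeftInvOn ψ φ (Metric.closedBall 0 1 ∩ H) :=
  ⟨_, h.inj.leftInvOn_invFunOn⟩

lemma continuousOn_inv [T2Space X] (h : IsChart D φ H) {ψ : X → ℂ}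
    (hψ : LeftInvOn ψ φ (Metric.closedBall 0 1 ∩ H)) :
    ContinuousOn ψ (φ '' (Metric.closedBall 0 1 ∩ H)) :=
  continuousOn_of_leftInvOn_compact h.isCompact_dom h.cont hψ

end

section Upper

lemma halfCircle_mem_closedBall {t : ℝ} : halfCircle t ∈ Metric.closedBall 0 1 := by
  rw [mem_closedBall_zero_iff, norm_halfCircle]
  norm_num

variable {X : Type*} [TopologicalSpace X] {D : Set X} {φ : ℂ → X} {H : Set ℂ}

lemma halfCircle_mem_dom (h : IsChart D φ H) {t : ℝ} (ht : t ∈ Icc (0 : ℝ) 1) :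
    halfCircle t ∈ Metric.closedBall 0 1 ∩ H := by
  refine ⟨halfCircle_mem_closedBall, h.mem_half ?_⟩
  rw [halfCircle_im]
  have := Real.sin_nonneg_of_nonneg_of_le_pi (x := Real.pi * t)
    (mul_nonneg Real.pi_pos.le ht.1) (by nlinarith [Real.pi_pos, ht.2])
  simp only [Complex.ofReal_re]
  positivity

lemma flatPath (h : IsChart D φ H) : FlatPath D fun t : ℝ => φ (halfCircle t) := by
  have hcc : ContinuousOn (fun t : ℝ => halfCircle t) (Icc 0 1) :=
    (halfCircle_continuous.comp Complex.continuous_ofReal).continuousOn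
  have hm : MapsTo (fun t : ℝ => halfCircle t) (Icc 0 1) (Metric.closedBall 0 1 ∩ H) :=
    fun t ht => h.halfCircle_mem_dom ht
  refine ⟨h.cont.comp hcc hm, ?_, ?_⟩
  · intro s hs t ht hst
    have h1 := halfCircle_inj (h.inj (hm hs) (hm ht) hst) (by
      rw [abs_lt]; simp only [Complex.ofReal_re]
      constructor <;> linarith [hs.1, hs.2, ht.1, ht.2])
    exact_mod_cast h1
  · intro t ht
    set N : Set ℂ := {ζ | 0 < ζ.re ∧ ζ.re < 1 ∧ ‖halfCircle ζ‖ < 1} with hN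
    have hNo : IsOpen N := by
      refine (isOpen_lt continuous_const Complex.continuous_re).inter
        ((isOpen_lt Complex.continuous_re continuous_const).inter
          (isOpen_lt halfCircle_continuous.norm continuous_const))
    have him : ∀ ζ ∈ N, 0 < (halfCircle ζ).im := by
      intro ζ hζ
      rw [halfCircle_im]
      have := Real.sin_pos_of_pos_of_lt_pi (x := Real.pi * ζ.re)
        (mul_pos Real.pi_pos hζ.1) (by nlinarith [Real.pi_pos, hζ.2.1])
      positivity
    have hNm : MapsTo halfCircle N (Metric.closedBall 0 1 ∩ H) := fun ζ hζ =>
      ⟨mem_closedBall_zero_iff.2 hζ.2.2.le, h.mem_half (him ζ hζ).le⟩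
    have htN : (t : ℂ) ∈ N := by
      refine ⟨by simpa using ht.1, by simpa using ht.2, ?_⟩
      rw [norm_halfCircle]; norm_num
    refine FlatAt.map (Y := ℂ) (D' := ∅) (s := {ζ : ℂ | ζ.im = 0}) (N := N)
      (φ := fun ζ => φ (halfCircle ζ)) (w := (t : ℂ)) hNo
      (h.cont.comp halfCircle_continuous.continuousOn hNm) ?_ htN ?_ ?_
      (flatAt_real_line t (Complex.ofReal_im t))
    · intro W hW hWo
      have h1 := h.isOpen_image (halfCircle '' W) (halfCircle_isOpenMap W hWo) (by
        rintro _ ⟨ζ, hζ, rfl⟩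
        exact mem_ball_zero_iff.2 (hW hζ).2.2)
      have h2 : halfCircle '' W ∩ H = halfCircle '' W := by
        rw [inter_eq_left]
        rintro _ ⟨ζ, hζ, rfl⟩
        exact (hNm (hW hζ)).2
      rwa [h2, image_image] at h1
    · intro ζ hζ
      constructor
      · rintro ⟨s, hs, hst⟩
        have h1 := h.inj (hm hs) (hNm hζ) hst
        have h2 := congrArg norm h1
        simp only [norm_halfCircle, Complex.ofReal_im, mul_zero, neg_zero, Real.exp_zero] at h2
        have h3 : Real.exp (-(Real.pi * ζ.im)) = 1 := by linarith
        rw [Real.exp_eq_one_iff] at h3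
        simpa [Real.pi_ne_zero] using h3
      · intro h0
        refine ⟨ζ.re, ⟨hζ.1.le, hζ.2.1.le⟩, ?_⟩
        have : ((ζ.re : ℝ) : ℂ) = ζ := Complex.ext rfl (by simpa using h0.symm)
        simp only [this]
    · intro hD
      rcases h.type with ⟨rfl, ht'⟩ | ⟨rfl, ht'⟩
      · exact absurd hD (ht' _ (hNm htN).1)
      · exact absurd ((ht' _ (hNm htN)).1 hD) (him _ htN).ne'

end Upper

section Metric

variable {X : Type*} [MetricSpace X] {D V : Set X} {𝒜 : Set (Set X)} {φ : ℂ → X} {H : Set ℂ}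

lemma halfCircle_zero : halfCircle ((0 : ℝ) : ℂ) = 1 / 2 := by simp [halfCircle]

lemma halfCircle_one : halfCircle ((1 : ℝ) : ℂ) = -(1 / 2) := by
  simp [halfCircle, Complex.exp_pi_mul_I]

lemma hasLog_sub_ball {c p : ℂ} {r : ℝ} (hr : 0 < r) (h : r ≤ dist p c) :
    HasLog (fun z => z - p) (Metric.ball c r) :=
  hasLog_of_starConvex (c := c) (Metric.mem_ball_self hr)
    ((convex_ball c r).starConvex (Metric.mem_ball_self hr)) (by fun_prop) (by
      intro z hz h0
      rw [sub_eq_zero] at h0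
      subst h0
      exact absurd (Metric.mem_ball.1 hz) (not_lt.2 h))

lemma upper (h : IsChart D φ H) (hG : GraphFam D V 𝒜) (hV : V ⊆ ⋃₀ 𝒜) :
    ∃ V' 𝒜' T, Extends D 𝒜 V' 𝒜' ∧ IsUnionOf 𝒜' T ∧
      T ⊆ φ '' ({z | 1 / 3 < ‖z‖ ∧ ‖z‖ < 2 / 3} ∩ H) ∧ φ (1 / 2) ∈ T ∧ φ (-(1 / 2)) ∈ T ∧
      ∀ (ψ : X → ℂ) (y : ℝ) (u : X → ℂ), |y| ≤ 1 / 6 →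
        LeftInvOn ψ φ (Metric.closedBall 0 1 ∩ H) → ContinuousOn u T →
        (∀ z ∈ T, Complex.exp (u z) = ψ z - y * Complex.I) →
        0 < (u (φ (-(1 / 2))) - u (φ (1 / 2))).im := by
  have hnorm : ∀ t : ℝ, ‖halfCircle t‖ = 1 / 2 := fun t => by rw [norm_halfCircle]; simp
  have hsub : ∀ t : ℝ, Metric.ball (halfCircle t) (1 / 6) ⊆ {z | 1 / 3 < ‖z‖ ∧ ‖z‖ < 2 / 3} := by
    intro t z hz
    rw [Metric.mem_ball, dist_eq_norm] at hz
    have h1 := norm_sub_norm_le (halfCircle t) z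
    have h2 := norm_sub_norm_le z (halfCircle t)
    rw [norm_sub_rev] at h1
    rw [hnorm] at h1 h2
    constructor <;> linarith
  have hsub1 : ∀ t : ℝ, Metric.ball (halfCircle t) (1 / 6) ⊆ Metric.ball 0 1 := fun t z hz => by
    rw [mem_ball_zero_iff]
    linarith [(hsub t hz).2]
  obtain ⟨V', 𝒜', T, hE, hT, hTO, hT0, hT1, hlog⟩ := hG.detour hV h.flatPath
    (fun t => φ '' (Metric.ball (halfCircle t) (1 / 6) ∩ H)) (fun t ht =>
      ⟨h.isOpen_image _ Metric.isOpen_ball (hsub1 t),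
        mem_image_of_mem _ ⟨Metric.mem_ball_self (by norm_num), (h.halfCircle_mem_dom ht).2⟩⟩)
  simp only [halfCircle_zero, halfCircle_one] at hT0 hT1 hlog
  refine ⟨V', 𝒜', T, hE, hT, hTO.trans ?_, hT0, hT1, ?_⟩
  · refine iUnion₂_subset fun t _ => image_mono (inter_subset_inter_left _ (hsub t))
  · intro ψ y u hy hψ hu hu'
    have hw : ∀ t ∈ Icc (0 : ℝ) 1, -Complex.I * (halfCircle t - y * Complex.I) ∈ Complex.slitPlane := by
      intro t ht
      rw [Complex.mem_slitPlane_iff]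
      simp only [Complex.mul_re, Complex.mul_im, Complex.neg_re, Complex.neg_im, Complex.I_re,
        Complex.I_im, Complex.sub_re, Complex.sub_im, Complex.ofReal_re, Complex.ofReal_im]
      by_contra hcon
      push Not at hcon
      obtain ⟨h1, h2⟩ := hcon
      have hre : (halfCircle t).re = 0 := by linarith
      have h3 := (h.halfCircle_mem_dom ht)
      have h4 : 0 ≤ (halfCircle t).im := by
        rw [halfCircle_im]
        have := Real.sin_nonneg_of_nonneg_of_le_pi (x := Real.pi * t)
          (mul_nonneg Real.pi_pos.le ht.1) (by nlinarith [Real.pi_pos, ht.2])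
        simp only [Complex.ofReal_re]
        positivity
      have h5 : ‖halfCircle t‖ = |(halfCircle t).im| :=
        (Complex.abs_im_eq_norm.2 hre).symm
      rw [hnorm, abs_of_nonneg h4] at h5
      have := (abs_le.1 hy).2
      linarith
    have hpi := Real.pi_pos
    have hexp : Complex.exp (Real.pi / 2 * Complex.I) = Complex.I := by
      rw [Complex.exp_mul_I]; simp
    have key := hlog (fun z => ψ z - y * Complex.I) u
      (fun t => Complex.log (-Complex.I * (halfCircle t - y * Complex.I)) + Real.pi / 2 * Complex.I)
      (fun t ht => by
        refine (hasLog_sub_ball (c := halfCircle t) (p := y * Complex.I) (r := 1 / 6) (by norm_num)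
          ?_).comp (g := ψ) ?_ ?_
        · rw [dist_eq_norm, norm_sub_rev]
          have h1 := norm_sub_norm_le (halfCircle t) (y * Complex.I)
          have h2 : ‖(y * Complex.I : ℂ)‖ = |y| := by simp
          rw [hnorm, h2] at h1
          linarith
        · exact (h.continuousOn_inv hψ).mono (image_mono (inter_subset_inter_left _
            ((hsub1 t).trans Metric.ball_subset_closedBall)))
        · rintro _ ⟨z, hz, rfl⟩
          rw [hψ ⟨Metric.ball_subset_closedBall (hsub1 t hz.1), hz.2⟩]
          exact hz.1) hu hu' (by
        refine ContinuousOn.add (ContinuousOn.clog ?_ hw) continuousOn_const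
        have := halfCircle_continuous
        fun_prop) (fun t ht => by
        rw [Complex.exp_add, Complex.exp_log (Complex.slitPlane_ne_zero (hw t ht)), hexp,
          hψ (h.halfCircle_mem_dom ht)]
        linear_combination (-(halfCircle t - y * Complex.I)) * Complex.I_mul_I)
    rw [key, halfCircle_zero, halfCircle_one]
    simp only [Complex.sub_im, Complex.add_im, Complex.log_im]
    have e1 : 0 < (-Complex.I * (-(1 / 2) - y * Complex.I)).arg := by
      have him : (-Complex.I * (-(1 / 2) - y * Complex.I)).im = 1 / 2 := by simp
      refine lt_of_le_of_ne (Complex.arg_nonneg_iff.2 (by rw [him]; norm_num)) fun h0 => ?_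
      have := (Complex.arg_eq_zero_iff.1 h0.symm).2
      rw [him] at this
      norm_num at this
    have e2 : (-Complex.I * (1 / 2 - y * Complex.I)).arg < 0 := by
      rw [Complex.arg_neg_iff]
      simp
    linarith

end Metric

end IsChart

namespace IsChart

variable {X : Type*} [MetricSpace X] {D V : Set X} {𝒜 : Set (Set X)} {φ : ℂ → X} {H : Set ℂ}

lemma comp_conj (h : IsChart D φ univ) :
    IsChart D (fun z => φ (starRingEnd ℂ z)) univ := by
  have hb : MapsTo (starRingEnd ℂ) (Metric.closedBall 0 1 ∩ univ) (Metric.closedBall 0 1 ∩ univ) := by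
    intro z hz
    simpa using hz
  refine ⟨h.cont.comp Complex.continuous_conj.continuousOn hb, ?_, ?_, ?_⟩
  · intro z hz w hw hzw
    exact (starRingEnd ℂ).injective (h.inj (hb hz) (hb hw) hzw)
  · intro W hW hWb
    have h1 := h.isOpen_image (starRingEnd ℂ ⁻¹' W) (hW.preimage Complex.continuous_conj) (by
      intro z hz
      have := hWb hz
      simpa using this)
    convert h1 using 1
    ext x
    simp only [inter_univ, mem_image, mem_preimage]
    constructor
    · rintro ⟨z, hz, rfl⟩
      exact ⟨starRingEnd ℂ z, by simpa using hz, rfl⟩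
    · rintro ⟨z, hz, rfl⟩
      exact ⟨starRingEnd ℂ z, hz, by simp⟩
  · left
    refine ⟨rfl, fun z hz => ?_⟩
    rcases h.type with ⟨-, ht⟩ | ⟨hH, -⟩
    · exact ht _ (by simpa using hz)
    · exfalso
      have : (-Complex.I) ∈ (univ : Set ℂ) := mem_univ _
      rw [hH] at this
      norm_num at this

/-- The part of the chart domain containing the lower half of the cycle. -/
def lowerRegion (H : Set ℂ) : Set ℂ :=
  {z | 1 / 3 < ‖z‖ ∧ ‖z‖ < 2 / 3} ∪ {z | H = {z | 0 ≤ z.im} ∧ z.im = 0 ∧ ‖z‖ ≤ 1 / 2}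

lemma lower (h : IsChart D φ H) (hG : GraphFam D V 𝒜) (hV : V ⊆ ⋃₀ 𝒜) (hD : D ⊆ ⋃₀ 𝒜) :
    ∃ V' 𝒜' T, Extends D 𝒜 V' 𝒜' ∧ IsUnionOf 𝒜' T ∧
      T ⊆ φ '' (lowerRegion H ∩ H) ∧ φ (1 / 2) ∈ T ∧ φ (-(1 / 2)) ∈ T ∧
      ∀ (ψ : X → ℂ) (u : X → ℂ),
        LeftInvOn ψ φ (Metric.closedBall 0 1 ∩ H) → ContinuousOn u T →
        (∀ z ∈ T, Complex.exp (u z) = ψ z - (1 / 6 : ℝ) * Complex.I) →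
        (u (φ (-(1 / 2))) - u (φ (1 / 2))).im < 0 := by
  rcases h.type with ⟨rfl, ht⟩ | ⟨rfl, ht⟩
  · obtain ⟨V', 𝒜', T, hE, hT, hTs, h1, h2, hlog⟩ := h.comp_conj.upper hG hV
    have hhalf : (starRingEnd ℂ) (1 / 2) = 1 / 2 := by
      rw [show (1 / 2 : ℂ) = ((1 / 2 : ℝ) : ℂ) by norm_num]
      exact Complex.conj_ofReal _
    simp only [map_neg, hhalf] at h1 h2 hlog
    refine ⟨V', 𝒜', T, hE, hT, ?_, h1, h2, fun ψ u hψ hu hu' => ?_⟩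
    · refine hTs.trans ?_
      rintro _ ⟨z, hz, rfl⟩
      exact ⟨starRingEnd ℂ z, ⟨Or.inl (by simpa using hz.1), mem_univ _⟩, rfl⟩
    · have := hlog (fun x => starRingEnd ℂ (ψ x)) (-(1 / 6)) (fun x => starRingEnd ℂ (u x))
        (by rw [abs_neg, abs_of_pos] <;> norm_num) (fun z hz => by
          simp only
          rw [hψ (by simpa using hz), Complex.conj_conj])
        (Complex.continuous_conj.comp_continuousOn hu) (fun z hz => by
          rw [Complex.exp_conj, hu' z hz, map_sub, map_mul, Complex.conj_ofReal, Complex.conj_I]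
          push_cast
          ring)
      simp only [Complex.sub_im, Complex.conj_im] at this ⊢
      linarith
  · have hseg : ∀ r ∈ Icc (-(1 / 2) : ℝ) (1 / 2),
        (r : ℂ) ∈ Metric.closedBall (0 : ℂ) 1 ∩ {z | 0 ≤ z.im} := by
      intro r hr
      refine ⟨?_, by simp⟩
      rw [mem_closedBall_zero_iff, Complex.norm_real, Real.norm_eq_abs, abs_le]
      constructor <;> linarith [hr.1, hr.2]
    have hbc : ContinuousOn (fun r : ℝ => φ r) (Icc (-(1 / 2)) (1 / 2)) :=
      h.cont.comp Complex.continuous_ofReal.continuousOn hseg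
    have hbi : InjOn (fun r : ℝ => φ r) (Icc (-(1 / 2)) (1 / 2)) := fun r hr s hs hrs => by
      exact_mod_cast h.inj (hseg r hr) (hseg s hs) hrs
    have hb := isArc_of_Icc (by norm_num) hbc hbi
    have e1 : ((-(1 / 2) : ℝ) : ℂ) = -(1 / 2) := by push_cast; ring
    have e2 : ((1 / 2 : ℝ) : ℂ) = 1 / 2 := by push_cast; ring
    simp only [e1, e2] at hb
    have hbD : (fun r : ℝ => φ r) '' Icc (-(1 / 2)) (1 / 2) ⊆ D := by
      rintro _ ⟨r, hr, rfl⟩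
      exact (ht _ (hseg r hr)).2 (by simp)
    obtain ⟨𝒜₁, h₁, hs₁⟩ := hG.addVertices (W := {φ (-(1 / 2)), φ (1 / 2)}) (by simp)
    have hsub : (fun r : ℝ => φ r) '' Icc (-(1 / 2)) (1 / 2) ⊆ ⋃₀ 𝒜₁ := by
      rw [hs₁.sUnion_eq]; exact hbD.trans hD
    refine ⟨_, 𝒜₁, _, ⟨h₁, ?_, hs₁.cover⟩,
      h₁.isUnionOf_arc hb (Or.inl (Or.inl rfl)) (Or.inl (Or.inr rfl)) hsub, ?_,
      hb.right_mem, hb.left_mem, fun ψ u hψ hu hu' => ?_⟩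
    · exact union_subset (hb.ends_subset.trans hsub) (hs₁.sUnion_eq ▸ hV)
    · rintro _ ⟨r, hr, rfl⟩
      refine ⟨r, ⟨Or.inr ⟨rfl, by simp, ?_⟩, (hseg r hr).2⟩, rfl⟩
      rw [Complex.norm_real, Real.norm_eq_abs, abs_le]
      exact hr
    · have hsl : ∀ z ∈ (fun r : ℝ => φ r) '' Icc (-(1 / 2)) (1 / 2),
          Complex.I * (ψ z - (1 / 6 : ℝ) * Complex.I) ∈ Complex.slitPlane := by
        rintro _ ⟨r, hr, rfl⟩
        simp only
        rw [hψ (hseg r hr), Complex.mem_slitPlane_iff]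
        left
        simp
      have hexp : Complex.exp (-(Real.pi / 2 * Complex.I)) = -Complex.I := by
        rw [← neg_mul, Complex.exp_mul_I]; simp
      have hψc : ContinuousOn ψ ((fun r : ℝ => φ r) '' Icc (-(1 / 2)) (1 / 2)) :=
        (h.continuousOn_inv hψ).mono (by
          rintro _ ⟨r, hr, rfl⟩
          exact mem_image_of_mem _ (hseg r hr))
      have key := log_diff_eq hb.isPreconnected hu (w := fun z =>
          Complex.log (Complex.I * (ψ z - (1 / 6 : ℝ) * Complex.I)) + -(Real.pi / 2 * Complex.I))
        ((ContinuousOn.clog (by fun_prop) hsl).add continuousOn_const) (fun z hz => by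
          rw [hu' z hz, Complex.exp_add, Complex.exp_log (Complex.slitPlane_ne_zero (hsl z hz)), hexp]
          linear_combination (ψ z - (1 / 6 : ℝ) * Complex.I) * Complex.I_mul_I)
        hb.left_mem hb.right_mem
      rw [key]
      have h1 : ψ (φ (-(1 / 2))) = -(1 / 2) := by
        have := hψ (hseg (-(1 / 2)) (by constructor <;> norm_num)); rwa [e1] at this
      have h2 : ψ (φ (1 / 2)) = 1 / 2 := by
        have := hψ (hseg (1 / 2) (by constructor <;> norm_num)); rwa [e2] at this
      simp only [h1, h2, Complex.sub_im, Complex.add_im, Complex.log_im]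
      have f1 : (Complex.I * (-(1 / 2) - (1 / 6 : ℝ) * Complex.I)).arg < 0 := by
        rw [Complex.arg_neg_iff]; simp
      have f2 : 0 ≤ (Complex.I * (1 / 2 - (1 / 6 : ℝ) * Complex.I)).arg := by
        rw [Complex.arg_nonneg_iff]; simp
      linarith

lemma exists_disc (h : IsChart D φ H) (hG : GraphFam D V 𝒜) (hV : V ⊆ ⋃₀ 𝒜) (hD : D ⊆ ⋃₀ 𝒜) :
    ∃ V' 𝒜' F J, Extends D 𝒜 V' 𝒜' ∧ IsDisc F J ∧ IsUnionOf 𝒜' J ∧ Disjoint F D ∧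
      φ '' (Metric.ball 0 (1 / 3) ∩ H) ⊆ F ∪ J := by
  obtain ⟨V₁, 𝒜₁, T₁, hE₁, hT₁, hTs₁, ha₁, hb₁, hl₁⟩ := h.lower hG hV hD
  obtain ⟨V₂, 𝒜₂, T₂, hE₂, hT₂, hTs₂, ha₂, hb₂, hl₂⟩ := h.upper hE₁.graph hE₁.sub
  obtain ⟨ψ, hψ⟩ := h.exists_inv
  have hT : IsUnionOf 𝒜₂ (T₁ ∪ T₂) := (hT₁.trans hE₂.cover).union hT₂
  have hTs : T₁ ∪ T₂ ⊆ φ '' (lowerRegion H ∩ H) :=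
    union_subset hTs₁ (hTs₂.trans (image_mono (inter_subset_inter_left _ subset_union_left)))
  have hreg : ∀ z ∈ lowerRegion H, ‖z‖ < 2 / 3 := by
    rintro z (hz | hz)
    · exact hz.2
    · linarith [hz.2.2]
  have hdom : lowerRegion H ∩ H ⊆ Metric.closedBall 0 1 ∩ H := fun z hz =>
    ⟨mem_closedBall_zero_iff.2 (by linarith [hreg z hz.1]), hz.2⟩
  set p : ℂ := (1 / 6 : ℝ) * Complex.I with hp
  have hpim : p.im = 1 / 6 := by simp [hp]
  have hpn : ‖p‖ = 1 / 6 := by simp [hp]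
  have hpr : p ∉ lowerRegion H := by
    rintro (hz | hz)
    · have := hz.1; rw [hpn] at this; norm_num at this
    · have := hz.2.1; rw [hpim] at this; norm_num at this
  have hψT : ContinuousOn ψ (T₁ ∪ T₂) :=
    (h.continuousOn_inv hψ).mono (hTs.trans (image_mono hdom))
  have hnl : ¬ HasLog (fun z => ψ z - p) (T₁ ∪ T₂) := by
    rintro ⟨u, hu, hu'⟩
    have h1 := hl₁ ψ u hψ (hu.mono subset_union_left) fun z hz => hu' z (Or.inl hz)
    have h2 := hl₂ ψ (1 / 6) u (by rw [abs_of_pos] <;> norm_num) hψ (hu.mono subset_union_right)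
      fun z hz => hu' z (Or.inr hz)
    linarith
  obtain ⟨𝓑, h𝓑, h𝓑T⟩ := hT
  have hmap : ∀ z ∈ T₁ ∪ T₂, ψ z ∈ lowerRegion H ∩ H ∧ φ (ψ z) = z := by
    intro z hz
    obtain ⟨w, hw, rfl⟩ := hTs hz
    rw [hψ (hdom hw)]
    exact ⟨hw, rfl⟩
  rw [← h𝓑T] at hψT hnl hmap
  obtain ⟨J, hJu, hJ, hJl⟩ := (hE₂.graph.mono h𝓑).exists_cycle (f := fun z => ψ z - p)
    (hψT.sub continuousOn_const) (fun z hz h0 => hpr (sub_eq_zero.1 h0 ▸ (hmap z hz).1.1)) hnl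
  have hJs : J ⊆ ⋃₀ 𝓑 := hJu.subset
  set C := ψ '' J with hC
  have hCJ : φ '' C = J := by
    rw [hC, image_image]
    exact (image_congr fun z hz => (hmap z (hJs hz)).2).trans (image_id' J)
  have hCs : C ⊆ lowerRegion H ∩ H := by
    rintro _ ⟨z, hz, rfl⟩
    exact (hmap z (hJs hz)).1
  have hCj : IsJordan C := hJ.image (hψT.mono hJs) fun z hz w hw hzw => by
    rw [← (hmap z (hJs hz)).2, ← (hmap w (hJs hw)).2, hzw]
  have hpC : p ∈ inner C := by
    refine ⟨fun hpC => hpr (hCs hpC).1, fun hl => hJl ?_⟩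
    exact hl.comp (g := ψ) (hψT.mono hJs) fun z hz => mem_image_of_mem _ hz
  have hin : inner C ⊆ Metric.ball 0 (2 / 3) := by
    intro z hz
    by_contra hzb
    rw [mem_ball_zero_iff, not_lt] at hzb
    exact (inner_eq C ▸ hz).2 (mem_outer_of_norm (fun w hw => mem_ball_zero_iff.2
      (hreg w (hCs hw).1)) (by norm_num) hzb)
  have hin1 : inner C ⊆ Metric.ball 0 1 := hin.trans (Metric.ball_subset_ball (by norm_num))
  have hinH : inner C ⊆ H ∧ Disjoint (φ '' inner C) D ∧
      Metric.ball 0 (1 / 3) ∩ H ⊆ closure (inner C) := by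
    have key : ∀ Q : Set ℂ, Convex ℝ Q → Q ⊆ Metric.ball 0 (1 / 3) → p ∈ Q →
        (∀ z ∈ Q, H = {z | 0 ≤ z.im} → z.im ≠ 0) → Q ⊆ inner C := by
      intro Q hQ hQb hpQ hQi
      refine hQ.isPreconnected.subset_left_of_subset_union hCj.isOpen_inner hCj.isOpen_outer
        (Set.disjoint_left.2 fun z hz hz' => (inner_eq C ▸ hz).2 hz') ?_ ⟨p, hpQ, hpC⟩
      intro z hz
      by_contra hcon
      rw [mem_union, not_or] at hcon
      have hzC : z ∈ C := by
        by_contra hzC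
        exact hcon.1 (by rw [inner_eq]; exact ⟨hzC, hcon.2⟩)
      rcases (hCs hzC).1 with h1 | h1
      · have := mem_ball_zero_iff.1 (hQb hz)
        linarith [h1.1]
      · exact hQi z hz h1.1 h1.2.1
    have hpb : p ∈ Metric.ball (0 : ℂ) (1 / 3) := by
      rw [mem_ball_zero_iff, hpn]; norm_num
    rcases h.type with ⟨rfl, ht⟩ | ⟨rfl, ht⟩
    · refine ⟨subset_univ _, ?_, ?_⟩
      · rw [Set.disjoint_left]
        rintro _ ⟨z, hz, rfl⟩ hzD
        exact ht z (Metric.ball_subset_closedBall (hin1 hz)) hzD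
      · rw [inter_univ]
        refine (key _ (convex_ball 0 (1 / 3)) Subset.rfl hpb fun z _ hU => ?_).trans subset_closure
        exfalso
        have : (-Complex.I) ∈ (univ : Set ℂ) := mem_univ _
        rw [hU] at this
        norm_num at this
    · have hpos : inner C ⊆ {z | 0 < z.im} := inner_subset_im_pos (hCs.trans inter_subset_right)
      have hge : inner C ⊆ {z | 0 ≤ z.im} := fun z hz => (show (0 : ℝ) < z.im from hpos hz).le
      refine ⟨hge, ?_, ?_⟩
      · rw [Set.disjoint_left]
        rintro _ ⟨z, hz, rfl⟩ hzD
        exact (show (0 : ℝ) < z.im from hpos hz).ne' ((ht z ⟨Metric.ball_subset_closedBall (hin1 hz), hge hz⟩).1 hzD)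
      · refine Subset.trans ?_ (closure_mono (key (Metric.ball 0 (1 / 3) ∩ {z | 0 < z.im})
          ((convex_ball 0 (1 / 3)).inter (convex_halfSpace_im_gt 0)) inter_subset_left
          ⟨hpb, by rw [Set.mem_ofPred_eq, hpim]; norm_num⟩ fun z hz _ => hz.2.ne'))
        rintro z ⟨hz, hz0⟩
        rw [Metric.mem_closure_iff]
        intro ε hε
        rw [mem_ball_zero_iff] at hz
        set δ := min (ε / 2) ((1 / 3 - ‖z‖) / 2) with hδ
        have hδ0 : 0 < δ := lt_min (by linarith) (by linarith)
        have hδn : ‖(δ * Complex.I : ℂ)‖ = δ := by simp [abs_of_pos hδ0]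
        refine ⟨z + δ * Complex.I, ⟨?_, ?_⟩, ?_⟩
        · rw [mem_ball_zero_iff]
          have := norm_add_le z (δ * Complex.I)
          linarith [min_le_right (ε / 2) ((1 / 3 - ‖z‖) / 2)]
        · have : 0 ≤ z.im := hz0
          simp
          linarith
        · rw [dist_eq_norm, sub_add_cancel_left, norm_neg, hδn]
          linarith [min_le_left (ε / 2) ((1 / 3 - ‖z‖) / 2)]
  have hsubdom : C ∪ inner C ⊆ Metric.closedBall 0 1 ∩ H :=
    union_subset (hCs.trans hdom) fun z hz => ⟨Metric.ball_subset_closedBall (hin1 hz), hinH.1 hz⟩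
  refine ⟨V₂, 𝒜₂, φ '' inner C, J, hE₁.trans hE₂, ⟨φ, C, hCj, h.cont.mono hsubdom,
    h.inj.mono hsubdom, rfl, hCJ, ?_⟩, hJu.mono h𝓑, hinH.2.1, ?_⟩
  · have := h.isOpen_image _ hCj.isOpen_inner hin1
    rwa [inter_eq_left.2 hinH.1] at this
  · rw [← hCJ, ← image_union, union_comm]
    exact image_mono (hinH.2.2.trans hCj.closure_inner_subset)

end IsChart

/-- Coordinates modelled on relatively open subsets of the closed half plane. -/
structure IsHalfChart {X : Type*} [TopologicalSpace X] (ψ : ℂ → X) (O : Set ℂ) : Prop where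
  isOpen : IsOpen O
  cont : ContinuousOn ψ (O ∩ {z | 0 ≤ z.im})
  inj : InjOn ψ (O ∩ {z | 0 ≤ z.im})
  isOpen_image : ∀ W, IsOpen W → W ⊆ O → IsOpen (ψ '' (W ∩ {z | 0 ≤ z.im}))

section HalfCharts

variable {X : Type*} [TopologicalSpace X] {ψ : ℂ → X} {O : Set ℂ}

lemma exists_isHalfChart (hS : IsSurface X) (x : X) :
    ∃ (ψ : ℂ → X) (O : Set ℂ) (w : ℂ), IsHalfChart ψ O ∧ w ∈ O ∧ 0 ≤ w.im ∧ ψ w = x := by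
  classical
  obtain ⟨U, V, hU, hxU, hV, ⟨e⟩⟩ := hS.locallyHalfPlane x
  set ι : ℂ → {p : ℝ × ℝ // 0 ≤ p.2} := fun z => ⟨(z.re, max z.im 0), le_max_right _ _⟩ with hι
  have hιc : Continuous ι := by
    apply Continuous.subtype_mk
    fun_prop
  set κ : {p : ℝ × ℝ // 0 ≤ p.2} → ℂ := fun p => p.1.1 + p.1.2 * Complex.I with hκ
  have hκc : Continuous κ := by
    fun_prop
  have hκ0 : ∀ p, 0 ≤ (κ p).im := fun p => by simpa [hκ] using p.2
  have hικ : ∀ p, ι (κ p) = p := fun p => by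
    apply Subtype.ext
    simp [hι, hκ, max_eq_left p.2]
  have hκι : ∀ z : ℂ, 0 ≤ z.im → κ (ι z) = z := fun z hz => by
    apply Complex.ext <;> simp [hι, hκ, max_eq_left hz]
  set ψ : ℂ → X := fun z => if h : ι z ∈ V then (e.symm ⟨ι z, h⟩ : X) else x with hψ
  have hψV : ∀ z (h : ι z ∈ V), ψ z = (e.symm ⟨ι z, h⟩ : X) := fun z h => by
    simp only [hψ, dif_pos h]
  have hx : ψ (κ (e ⟨x, hxU⟩).1) = x := by
    have h : ι (κ (e ⟨x, hxU⟩).1) ∈ V := by rw [hικ]; exact (e ⟨x, hxU⟩).2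
    rw [hψV _ h]
    have : (⟨ι (κ (e ⟨x, hxU⟩).1), h⟩ : V) = e ⟨x, hxU⟩ := Subtype.ext (hικ _)
    rw [this, e.symm_apply_apply]
  refine ⟨ψ, ι ⁻¹' V, κ (e ⟨x, hxU⟩).1, ⟨hV.preimage hιc, ?_, ?_, ?_⟩, ?_, hκ0 _, hx⟩
  · refine ContinuousOn.mono ?_ inter_subset_left
    rw [continuousOn_iff_continuous_domRestrict]
    have : (ι ⁻¹' V).domRestrict ψ =
        fun z : ι ⁻¹' V => (e.symm ⟨ι z.1, z.2⟩ : X) := by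
      ext z
      exact hψV z.1 z.2
    rw [this]
    exact continuous_subtype_val.comp (e.symm.continuous.comp
      ((hιc.comp continuous_subtype_val).subtype_mk _))
  · rintro z ⟨hz, hz0⟩ y ⟨hy, hy0⟩ h
    rw [hψV z hz, hψV y hy] at h
    have := e.symm.injective (Subtype.ext h)
    have := congrArg Subtype.val this
    simp only at this
    rw [← hκι z hz0, ← hκι y hy0, this]
  · intro W hW hWO
    have : ψ '' (W ∩ {z | 0 ≤ z.im}) =
        Subtype.val '' (e.symm '' {v : V | κ v.1 ∈ W}) := by
      ext y
      constructor
      · rintro ⟨z, ⟨hzW, hz0⟩, rfl⟩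
        refine ⟨_, ⟨⟨ι z, hWO hzW⟩, ?_, rfl⟩, (hψV z (hWO hzW)).symm⟩
        rw [Set.mem_ofPred_eq, hκι z hz0]
        exact hzW
      · rintro ⟨_, ⟨v, hv, rfl⟩, rfl⟩
        refine ⟨κ v.1, ⟨hv, hκ0 _⟩, ?_⟩
        have h : ι (κ v.1) ∈ V := by rw [hικ]; exact v.2
        rw [hψV _ h]
        have : (⟨ι (κ v.1), h⟩ : V) = v := Subtype.ext (hικ _)
        rw [this]
    rw [this]
    exact hU.isOpenMap_subtype_val _
      (e.symm.isOpenMap _ (hW.preimage (hκc.comp continuous_subtype_val)))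
  · show ι (κ (e ⟨x, hxU⟩).1) ∈ V
    rw [hικ]
    exact (e ⟨x, hxU⟩).2

lemma isClosed_bd : IsClosed (Bd X) := by
  rw [← isOpen_compl_iff, isOpen_iff_mem_nhds]
  intro x hx
  obtain ⟨U, hU, hxU, hU'⟩ := not_not.1 hx
  exact Filter.mem_of_superset (hU.mem_nhds hxU) fun y hy h => h ⟨U, hU, hy, hU'⟩

namespace IsHalfChart

lemma not_mem_bd (h : IsHalfChart ψ O) {w : ℂ} (hw : w ∈ O) (hw0 : 0 < w.im) : ψ w ∉ Bd X := by
  have hop : IsOpen (O ∩ {z : ℂ | 0 < z.im}) :=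
    h.isOpen.inter (isOpen_lt continuous_const Complex.continuous_im)
  obtain ⟨r, hr, hb⟩ := Metric.isOpen_iff.1 hop w ⟨hw, hw0⟩
  set b := OpenPartialHomeomorph.univBall w r with hbdef
  have hbs : b.source = univ := OpenPartialHomeomorph.univBall_source w r
  have hbt : b.target = Metric.ball w r := OpenPartialHomeomorph.univBall_target w hr
  have hmem : ∀ z, b z ∈ Metric.ball w r := fun z => by
    rw [← hbt]; exact b.map_source (by rw [hbs]; trivial)
  have hmem' : ∀ z, b z ∈ O ∩ {z | 0 ≤ z.im} := fun z =>
    ⟨(hb (hmem z)).1, (show (0 : ℝ) < (b z).im from (hb (hmem z)).2).le⟩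
  have hbc : Continuous b := by
    rw [← continuousOn_univ, ← hbs]; exact b.continuousOn
  have hf : IsOpenEmbedding (ψ ∘ b) := by
    refine IsOpenEmbedding.of_continuous_injective_isOpenMap
      (h.cont.comp_continuous hbc hmem') ?_ ?_
    · intro z y hzy
      exact b.injOn (by rw [hbs]; trivial) (by rw [hbs]; trivial) (h.inj (hmem' z) (hmem' y) hzy)
    · intro W hW
      have h1 : IsOpen (b '' W) := b.isOpen_image_of_subset_source hW (by rw [hbs]; simp)
      have h2 : b '' W ⊆ {z | 0 ≤ z.im} := by
        rintro _ ⟨z, -, rfl⟩; exact (hmem' z).2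
      rw [image_comp, ← inter_eq_left.2 h2]
      refine h.isOpen_image _ h1 ?_
      rintro _ ⟨z, -, rfl⟩
      exact (hmem' z).1
  refine not_not.2 ⟨range (ψ ∘ b), hf.isOpen_range, ?_,
    ⟨hf.isEmbedding.toHomeomorph.symm.trans Complex.equivRealProdCLM.toHomeomorph⟩⟩
  exact ⟨0, by simp [hbdef]⟩

lemma mem_bd [T2Space X] (h : IsHalfChart ψ O) {w : ℂ} (hw : w ∈ O) (hw0 : w.im = 0) :
    ψ w ∈ Bd X := by
  rintro ⟨U, hU, hwU, ⟨k⟩⟩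
  set g : ℂ → X := fun z => (k.symm (Complex.equivRealProdCLM z) : X) with hg
  have hgo : IsOpenEmbedding g := hU.isOpenEmbedding_subtypeVal.comp
    (k.symm.isOpenEmbedding.comp Complex.equivRealProdCLM.toHomeomorph.isOpenEmbedding)
  have hgr : range g = U := by
    ext y
    constructor
    · rintro ⟨z, rfl⟩; exact (k.symm _).2
    · intro hy
      refine ⟨Complex.equivRealProdCLM.symm (k ⟨y, hy⟩), ?_⟩
      simp [hg]
  set p := hgo.toOpenPartialHomeomorph g with hp
  have hpg : ∀ z, p z = g z := fun z => rfl
  have hpt : p.target = U := by simp [hp, hgr]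
  have hgp : ∀ y ∈ U, g (p.symm y) = y := fun y hy => p.right_inv (by rwa [hpt])
  have hpg' : ∀ z, p.symm (g z) = z := fun z => p.left_inv (by simp [hp])
  have hpc : ContinuousOn p.symm U := hpt ▸ p.continuousOn_symm
  have hw0' : w ∈ {z : ℂ | 0 ≤ z.im} := hw0.ge
  obtain ⟨δ, hδ, hδO, hδU⟩ : ∃ δ > 0, Metric.closedBall w δ ⊆ O ∧
      ∀ z ∈ Metric.closedBall w δ ∩ {z | 0 ≤ z.im}, ψ z ∈ U := by
    have h1 : ψ ⁻¹' U ∈ 𝓝[O ∩ {z | 0 ≤ z.im}] w :=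
      (h.cont w ⟨hw, hw0'⟩) (hU.mem_nhds hwU)
    obtain ⟨N, hN, hwN, hNU⟩ := mem_nhdsWithin.1 h1
    obtain ⟨δ, hδ, hb⟩ := Metric.nhds_basis_closedBall.mem_iff.1
      ((hN.inter h.isOpen).mem_nhds ⟨hwN, hw⟩)
    exact ⟨δ, hδ, hb.trans inter_subset_right,
      fun z hz => hNU ⟨(hb hz.1).1, (hb hz.1).2, hz.2⟩⟩
  set K := Metric.closedBall w δ ∩ {z : ℂ | 0 ≤ z.im} with hK
  have hKO : K ⊆ O ∩ {z | 0 ≤ z.im} := inter_subset_inter_left _ hδO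
  have hKc : IsCompact K := (isCompact_closedBall w δ).inter_right
    (isClosed_le continuous_const Complex.continuous_im)
  set θ := Function.invFunOn ψ K with hθ
  have hθl : LeftInvOn θ ψ K := (h.inj.mono hKO).leftInvOn_invFunOn
  have hθc : ContinuousOn θ (ψ '' K) :=
    continuousOn_of_leftInvOn_compact hKc (h.cont.mono hKO) hθl
  have hwK : w ∈ K := ⟨Metric.mem_closedBall_self hδ.le, hw0'⟩
  have hN : IsOpen (g ⁻¹' (ψ '' (Metric.ball w δ ∩ {z | 0 ≤ z.im}))) :=
    (h.isOpen_image _ Metric.isOpen_ball (Metric.ball_subset_closedBall.trans hδO)).preimage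
      hgo.continuous
  obtain ⟨c, hc⟩ : ∃ c, g c = ψ w := ⟨_, hgp _ hwU⟩
  obtain ⟨ρ, hρ, hρN⟩ := Metric.nhds_basis_closedBall.mem_iff.1 (hN.mem_nhds (x := c)
    ⟨w, ⟨Metric.mem_ball_self hδ, hw0'⟩, hc.symm⟩)
  have hlog : HasLog (fun z => p.symm (ψ z) - c) (K \ {w}) := by
    have hc0 : w + (δ / 2 : ℝ) * Complex.I ∈ K \ {w} := by
      refine ⟨⟨?_, ?_⟩, ?_⟩
      · rw [mem_closedBall_iff_norm]
        simp [abs_of_pos hδ]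
        linarith
      · show 0 ≤ (w + (δ / 2 : ℝ) * Complex.I).im
        simp [hw0]; positivity
      · simp [hδ.ne']
    refine hasLog_of_starConvex hc0 ?_ ?_ ?_
    · rw [starConvex_iff_segment_subset]
      rintro z ⟨hzK, hzw⟩ y hy
      have hKconv : Convex ℝ K :=
        (convex_closedBall w δ).inter (convex_halfSpace_im_ge 0)
      refine ⟨hKconv.segment_subset hc0.1 hzK hy, ?_⟩
      rintro rfl
      obtain ⟨s, t, hs, ht, hst, hyy⟩ := hy
      have him := congrArg Complex.im hyy
      simp only [Complex.add_im, Complex.real_smul, Complex.mul_im, Complex.ofReal_re,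
        Complex.ofReal_im, Complex.I_re, Complex.I_im, hw0] at him
      have hz0 : 0 ≤ z.im := hzK.2
      have h3 : s * (δ / 2) = 0 := by
        have : 0 ≤ s * (δ / 2) := by positivity
        have : 0 ≤ t * z.im := by positivity
        nlinarith
      have hs0 : s = 0 := by
        rcases mul_eq_zero.1 h3 with h | h
        · exact h
        · linarith
      have ht1 : t = 1 := by linarith
      apply hzw
      simpa [hs0, ht1] using hyy
    · exact ((hpc.comp (h.cont.mono (sdiff_subset.trans hKO)) fun z hz => hδU z hz.1).sub
        continuousOn_const)
    · rintro z ⟨hzK, hzw⟩ h0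
      apply hzw
      refine h.inj (hKO hzK) (hKO hwK) ?_
      rw [← hgp _ (hδU z hzK), sub_eq_zero.1 h0, hc]
  have hgm : ∀ ζ ∈ Metric.sphere c ρ, ∃ z ∈ K, ψ z = g ζ := fun ζ hζ => by
    obtain ⟨z, hz, hzg⟩ := hρN (Metric.sphere_subset_closedBall hζ)
    exact ⟨z, inter_subset_inter_left _ Metric.ball_subset_closedBall hz, hzg⟩
  have hθg : ∀ ζ ∈ Metric.sphere c ρ, θ (g ζ) ∈ K ∧ ψ (θ (g ζ)) = g ζ := fun ζ hζ => by
    obtain ⟨z, hz, hzg⟩ := hgm ζ hζ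
    rw [← hzg, hθl hz]
    exact ⟨hz, rfl⟩
  have h2 : HasLog (fun ζ => p.symm (ψ (θ (g ζ))) - c) (Metric.sphere c ρ) := by
    refine hlog.comp (g := fun ζ => θ (g ζ)) (hθc.comp hgo.continuous.continuousOn fun ζ hζ => ?_)
      fun ζ hζ => ⟨(hθg ζ hζ).1, fun hζw => ?_⟩
    · obtain ⟨z, hz, hzg⟩ := hgm ζ hζ
      exact ⟨z, hz, hzg⟩
    · have h3 := (hθg ζ hζ).2
      rw [show θ (g ζ) = w from hζw, ← hc] at h3
      rw [← hgo.injective h3] at hζ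
      simp at hζ
      exact hρ.ne hζ
  have h3 : HasLog (fun ζ => (ζ - c) ^ (1 : ℤ)) (Metric.sphere c ρ) :=
    h2.congr fun ζ hζ => by
      simp only [zpow_one]
      rw [(hθg ζ hζ).2, hpg']
  exact one_ne_zero (zpow_log_sphere hρ h3)

end IsHalfChart

lemma exists_isChart (hS : IsSurface X) (x : X) :
    ∃ (φ : ℂ → X) (H : Set ℂ), IsChart (Bd X) φ H ∧ φ 0 = x := by
  have := hS.t2
  obtain ⟨ψ, O, w, h, hw, hw0, rfl⟩ := exists_isHalfChart hS x
  suffices H : ∀ r > 0, ∀ H : Set ℂ, Metric.closedBall w r ⊆ O →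
      (∀ z ∈ Metric.closedBall w r, 0 ≤ z.im ↔ (z - w) / r ∈ H) →
      ((H = univ ∧ ∀ z ∈ Metric.closedBall w r, 0 < z.im) ∨ (H = {z | 0 ≤ z.im} ∧ w.im = 0)) →
      IsChart (Bd X) (fun z => ψ (w + r * z)) H by
    rcases hw0.eq_or_lt with h0 | h0
    · obtain ⟨r, hr, hb⟩ := Metric.nhds_basis_closedBall.mem_iff.1 (h.isOpen.mem_nhds hw)
      refine ⟨_, _, H r hr {z | 0 ≤ z.im} hb (fun z hz => ?_) (Or.inr ⟨rfl, h0.symm⟩), by simp⟩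
      rw [Set.mem_ofPred_eq, Complex.div_ofReal_im, Complex.sub_im, ← h0, sub_zero]
      exact ⟨fun h => by positivity, fun h => by
        have := mul_nonneg h hr.le
        rwa [div_mul_cancel₀ _ hr.ne'] at this⟩
    · have hop : IsOpen (O ∩ {z : ℂ | 0 < z.im}) :=
        h.isOpen.inter (isOpen_lt continuous_const Complex.continuous_im)
      obtain ⟨r, hr, hb⟩ := Metric.nhds_basis_closedBall.mem_iff.1 (hop.mem_nhds ⟨hw, h0⟩)
      exact ⟨_, _, H r hr univ (hb.trans inter_subset_left)
        (fun z hz => ⟨fun _ => mem_univ _, fun _ => (show (0 : ℝ) < z.im from (hb hz).2).le⟩)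
        (Or.inl ⟨rfl, fun z hz => (hb hz).2⟩),
        by simp⟩
  intro r hr H hb hH hT
  have hr0 : (r : ℂ) ≠ 0 := by exact_mod_cast hr.ne'
  have hsc : ∀ z : ℂ, (w + r * z - w) / r = z := fun z => by field_simp; ring
  have hmb : ∀ z ∈ Metric.closedBall (0 : ℂ) 1, w + r * z ∈ Metric.closedBall w r := fun z hz => by
    rw [mem_closedBall_zero_iff] at hz
    rw [mem_closedBall_iff_norm, add_sub_cancel_left, norm_mul, Complex.norm_real,
      Real.norm_eq_abs, abs_of_pos hr]
    nlinarith
  have hm : MapsTo (fun z : ℂ => w + r * z) (Metric.closedBall 0 1 ∩ H) (O ∩ {z | 0 ≤ z.im}) :=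
    fun z hz => ⟨hb (hmb z hz.1), (hH _ (hmb z hz.1)).2 (by rw [hsc]; exact hz.2)⟩
  refine ⟨h.cont.comp (by fun_prop) hm, fun z hz y hy hzy => ?_, fun W hW hWb => ?_, ?_⟩
  · have := h.inj (hm hz) (hm hy) hzy
    simpa [hr0] using this
  · have : (fun z => ψ (w + r * z)) '' (W ∩ H) =
        ψ '' ({y | (y - w) / r ∈ W} ∩ {z | 0 ≤ z.im}) := by
      ext s
      constructor
      · rintro ⟨z, hz, rfl⟩
        refine ⟨w + r * z, ⟨?_, (hm ⟨Metric.ball_subset_closedBall (hWb hz.1), hz.2⟩).2⟩, rfl⟩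
        rw [Set.mem_ofPred_eq, hsc]
        exact hz.1
      · rintro ⟨y, ⟨hyW, hy0⟩, rfl⟩
        have hyy : w + r * ((y - w) / r) = y := by field_simp; ring
        refine ⟨(y - w) / r, ⟨hyW, ?_⟩, by simp only [hyy]⟩
        refine (hH y ?_).1 hy0
        rw [← hyy]
        exact hmb _ (Metric.ball_subset_closedBall (hWb hyW))
    rw [this]
    refine h.isOpen_image _ (hW.preimage (by fun_prop)) fun y hy => ?_
    have hyy : w + r * ((y - w) / r) = y := by field_simp; ring
    rw [← hyy]
    exact hb (hmb _ (Metric.ball_subset_closedBall (hWb hy)))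
  · rcases hT with ⟨rfl, h0⟩ | ⟨rfl, h0⟩
    · refine Or.inl ⟨rfl, fun z hz => ?_⟩
      have h1 := hm ⟨hz, mem_univ z⟩
      exact h.not_mem_bd h1.1 (h0 _ (hmb z hz))
    · refine Or.inr ⟨rfl, fun z hz => ?_⟩
      have h1 := hm hz
      have him : (w + r * z).im = r * z.im := by simp [h0]
      constructor
      · intro hzb
        by_contra hne
        have : 0 < z.im := lt_of_le_of_ne hz.2 (Ne.symm hne)
        exact h.not_mem_bd h1.1 (by rw [him]; positivity) hzb
      · intro hz0
        exact h.mem_bd h1.1 (by rw [him, hz0, mul_zero])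

end HalfCharts

section BoundaryGraph

variable {X : Type*} [TopologicalSpace X] {D : Set X} {φ : ℂ → X} {H : Set ℂ}

/-- The boundary segment of a coordinate half disc. -/
noncomputable def bottom (φ : ℂ → X) (t : ℝ) : X := φ ((t - 1 / 2 : ℝ) : ℂ)

namespace IsChart

lemma half_eq (h : IsChart D φ H) (h0 : φ 0 ∈ D) :
    H = {z | 0 ≤ z.im} ∧ ∀ z ∈ Metric.closedBall 0 1 ∩ H, φ z ∈ D ↔ z.im = 0 := by
  rcases h.type with ⟨-, ht⟩ | h
  · exact absurd h0 (ht 0 (Metric.mem_closedBall_self zero_le_one))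
  · exact h

lemma ofReal_mem (h : IsChart D φ H) {s : ℝ} (hs : |s| ≤ 1) :
    (s : ℂ) ∈ Metric.closedBall 0 1 ∩ H :=
  ⟨by simpa using hs, h.mem_half (by simp)⟩

lemma bottom_mem_dom (h : IsChart D φ H) {t : ℝ} (ht : t ∈ Icc (0 : ℝ) 1) :
    ((t - 1 / 2 : ℝ) : ℂ) ∈ Metric.closedBall 0 1 ∩ H :=
  h.ofReal_mem (by rw [abs_le]; constructor <;> linarith [ht.1, ht.2])

lemma bottom_subset (h : IsChart D φ H) (h0 : φ 0 ∈ D) : bottom φ '' Icc 0 1 ⊆ D := by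
  rintro _ ⟨t, ht, rfl⟩
  exact ((h.half_eq h0).2 _ (h.bottom_mem_dom ht)).2 (Complex.ofReal_im _)

lemma mem_bottom (h : IsChart D φ H) (h0 : φ 0 ∈ D) {z : ℂ}
    (hz : z ∈ Metric.ball (0 : ℂ) (1 / 2) ∩ H) (hzD : φ z ∈ D) : φ z ∈ bottom φ '' Ioo 0 1 := by
  have him := ((h.half_eq h0).2 z ⟨Metric.ball_subset_closedBall
    (Metric.ball_subset_ball (by norm_num) hz.1), hz.2⟩).1 hzD
  have hre : z = (z.re : ℂ) := Complex.ext rfl (by simpa using him)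
  have hn := hz.1
  rw [hre, mem_ball_zero_iff, Complex.norm_real, Real.norm_eq_abs, abs_lt] at hn
  refine ⟨z.re + 1 / 2, ⟨by linarith, by linarith⟩, ?_⟩
  rw [bottom, add_sub_cancel_right, ← hre]

lemma flatPath_bottom (h : IsChart D φ H) (h0 : φ 0 ∈ D) : FlatPath D (bottom φ) := by
  have hm : MapsTo (fun t : ℝ => ((t - 1 / 2 : ℝ) : ℂ)) (Icc 0 1) (Metric.closedBall 0 1 ∩ H) :=
    fun t ht => h.bottom_mem_dom ht
  refine ⟨h.cont.comp (by fun_prop) hm, ?_, ?_⟩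
  · intro s hs t ht hst
    have := h.inj (hm hs) (hm ht) hst
    have := Complex.ofReal_injective this
    linarith
  · intro t ht
    set w : ℂ := ((t - 1 / 2 : ℝ) : ℂ) with hw
    have hwd : w ∈ Metric.closedBall 0 1 ∩ H := hm (Ioo_subset_Icc_self ht)
    have hwb : w ∈ Metric.ball (0 : ℂ) (1 / 2) := by
      rw [mem_ball_zero_iff, hw, Complex.norm_real, Real.norm_eq_abs, abs_lt]
      constructor <;> linarith [ht.1, ht.2]
    have key : ∀ W ∈ 𝓝 (bottom φ t), ∃ ε > 0, Metric.ball w ε ⊆ Metric.ball 0 (1 / 2) ∧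
        φ '' (Metric.ball w ε ∩ H) ⊆ W := by
      intro W hW
      obtain ⟨N, hN, hwN, hNW⟩ := mem_nhdsWithin.1 ((h.cont w hwd) hW)
      obtain ⟨ε, hε, hb⟩ := Metric.isOpen_iff.1 (hN.inter Metric.isOpen_ball) w ⟨hwN, hwb⟩
      refine ⟨ε, hε, hb.trans inter_subset_right, image_subset_iff.2 fun z hz => hNW
        ⟨(hb hz.1).1, Metric.ball_subset_closedBall
          (Metric.ball_subset_ball (by norm_num) (hb hz.1).2), hz.2⟩⟩
    have hiff : ∀ ε, Metric.ball w ε ⊆ Metric.ball (0 : ℂ) (1 / 2) → ∀ z ∈ Metric.ball w ε, z ∈ H →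
        (φ z ∈ bottom φ '' Icc 0 1 ↔ z.im = 0) := by
      intro ε hb z hz hzH
      have hzc : z ∈ Metric.closedBall (0 : ℂ) 1 ∩ H := ⟨Metric.ball_subset_closedBall
        (Metric.ball_subset_ball (by norm_num) (hb hz)), hzH⟩
      constructor
      · intro hz'
        exact ((h.half_eq h0).2 z hzc).1 (h.bottom_subset h0 hz')
      · intro hz'
        exact image_mono Ioo_subset_Icc_self
          (h.mem_bottom h0 ⟨hb hz, hzH⟩ (((h.half_eq h0).2 z hzc).2 hz'))
    constructor
    · rw [mem_closure_iff_nhds]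
      intro W hW
      obtain ⟨ε, hε, hb, hbW⟩ := key W hW
      have hz : w + (ε / 2 : ℝ) * Complex.I ∈ Metric.ball w ε := by
        rw [mem_ball_iff_norm]
        simp [abs_of_pos hε]
        linarith
      have hzi : (w + (ε / 2 : ℝ) * Complex.I).im = ε / 2 := by simp [hw]
      have hzH : w + (ε / 2 : ℝ) * Complex.I ∈ H := h.mem_half (by rw [hzi]; positivity)
      refine ⟨_, hbW ⟨_, ⟨hz, hzH⟩, rfl⟩, fun hza => ?_⟩
      have := (hiff ε hb _ hz hzH).1 hza
      rw [hzi] at this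
      linarith
    · intro W hW
      obtain ⟨ε, hε, hb, hbW⟩ := key W hW
      have hsub : Metric.ball w ε ∩ {z | 0 < z.im} ⊆ Metric.closedBall 0 1 ∩ H := fun z hz =>
        ⟨Metric.ball_subset_closedBall (Metric.ball_subset_ball (by norm_num) (hb hz.1)),
          h.mem_half (show (0 : ℝ) < z.im from hz.2).le⟩
      have hpre : IsPreconnected (φ '' (Metric.ball w ε ∩ {z | 0 < z.im})) :=
        (((convex_ball w ε).inter (convex_halfSpace_im_gt 0)).isPreconnected).image _
          (h.cont.mono hsub)
      refine ⟨_, (h.isOpen_image _ Metric.isOpen_ball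
        (hb.trans (Metric.ball_subset_ball (by norm_num)))).mem_nhds
        ⟨w, ⟨Metric.mem_ball_self hε, hwd.2⟩, rfl⟩, hbW, _, _, hpre, hpre, ?_, fun _ => rfl⟩
      rw [union_self]
      ext y
      constructor
      · rintro ⟨⟨z, hz, rfl⟩, hza⟩
        refine ⟨z, ⟨hz.1, ?_⟩, rfl⟩
        have hz0 : 0 ≤ z.im := by
          have := hz.2
          rwa [(h.half_eq h0).1] at this
        exact lt_of_le_of_ne hz0 fun h' => hza ((hiff ε hb z hz.1 hz.2).2 h'.symm)
      · rintro ⟨z, hz, rfl⟩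
        exact ⟨⟨z, ⟨hz.1, (hsub hz).2⟩, rfl⟩, fun hza =>
          (show (0 : ℝ) < z.im from hz.2).ne' ((hiff ε hb z hz.1 (hsub hz).2).1 hza)⟩

/-- A connected part of the boundary avoiding the ends of a boundary segment does not cross
that segment. -/
lemma bottom_dichotomy [T2Space X] (h : IsChart D φ H) (h0 : φ 0 ∈ D) {s : Set X}
    (hs : IsPreconnected s) (hsD : s ⊆ D) (h1 : bottom φ 0 ∉ s) (h2 : bottom φ 1 ∉ s) :
    s ⊆ bottom φ '' Icc 0 1 ∨ Disjoint s (bottom φ '' Icc 0 1) := by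
  have hbc : IsClosed (bottom φ '' Icc 0 1) :=
    (isCompact_Icc.image_of_continuousOn (h.flatPath_bottom h0).cont).isClosed
  set U := φ '' (Metric.ball 0 (1 / 2) ∩ H) with hU
  have hUo : IsOpen U := h.isOpen_image _ Metric.isOpen_ball
    (Metric.ball_subset_ball (by norm_num))
  have hUb : ∀ x ∈ U, x ∈ D → x ∈ bottom φ '' Icc 0 1 := by
    rintro _ ⟨z, hz, rfl⟩ hzD
    exact image_mono Ioo_subset_Icc_self (h.mem_bottom h0 hz hzD)
  refine (isPreconnected_iff_subset_of_disjoint.1 hs U (bottom φ '' Icc 0 1)ᶜ hUo hbc.isOpen_compl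
    ?_ ?_).imp (fun h x hx => hUb x (h hx) (hsD hx)) fun h => disjoint_left.2 fun x hx => h hx
  · intro x hx
    by_cases hxb : x ∈ bottom φ '' Icc 0 1
    · left
      obtain ⟨t, ht, rfl⟩ := hxb
      have ht0 : t ≠ 0 := by rintro rfl; exact h1 hx
      have ht1 : t ≠ 1 := by rintro rfl; exact h2 hx
      have hl := lt_of_le_of_ne ht.1 (Ne.symm ht0)
      have hr := lt_of_le_of_ne ht.2 ht1
      refine ⟨((t - 1 / 2 : ℝ) : ℂ), ⟨?_, (h.bottom_mem_dom ht).2⟩, rfl⟩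
      rw [mem_ball_zero_iff, Complex.norm_real, Real.norm_eq_abs, abs_lt]
      constructor <;> linarith
    · exact Or.inr hxb
  · rw [eq_empty_iff_forall_notMem]
    rintro x ⟨hx, hxU, hxb⟩
    exact hxb (hUb x hxU (hsD hx))

end IsChart

lemma exists_boundary_graph [T2Space X] (hD : IsCompact D)
    (hch : ∀ x : X, ∃ (φ : ℂ → X) (H : Set ℂ), IsChart D φ H ∧ φ 0 = x) :
    ∃ V 𝒜, GraphFam D V 𝒜 ∧ V ⊆ ⋃₀ 𝒜 ∧ ⋃₀ 𝒜 = D := by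
  classical
  choose φ H hφ hφ0 using hch
  have h0 : ∀ x ∈ D, φ x 0 ∈ D := fun x hx => by rwa [hφ0]
  obtain ⟨s, hsD, hs⟩ := hD.elim_nhds_subcover
    (fun x => φ x '' (Metric.ball 0 (1 / 2) ∩ H x)) fun x hx =>
      ((hφ x).isOpen_image _ Metric.isOpen_ball (Metric.ball_subset_ball (by norm_num))).mem_nhds
        ⟨0, ⟨Metric.mem_ball_self (by norm_num), (hφ x).mem_half (by simp)⟩, hφ0 x⟩
  have key : ∀ s : Finset X, (∀ x ∈ s, x ∈ D) →
      ∃ V 𝒜, GraphFam D V 𝒜 ∧ V ⊆ ⋃₀ 𝒜 ∧ ⋃₀ 𝒜 = ⋃ x ∈ s, bottom (φ x) '' Icc 0 1 := by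
    intro s
    induction s using Finset.induction_on with
    | empty =>
      intro _
      exact ⟨∅, ∅, ⟨finite_empty, finite_empty, by simp, by simp, by simp⟩, by simp, by simp⟩
    | insert x s hx ih =>
      intro hs
      obtain ⟨V, 𝒜, hG, hV, hA⟩ := ih fun y hy => hs y (Finset.mem_insert_of_mem hy)
      have hxD := hs x (Finset.mem_insert_self x s)
      have hγ := (hφ x).flatPath_bottom (h0 x hxD)
      set E : Set X := ⋃ y ∈ s, {bottom (φ y) 0, bottom (φ y) 1} with hE
      have hEf : E.Finite := s.finite_toSet.biUnion fun y _ => toFinite _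
      have hPf : {t | t ∈ Icc (0 : ℝ) 1 ∧ bottom (φ x) t ∈ E}.Finite :=
        hEf.of_injOn (fun t ht => ht.2) (hγ.inj.mono fun t ht => ht.1)
      obtain ⟨V', 𝒜', hE', hA'⟩ := GraphFam.addFinPath hγ hPf.toFinset hG hV le_rfl zero_lt_one le_rfl
        (fun p q hp hpq hq hd => by
          have hsub : Ioo p q ⊆ Icc 0 1 := fun t ht => ⟨by linarith [ht.1], by linarith [ht.2]⟩
          have hpre : IsPreconnected (bottom (φ x) '' Ioo p q) :=
            isPreconnected_Ioo.image _ (hγ.cont.mono hsub)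
          have hpD : bottom (φ x) '' Ioo p q ⊆ D :=
            (image_mono hsub).trans ((hφ x).bottom_subset (h0 x hxD))
          have hnE : ∀ z ∈ bottom (φ x) '' Ioo p q, z ∉ E := by
            rintro _ ⟨t, ht, rfl⟩ htE
            exact disjoint_left.1 hd ht (by simpa using ⟨hsub ht, htE⟩)
          rw [hA]
          by_cases hex : ∃ y ∈ s, bottom (φ x) '' Ioo p q ⊆ bottom (φ y) '' Icc 0 1
          · obtain ⟨y, hy, hys⟩ := hex
            exact Or.inl fun z hz => mem_biUnion hy (hys hz)
          · push Not at hex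
            right
            rw [disjoint_iUnion₂_right]
            intro y hy
            refine ((hφ y).bottom_dichotomy (h0 y (hs y (Finset.mem_insert_of_mem hy))) hpre hpD
              ?_ ?_).resolve_left (hex y hy)
            · exact fun h => hnE _ h (mem_biUnion hy (Or.inl rfl))
            · exact fun h => hnE _ h (mem_biUnion hy (Or.inr rfl)))
      refine ⟨V', 𝒜', hE'.graph, hE'.sub, ?_⟩
      rw [hA', hA, Finset.set_biUnion_insert, union_comm]
  obtain ⟨V, 𝒜, hG, hV, hA⟩ := key s hsD
  refine ⟨V, 𝒜, hG, hV, hA.trans (Subset.antisymm ?_ ?_)⟩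
  · exact iUnion₂_subset fun x hx => (hφ x).bottom_subset (h0 x (hsD x hx))
  · intro z hz
    obtain ⟨x, hx, w, hw, rfl⟩ := mem_iUnion₂.1 (hs hz)
    exact mem_biUnion hx (image_mono Ioo_subset_Icc_self
      ((hφ x).mem_bottom (h0 x (hsD x hx)) hw hz))

end BoundaryGraph

lemma exists_disc_cover {X : Type*} [MetricSpace X] [CompactSpace X] {D : Set X}
    (hD : IsClosed D)
    (hch : ∀ x : X, ∃ (φ : ℂ → X) (H : Set ℂ), IsChart D φ H ∧ φ 0 = x) :
    ∃ (V : Set X) (𝒜 : Set (Set X)) (𝓓 : Set (Set X × Set X)), GraphFam D V 𝒜 ∧ V ⊆ ⋃₀ 𝒜 ∧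
      D ⊆ ⋃₀ 𝒜 ∧ 𝓓.Finite ∧
      (∀ d ∈ 𝓓, IsDisc d.1 d.2 ∧ IsUnionOf 𝒜 d.2 ∧ Disjoint d.1 D) ∧
      (⋃ d ∈ 𝓓, d.1 ∪ d.2) = univ := by
  classical
  obtain ⟨V₀, 𝒜₀, hG₀, hV₀, hA₀⟩ := exists_boundary_graph hD.isCompact hch
  choose φ H hφ hφ0 using hch
  obtain ⟨s, -, hs⟩ := isCompact_univ.elim_nhds_subcover
    (fun x => φ x '' (Metric.ball 0 (1 / 3) ∩ H x)) fun x _ =>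
      ((hφ x).isOpen_image _ Metric.isOpen_ball (Metric.ball_subset_ball (by norm_num))).mem_nhds
        ⟨0, ⟨Metric.mem_ball_self (by norm_num), (hφ x).mem_half (by simp)⟩, hφ0 x⟩
  have key : ∀ s : Finset X, ∃ (V : Set X) (𝒜 : Set (Set X)) (𝓓 : Set (Set X × Set X)),
      GraphFam D V 𝒜 ∧ V ⊆ ⋃₀ 𝒜 ∧ D ⊆ ⋃₀ 𝒜 ∧ 𝓓.Finite ∧
      (∀ d ∈ 𝓓, IsDisc d.1 d.2 ∧ IsUnionOf 𝒜 d.2 ∧ Disjoint d.1 D) ∧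
      (⋃ x ∈ s, φ x '' (Metric.ball 0 (1 / 3) ∩ H x)) ⊆ ⋃ d ∈ 𝓓, d.1 ∪ d.2 := by
    intro s
    induction s using Finset.induction_on with
    | empty => exact ⟨V₀, 𝒜₀, ∅, hG₀, hV₀, hA₀.ge, finite_empty, by simp, by simp⟩
    | insert x s hx ih =>
      obtain ⟨V, 𝒜, 𝓓, hG, hV, hA, hf, hd, hc⟩ := ih
      obtain ⟨V', 𝒜', F, J, hE, hF, hJ, hFD, hcov⟩ := (hφ x).exists_disc hG hV hA
      refine ⟨V', 𝒜', insert (F, J) 𝓓, hE.graph, hE.sub, hA.trans hE.sUnion_subset,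
        hf.insert _, ?_, ?_⟩
      · rintro d (rfl | hd')
        · exact ⟨hF, hJ, hFD⟩
        · exact ⟨(hd d hd').1, (hd d hd').2.1.trans hE.cover, (hd d hd').2.2⟩
      · rw [Finset.set_biUnion_insert, biUnion_insert]
        exact union_subset_union hcov hc
  obtain ⟨V, 𝒜, 𝓓, hG, hV, hA, hf, hd, hc⟩ := key s
  exact ⟨V, 𝒜, 𝓓, hG, hV, hA, hf, hd, univ_subset_iff.1 (hs.trans hc)⟩

section DiscPosition

variable {X : Type*} [TopologicalSpace X] [T2Space X] {F J F' J' P : Set X}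

lemma IsDisc.subset_of_meet (h : IsDisc F J) (hP : IsPreconnected P) (hPJ : Disjoint P J)
    (hm : (P ∩ F).Nonempty) : P ⊆ F := by
  refine hP.subset_left_of_subset_union h.isOpen h.isCompact.isClosed.isOpen_compl
    (disjoint_left.2 fun x hx hx' => hx' (Or.inl hx)) (fun x hx => ?_) hm
  by_cases hxF : x ∈ F
  · exact Or.inl hxF
  · exact Or.inr fun hx' => hx'.elim hxF (disjoint_left.1 hPJ hx)

lemma IsDisc.boundary_eq (h : IsDisc F J) : J = closure F \ F := by
  rw [h.closure_eq, union_sdiff_left]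
  exact h.disjoint.symm.sdiff_eq_left.symm

lemma IsDisc.eq_of_meet (h : IsDisc F J) (h' : IsDisc F' J') (h1 : Disjoint F J')
    (h2 : Disjoint F' J) (hm : (F ∩ F').Nonempty) : F = F' ∧ J = J' := by
  have hF : F = F' := Subset.antisymm (h'.subset_of_meet h.isPreconnected h1 hm)
    (h.subset_of_meet h'.isPreconnected h2 (by rwa [inter_comm]))
  exact ⟨hF, by rw [h.boundary_eq, h'.boundary_eq, hF]⟩

end DiscPosition

/-- Small punctured neighbourhoods are connected. -/
def PuncturedConnected (X : Type*) [TopologicalSpace X] : Prop :=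
  ∀ x : X, ∀ W ∈ 𝓝 x, ∃ B ∈ 𝓝 x, B ⊆ W ∧ IsPreconnected (B \ {x}) ∧ (B \ {x}).Nonempty

lemma isPreconnected_halfBall_punctured {ε : ℝ} (hε : 0 < ε) :
    IsPreconnected ((Metric.ball (0 : ℂ) ε ∩ {z | 0 ≤ z.im}) \ {0}) := by
  have hc0 : ((ε / 2 : ℝ) * Complex.I : ℂ) ∈ (Metric.ball (0 : ℂ) ε ∩ {z | 0 ≤ z.im}) \ {0} := by
    refine ⟨⟨?_, ?_⟩, ?_⟩
    · rw [mem_ball_zero_iff]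
      simp [abs_of_pos hε]
      linarith
    · show 0 ≤ ((ε / 2 : ℝ) * Complex.I : ℂ).im
      simp; positivity
    · simp [hε.ne']
  have hst : StarConvex ℝ ((ε / 2 : ℝ) * Complex.I : ℂ)
      ((Metric.ball (0 : ℂ) ε ∩ {z | 0 ≤ z.im}) \ {0}) := by
    rw [starConvex_iff_segment_subset]
    rintro z ⟨hzK, hzw⟩ y hy
    have hKconv : Convex ℝ (Metric.ball (0 : ℂ) ε ∩ {z | 0 ≤ z.im}) :=
      (convex_ball 0 ε).inter (convex_halfSpace_im_ge 0)
    refine ⟨hKconv.segment_subset hc0.1 hzK hy, ?_⟩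
    rintro rfl
    obtain ⟨s, t, hs, ht, hst, hyy⟩ := hy
    have him := congrArg Complex.im hyy
    simp only [Complex.add_im, Complex.real_smul, Complex.mul_im, Complex.ofReal_re,
      Complex.ofReal_im, Complex.I_re, Complex.I_im, Complex.zero_im] at him
    have hz0 : 0 ≤ z.im := hzK.2
    have h3 : s * (ε / 2) = 0 := by
      have : 0 ≤ s * (ε / 2) := by positivity
      have : 0 ≤ t * z.im := by positivity
      nlinarith
    have hs0 : s = 0 := by
      rcases mul_eq_zero.1 h3 with h | h
      · exact h
      · linarith
    have ht1 : t = 1 := by linarith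
    apply hzw
    simpa [hs0, ht1] using hyy
  exact (hst.isPathConnected hc0).isConnected.isPreconnected

lemma isPreconnected_ball_punctured {ε : ℝ} (hε : 0 < ε) :
    IsPreconnected (Metric.ball (0 : ℂ) ε \ {0}) := by
  have h1 := isPreconnected_halfBall_punctured hε
  have h2 := h1.image (starRingEnd ℂ) Complex.continuous_conj.continuousOn
  have hp : ((ε / 2 : ℝ) : ℂ) ∈ (Metric.ball (0 : ℂ) ε ∩ {z | 0 ≤ z.im}) \ {0} := by
    refine ⟨⟨?_, ?_⟩, ?_⟩
    · rw [mem_ball_zero_iff, Complex.norm_real, Real.norm_eq_abs, abs_of_pos (by positivity)]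
      linarith
    · simp
    · simpa using hε.ne'
  have hp' : ((ε / 2 : ℝ) : ℂ) ∈
      starRingEnd ℂ '' ((Metric.ball (0 : ℂ) ε ∩ {z | 0 ≤ z.im}) \ {0}) :=
    ⟨_, hp, Complex.conj_ofReal _⟩
  have hu := IsPreconnected.union _ hp hp' h1 h2
  convert hu using 1
  ext z
  constructor
  · rintro ⟨hz, hz0⟩
    rcases le_total 0 z.im with h | h
    · exact Or.inl ⟨⟨hz, h⟩, hz0⟩
    · refine Or.inr ⟨starRingEnd ℂ z, ⟨⟨by simpa using hz, ?_⟩, ?_⟩, Complex.conj_conj z⟩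
      · show 0 ≤ (starRingEnd ℂ z).im
        rw [Complex.conj_im]; linarith
      · simpa using hz0
  · rintro (⟨⟨hz, -⟩, hz0⟩ | ⟨z, ⟨⟨hz, -⟩, hz0⟩, rfl⟩)
    · exact ⟨hz, hz0⟩
    · exact ⟨by simpa using hz, by simpa using hz0⟩

section Punctured

variable {X : Type*} [TopologicalSpace X] {D : Set X} {φ : ℂ → X} {H : Set ℂ}

lemma IsChart.exists_ball (h : IsChart D φ H) {W : Set X} (hW : W ∈ 𝓝 (φ 0)) :
    ∃ ε > 0, ε < 1 ∧ φ '' (Metric.ball 0 ε ∩ H) ⊆ W := by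
  have h0 : (0 : ℂ) ∈ Metric.closedBall 0 1 ∩ H :=
    ⟨Metric.mem_closedBall_self zero_le_one, h.mem_half (by simp)⟩
  obtain ⟨N, hN, hwN, hNW⟩ := mem_nhdsWithin.1 ((h.cont 0 h0) hW)
  obtain ⟨ε, hε, hb⟩ := Metric.isOpen_iff.1 hN 0 hwN
  refine ⟨min ε (1 / 2), by positivity, (min_le_right _ _).trans_lt (by norm_num),
    image_subset_iff.2 fun z hz => hNW ⟨hb (Metric.ball_subset_ball (min_le_left _ _) hz.1), ?_,
      hz.2⟩⟩
  exact Metric.ball_subset_closedBall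
    (Metric.ball_subset_ball ((min_le_right _ _).trans (by norm_num)) hz.1)

lemma puncturedConnected
    (hch : ∀ x : X, ∃ (φ : ℂ → X) (H : Set ℂ), IsChart D φ H ∧ φ 0 = x) :
    PuncturedConnected X := by
  intro x W hW
  obtain ⟨φ, H, h, rfl⟩ := hch x
  obtain ⟨ε, hε, hε1, hb⟩ := h.exists_ball hW
  have hsub : Metric.ball 0 ε ∩ H ⊆ Metric.closedBall 0 1 ∩ H := inter_subset_inter_left _
    (Metric.ball_subset_closedBall.trans (Metric.closedBall_subset_closedBall hε1.le))
  have h0 : (0 : ℂ) ∈ Metric.ball 0 ε ∩ H :=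
    ⟨Metric.mem_ball_self hε, h.mem_half (by simp)⟩
  have hpre : IsPreconnected ((Metric.ball (0 : ℂ) ε ∩ H) \ {0}) := by
    rcases h.type with ⟨rfl, -⟩ | ⟨rfl, -⟩
    · rw [inter_univ]; exact isPreconnected_ball_punctured hε
    · exact isPreconnected_halfBall_punctured hε
  have himg : φ '' (Metric.ball 0 ε ∩ H) \ {φ 0} = φ '' ((Metric.ball 0 ε ∩ H) \ {0}) := by
    rw [(h.inj.mono hsub).image_sdiff_subset (singleton_subset_iff.2 h0), image_singleton]
  refine ⟨_, (h.isOpen_image _ Metric.isOpen_ball (Metric.ball_subset_ball hε1.le)).mem_nhds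
    ⟨0, h0, rfl⟩, hb, ?_, ?_⟩
  · rw [himg]
    exact hpre.image _ (h.cont.mono (sdiff_subset.trans hsub))
  · rw [himg]
    refine ⟨_, ((ε / 2 : ℝ) : ℂ), ⟨⟨?_, h.mem_half (by simp)⟩, ?_⟩, rfl⟩
    · rw [mem_ball_zero_iff, Complex.norm_real, Real.norm_eq_abs, abs_of_pos (by positivity)]
      linarith
    · simpa using hε.ne'

lemma infinite_boundary_inter
    (hch : ∀ x : X, ∃ (φ : ℂ → X) (H : Set ℂ), IsChart D φ H ∧ φ 0 = x) {x : X} (hx : x ∈ D)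
    {W : Set X} (hW : W ∈ 𝓝 x) : (D ∩ W).Infinite := by
  obtain ⟨φ, H, h, rfl⟩ := hch x
  obtain ⟨ε, hε, hε1, hb⟩ := h.exists_ball hW
  have hm : ∀ t ∈ Ioo (0 : ℝ) ε, (t : ℂ) ∈ Metric.closedBall 0 1 ∩ H := fun t ht =>
    h.ofReal_mem (by rw [abs_of_pos ht.1]; linarith [ht.2])
  have hinj : InjOn (fun t : ℝ => φ t) (Ioo 0 ε) := fun s hs t ht hst =>
    Complex.ofReal_injective (h.inj (hm s hs) (hm t ht) hst)
  refine ((Ioo_infinite hε).image hinj).mono ?_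
  rintro _ ⟨t, ht, rfl⟩
  refine ⟨((h.half_eq hx).2 _ (hm t ht)).2 (Complex.ofReal_im t), hb ⟨_, ⟨?_, (hm t ht).2⟩, rfl⟩⟩
  rw [mem_ball_zero_iff, Complex.norm_real, Real.norm_eq_abs, abs_of_pos ht.1]
  exact ht.2

lemma PuncturedConnected.isPreconnected_compl [T2Space X] [PreconnectedSpace X]
    (h : PuncturedConnected X) {V : Set X} (hV : V.Finite) : IsPreconnected Vᶜ := by
  have hloc : ∀ x, ∀ N ∈ 𝓝 x, ∃ B ∈ 𝓝 x, B ⊆ N ∧ B \ {x} ⊆ Vᶜ ∧ IsPreconnected (B \ {x}) ∧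
      (B \ {x}).Nonempty := by
    intro x N hN
    obtain ⟨B, hB, hBW, hp, hn⟩ := h x (N ∩ (V \ {x})ᶜ) (Filter.inter_mem hN
      ((hV.subset sdiff_subset).isClosed.isOpen_compl.mem_nhds fun h => h.2 rfl))
    exact ⟨B, hB, fun y hy => (hBW hy).1, fun y hy hyV => (hBW hy.1).2 ⟨hyV, hy.2⟩, hp, hn⟩
  rw [isPreconnected_iff_subset_of_disjoint]
  intro u v hu hv huv hd
  have hVo : IsOpen Vᶜ := hV.isClosed.isOpen_compl
  have hdisj : ∀ x ∉ V, x ∈ u → x ∈ v → False := fun x hxV hxu hxv => by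
    have : x ∈ Vᶜ ∩ (u ∩ v) := ⟨hxV, hxu, hxv⟩
    rw [hd] at this
    exact this
  have hcov : closure (Vᶜ ∩ u) ∪ closure (Vᶜ ∩ v) = univ := by
    rw [← closure_union, ← inter_union_distrib_left, inter_eq_left.2 huv, eq_univ_iff_forall]
    intro x
    rw [mem_closure_iff_nhds]
    intro N hN
    obtain ⟨B, hB, hBN, hBV, -, y, hy⟩ := hloc x N hN
    exact ⟨y, hBN hy.1, hBV hy⟩
  have hcd : closure (Vᶜ ∩ u) ∩ closure (Vᶜ ∩ v) = ∅ := by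
    rw [eq_empty_iff_forall_notMem]
    rintro x ⟨hxu, hxv⟩
    by_cases hxV : x ∈ V
    · obtain ⟨B, hB, -, hBV, hBp, -⟩ := hloc x univ Filter.univ_mem
      rw [mem_closure_iff_nhds] at hxu hxv
      obtain ⟨y, hyB, hyV, hyu⟩ := hxu B hB
      obtain ⟨z, hzB, hzV, hzv⟩ := hxv B hB
      have hyx : y ≠ x := by rintro rfl; exact hyV hxV
      have hzx : z ≠ x := by rintro rfl; exact hzV hxV
      obtain ⟨w, hw, hwu, hwv⟩ := hBp u v hu hv (hBV.trans huv) ⟨y, ⟨hyB, hyx⟩, hyu⟩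
        ⟨z, ⟨hzB, hzx⟩, hzv⟩
      exact hdisj w (hBV hw) hwu hwv
    · rcases huv hxV with h | h
      · obtain ⟨y, ⟨hyV, hyu⟩, -, hyv⟩ := mem_closure_iff.1 hxv _ (hVo.inter hu) ⟨hxV, h⟩
        exact hdisj y hyV hyu hyv
      · obtain ⟨y, ⟨hyV, hyv⟩, -, hyu⟩ := mem_closure_iff.1 hxu _ (hVo.inter hv) ⟨hxV, h⟩
        exact hdisj y hyV hyu hyv
  by_contra hcon
  push Not at hcon
  obtain ⟨⟨y, hyV, hyu⟩, z, hzV, hzv⟩ := (not_subset.1 hcon.1), (not_subset.1 hcon.2)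
  have h1 : y ∈ closure (Vᶜ ∩ v) := subset_closure ⟨hyV, (huv hyV).resolve_left hyu⟩
  have h2 : z ∈ closure (Vᶜ ∩ u) := subset_closure ⟨hzV, (huv hzV).resolve_right hzv⟩
  obtain ⟨x, -, hx⟩ := isPreconnected_closed_iff.1 (isPreconnected_univ (α := X)) _ _
    isClosed_closure isClosed_closure hcov.ge ⟨z, trivial, h2⟩ ⟨y, trivial, h1⟩
  rw [hcd] at hx
  exact hx

end Punctured

/-- A cover of a space by finitely many closed discs, carried by a graph. -/
structure DiscSystem {X : Type*} [TopologicalSpace X] (D V : Set X) (𝒜 : Set (Set X))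
    (𝓓 : Set (Set X × Set X)) : Prop where
  graph : GraphFam D V 𝒜
  sub : V ⊆ ⋃₀ 𝒜
  boundary : D ⊆ ⋃₀ 𝒜
  fin : 𝓓.Finite
  disc : ∀ d ∈ 𝓓, IsDisc d.1 d.2 ∧ IsUnionOf 𝒜 d.2 ∧ Disjoint d.1 D
  cover : (⋃ d ∈ 𝓓, d.1 ∪ d.2) = univ
  edges : ∀ a ∈ 𝒜, ∃ d ∈ 𝓓, a ⊆ d.2
  meet : ∀ c ∈ 𝓓, ∀ d ∈ 𝓓, (c.2 ∩ d.1).Nonempty → (c.2 ∩ d.2).Nontrivial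

lemma IsJordan.diff_of_subsingleton {X : Type*} [TopologicalSpace X] {C K : Set X}
    (h : IsJordan C) (hK : (C ∩ K).Subsingleton) : IsPreconnected (C \ K) := by
  rcases hK.eq_empty_or_singleton with h0 | ⟨z, hz⟩
  · have : C \ K = C := by
      rw [sdiff_eq_left]; exact disjoint_iff_inter_eq_empty.2 h0
    rw [this]; exact h.isPreconnected
  · have : C \ K = C \ {z} := by rw [← hz, sdiff_self_inter]
    rw [this]; exact h.diff_singleton z

lemma GraphFam.restrict {X : Type*} [TopologicalSpace X] [T2Space X] {D V : Set X}
    {𝒜 𝓑 : Set (Set X)} (h : GraphFam D V 𝒜) (hs : 𝓑 ⊆ 𝒜) : GraphFam D (V ∩ ⋃₀ 𝓑) 𝓑 := by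
  have h' := h.mono hs
  refine ⟨h'.finV.subset inter_subset_left, h'.finA, fun a ha => ?_, fun a ha b hb hab x hx => ?_,
    fun a ha z hz => ?_⟩
  · obtain ⟨x, y, hxy, hV⟩ := h'.arc a ha
    refine ⟨x, y, hxy, ?_⟩
    rw [← hV]
    ext z
    exact ⟨fun hz => ⟨hz.1, hz.2.1⟩, fun hz => ⟨hz.1, hz.2, a, ha, hz.1⟩⟩
  · exact ⟨h'.inter a ha b hb hab hx, a, ha, hx.1⟩
  · exact h'.flat a ha z ⟨hz.1, fun hzV => hz.2 ⟨hzV, a, ha, hz.1⟩⟩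

lemma redundant_of_meet {X : Type*} [TopologicalSpace X] [T2Space X] [PreconnectedSpace X]
    (hX : PuncturedConnected X) {D U C U' C' : Set X} (hD : D.Infinite) (h : IsDisc U C)
    (h' : IsDisc U' C') (hUD : Disjoint U D) (hUD' : Disjoint U' D) (hm : (C ∩ U').Nonempty)
    (hs : (C ∩ C').Subsingleton) : U ∪ C ⊆ U' ∪ C' := by
  have h1 : C \ C' ⊆ U' := by
    refine h'.subset_of_meet (h.isJordan.diff_of_subsingleton hs) disjoint_sdiff_left ?_
    obtain ⟨x, hx, hx'⟩ := hm
    exact ⟨x, ⟨hx, disjoint_left.1 h'.disjoint hx'⟩, hx'⟩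
  by_cases hU : (C' ∩ U).Nonempty
  · exfalso
    have h2 : C' \ C ⊆ U := by
      refine h.subset_of_meet (h'.isJordan.diff_of_subsingleton (by rwa [inter_comm]))
        disjoint_sdiff_left ?_
      obtain ⟨x, hx, hx'⟩ := hU
      exact ⟨x, ⟨hx, disjoint_left.1 h.disjoint hx'⟩, hx'⟩
    have h3 : (C ∩ C')ᶜ ⊆ U ∪ U' := by
      refine (hX.isPreconnected_compl hs.finite).subset_left_of_subset_union
        (v := ((U ∪ C) ∪ (U' ∪ C'))ᶜ)
        (h.isOpen.union h'.isOpen) (h.isCompact.isClosed.union h'.isCompact.isClosed).isOpen_compl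
        (disjoint_left.2 fun x hx hx' => hx' (hx.imp Or.inl Or.inl)) (fun x hx => ?_) ?_
      · by_cases hxU : x ∈ U ∪ U'
        · exact Or.inl hxU
        · refine Or.inr ?_
          rintro ((hx' | hx') | (hx' | hx'))
          · exact hxU (Or.inl hx')
          · exact hxU (Or.inr (h1 ⟨hx', fun hx2 => hx ⟨hx', hx2⟩⟩))
          · exact hxU (Or.inr hx')
          · exact hxU (Or.inl (h2 ⟨hx', fun hx2 => hx ⟨hx2, hx'⟩⟩))
      · obtain ⟨x, hx, hx'⟩ := hm
        exact ⟨x, fun h3 => disjoint_left.1 h'.disjoint hx' h3.2, Or.inr hx'⟩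
    refine hD (hs.finite.subset fun x hx => by_contra fun hx' => ?_)
    exact (h3 hx').elim (fun h4 => disjoint_left.1 hUD h4 hx) fun h4 => disjoint_left.1 hUD' h4 hx
  · have h2 : U ⊆ U' := by
      refine h'.subset_of_meet h.isPreconnected
        (disjoint_left.2 fun x hx hx' => hU ⟨x, hx', hx⟩) ?_
      obtain ⟨x, hx, hx'⟩ := hm
      have := mem_closure_iff.1 (h.subset_closure hx) U' h'.isOpen hx'
      rwa [inter_comm]
    rw [← h.closure_eq, ← h'.closure_eq]
    exact closure_mono h2

lemma exists_discSystem {X : Type*} [MetricSpace X] [CompactSpace X] [PreconnectedSpace X]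
    {D : Set X} (hD : IsClosed D) (hDi : D.Nonempty)
    (hch : ∀ x : X, ∃ (φ : ℂ → X) (H : Set ℂ), IsChart D φ H ∧ φ 0 = x) :
    ∃ V 𝒜 𝓓, DiscSystem D V 𝒜 𝓓 := by
  obtain ⟨V, 𝒜, 𝓓, hG, hV, hDA, hfin, hdisc, hcov⟩ := exists_disc_cover hD hch
  have hinf : D.Infinite := by
    obtain ⟨x, hx⟩ := hDi
    simpa using infinite_boundary_inter hch hx (Filter.univ_mem)
  have hfam : {𝓔 | 𝓔 ⊆ 𝓓 ∧ (⋃ d ∈ 𝓔, d.1 ∪ d.2) = univ}.Finite :=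
    hfin.finite_subsets.subset fun _ h => h.1
  obtain ⟨𝓔, h𝓔⟩ := hfam.exists_minimal ⟨𝓓, Subset.rfl, hcov⟩
  obtain ⟨h𝓔D, h𝓔c⟩ := h𝓔.prop
  have hsub : {a ∈ 𝒜 | ∃ d ∈ 𝓔, a ⊆ d.2} ⊆ 𝒜 := fun a ha => ha.1
  have hun : ∀ d ∈ 𝓔, IsUnionOf {a ∈ 𝒜 | ∃ d ∈ 𝓔, a ⊆ d.2} d.2 := by
    intro d hd
    obtain ⟨𝓑, h𝓑, h𝓑d⟩ := (hdisc d (h𝓔D hd)).2.1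
    exact ⟨𝓑, fun a ha => ⟨h𝓑 ha, d, hd, h𝓑d ▸ subset_sUnion_of_mem ha⟩, h𝓑d⟩
  refine ⟨_, {a ∈ 𝒜 | ∃ d ∈ 𝓔, a ⊆ d.2}, 𝓔, hG.restrict hsub, inter_subset_right, ?_,
    hfin.subset h𝓔D, fun d hd => ⟨(hdisc d (h𝓔D hd)).1, hun d hd, (hdisc d (h𝓔D hd)).2.2⟩, h𝓔c,
    fun a ha => ha.2, ?_⟩
  · intro x hx
    have : x ∈ ⋃ d ∈ 𝓔, d.1 ∪ d.2 := h𝓔c ▸ mem_univ x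
    simp only [mem_iUnion] at this
    obtain ⟨d, hd, hxd | hxd⟩ := this
    · exact absurd hx (disjoint_left.1 (hdisc d (h𝓔D hd)).2.2 hxd)
    · exact (hun d hd).subset hxd
  · intro c hc d hd hm
    by_contra hs
    rw [not_nontrivial_iff] at hs
    have hcd := redundant_of_meet (puncturedConnected hch) hinf (hdisc c (h𝓔D hc)).1
      (hdisc d (h𝓔D hd)).1 (hdisc c (h𝓔D hc)).2.2 (hdisc d (h𝓔D hd)).2.2 hm hs
    have hne : d ≠ c := by
      rintro rfl
      obtain ⟨x, hx, hx'⟩ := hm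
      exact disjoint_left.1 (hdisc d (h𝓔D hc)).1.disjoint hx' hx
    have hmem : 𝓔 \ {c} ∈ {𝓔 | 𝓔 ⊆ 𝓓 ∧ (⋃ d ∈ 𝓔, d.1 ∪ d.2) = univ} := by
      refine ⟨sdiff_subset.trans h𝓔D, eq_univ_of_forall fun x => ?_⟩
      have : x ∈ ⋃ d ∈ 𝓔, d.1 ∪ d.2 := h𝓔c ▸ mem_univ x
      simp only [mem_iUnion] at this ⊢
      obtain ⟨e, he, hxe⟩ := this
      by_cases hec : e = c
      · exact ⟨d, ⟨hd, hne⟩, hcd (hec ▸ hxe)⟩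
      · exact ⟨e, ⟨he, hec⟩, hxe⟩
    exact (h𝓔.le_of_le hmem sdiff_subset hc).2 rfl

lemma DiscSystem.subdiv {X : Type*} [TopologicalSpace X] {D V W : Set X} {𝒜 𝒜' : Set (Set X)}
    {𝓓 : Set (Set X × Set X)} (h : DiscSystem D V 𝒜 𝓓) (hG : GraphFam D (W ∪ V) 𝒜')
    (hs : Subdiv 𝒜 𝒜') (hW : W ⊆ ⋃₀ 𝒜) : DiscSystem D (W ∪ V) 𝒜' 𝓓 := by
  refine ⟨hG, ?_, ?_, h.fin, fun d hd => ⟨(h.disc d hd).1, (h.disc d hd).2.1.trans hs.cover,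
    (h.disc d hd).2.2⟩, h.cover, fun a ha => ?_, h.meet⟩
  · rw [hs.sUnion_eq]; exact union_subset hW h.sub
  · rw [hs.sUnion_eq]; exact h.boundary
  · obtain ⟨b, hb, hab⟩ := hs.le a ha
    obtain ⟨d, hd, hbd⟩ := h.edges b hb
    exact ⟨d, hd, hab.trans hbd⟩

lemma exists_subarc_mem {X : Type*} [TopologicalSpace X] {a U : Set X} {x y z : X}
    (ha : IsArc a x y) (hz : z ∈ a) (hzx : z ≠ x) (hzy : z ≠ y) (hU : U ∈ 𝓝 z) :
    ∃ s u v, IsArc s u v ∧ s ⊆ a ∧ s ⊆ U ∧ z ∈ s ∧ z ≠ u ∧ z ≠ v := by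
  obtain ⟨f, hf, hi, rfl, rfl, rfl⟩ := ha
  obtain ⟨t, ht, rfl⟩ := hz
  have ht0 : 0 < t := lt_of_le_of_ne ht.1 fun h => hzx (by rw [h])
  have ht1 : t < 1 := lt_of_le_of_ne ht.2 fun h => hzy (by rw [h])
  have hc : ContinuousAt f t := hf.continuousAt (Icc_mem_nhds ht0 ht1)
  obtain ⟨ε, hε, hεU⟩ := Metric.mem_nhds_iff.1 (hc hU)
  set p := max 0 (t - ε / 2) with hp
  set q := min 1 (t + ε / 2) with hq
  have hpt : p < t := max_lt ht0 (by linarith)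
  have htq : t < q := lt_min ht1 (by linarith)
  have hp0 : 0 ≤ p := le_max_left _ _
  have hq1 : q ≤ 1 := min_le_left _ _
  have hpε : t - ε / 2 ≤ p := le_max_right _ _
  have hqε : q ≤ t + ε / 2 := min_le_right _ _
  have hsub : Icc p q ⊆ Icc 0 1 := Icc_subset_Icc hp0 hq1
  refine ⟨f '' Icc p q, f p, f q, isArc_of_Icc (hpt.trans htq) (hf.mono hsub) (hi.mono hsub),
    image_mono hsub, ?_, mem_image_of_mem _ ⟨hpt.le, htq.le⟩, fun h => ?_, fun h => ?_⟩
  · rintro _ ⟨r, hr, rfl⟩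
    refine hεU ?_
    rw [Metric.mem_ball, Real.dist_eq, abs_lt]
    constructor <;> linarith [hr.1, hr.2]
  · exact hpt.ne' (hi ht ⟨hp0, (hpt.trans htq).le.trans hq1⟩ h)
  · exact htq.ne (hi ht ⟨hp0.trans (hpt.trans htq).le, hq1⟩ h)

lemma exists_discSystem_free {X : Type*} [MetricSpace X] [CompactSpace X] [PreconnectedSpace X]
    {D K : Set X} (hD : IsClosed D) (hK : IsClosed K) (hKD : K ⊂ D)
    (hch : ∀ x : X, ∃ (φ : ℂ → X) (H : Set ℂ), IsChart D φ H ∧ φ 0 = x) :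
    ∃ V 𝒜 𝓓, DiscSystem D V 𝒜 𝓓 ∧ ∃ a ∈ 𝒜, ((a \ V) ∩ D).Nonempty ∧ Disjoint a K := by
  obtain ⟨p, hpD, hpK⟩ := exists_of_ssubset hKD
  obtain ⟨V, 𝒜, 𝓓, h⟩ := exists_discSystem hD ⟨p, hpD⟩ hch
  obtain ⟨z, ⟨hzD, hzK⟩, hzV⟩ :=
    ((infinite_boundary_inter hch hpD (hK.isOpen_compl.mem_nhds hpK)).sdiff h.graph.finV).nonempty
  obtain ⟨a, ha, hza⟩ := h.boundary hzD
  obtain ⟨x, y, hxy, hav⟩ := h.graph.arc a ha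
  have hzxy : z ∉ ({x, y} : Set X) := fun hz => hzV (hav.symm ▸ hz : z ∈ a ∩ V).2
  simp only [mem_insert_iff, mem_singleton_iff, not_or] at hzxy
  obtain ⟨s, u, v, hs, hsa, hsK, hzs, hzu, hzv⟩ := exists_subarc_mem hxy hza hzxy.1 hzxy.2
    (hK.isOpen_compl.mem_nhds hzK)
  obtain ⟨𝒜', hG, hsub⟩ := h.graph.addVertices (W := {u, v}) (toFinite _)
  have hA : s ⊆ ⋃₀ 𝒜' := by
    rw [hsub.sUnion_eq]; exact hsa.trans (subset_sUnion_of_mem ha)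
  obtain ⟨b, hb, hzb⟩ := hA hzs
  have hzW : z ∉ ({u, v} : Set X) ∪ V := by
    rintro ((rfl | rfl) | hz)
    exacts [hzu rfl, hzv rfl, hzV hz]
  refine ⟨_, 𝒜', 𝓓, h.subdiv hG hsub (hs.ends_subset.trans
    (hsa.trans (subset_sUnion_of_mem ha))), b, hb, ⟨z, ⟨hzb, hzW⟩, hzD⟩, ?_⟩
  have hbs := hG.edge_subset_of_arc hs (Or.inl (Or.inl rfl)) (Or.inl (Or.inr rfl)) hA hb hzs hzb hzW
  exact disjoint_left.2 fun w hw hwK => hsK (hbs hw) hwK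

section Faces

variable {X : Type*} [TopologicalSpace X] [T2Space X] {D V T : Set X} {𝒜 : Set (Set X)}
  {𝓓 : Set (Set X × Set X)}

lemma GraphFam.ear_end_mem (h : GraphFam D V 𝒜) (hT : IsUnionOf 𝒜 T) {e : Set X} {u v : X}
    (he : IsArc e u v) (heA : e ⊆ ⋃₀ 𝒜) (heT : e ∩ T = {u, v}) : {u, v} ⊆ V := by
  intro w hw
  by_contra hwV
  have hcl : IsClosed (⋃₀ {b ∈ 𝒜 | ¬ b ⊆ T}) :=
    h.isClosed_of_isUnionOf (isUnionOf_of_subset fun b hb => hb.1)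
  have hsub : e \ {u, v} ⊆ ⋃₀ {b ∈ 𝒜 | ¬ b ⊆ T} := by
    intro x hx
    obtain ⟨b, hb, hxb⟩ := heA hx.1
    exact ⟨b, ⟨hb, fun hbT => hx.2 (heT ▸ ⟨hx.1, hbT hxb⟩)⟩, hxb⟩
  obtain ⟨b, ⟨hb, hbT⟩, hwb⟩ :=
    closure_minimal hsub hcl (he.diff_ends.2.2 (he.ends_subset hw))
  rw [← heT] at hw
  exact hbT (h.subset_of_mem hT hb hwb hw.2 hwV)

lemma DiscSystem.exists_faces_disc (h : DiscSystem D V 𝒜 𝓓) {d : Set X × Set X} (hd : d ∈ 𝓓)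
    (n : ℕ) : ∀ (T : Set X) (𝓕 : Set (Set X × Set X)), {a ∈ 𝒜 | ¬ a ⊆ T}.ncard = n →
      IsUnionOf 𝒜 T → d.2 ⊆ T → 𝓕.Finite →
      (∀ f ∈ 𝓕, IsDisc f.1 f.2 ∧ IsUnionOf 𝒜 f.2 ∧ f.2 ⊆ T ∧ Disjoint f.1 T ∧ f.1 ⊆ d.1) →
      (d.1 ⊆ T ∪ ⋃ f ∈ 𝓕, f.1) →
      ∃ 𝓖 : Set (Set X × Set X), 𝓖.Finite ∧
        (∀ f ∈ 𝓖, IsDisc f.1 f.2 ∧ IsUnionOf 𝒜 f.2 ∧ Disjoint f.1 (⋃₀ 𝒜)) ∧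
        d.1 ⊆ ⋃₀ 𝒜 ∪ ⋃ f ∈ 𝓖, f.1 := by
  induction n using Nat.strong_induction_on with
  | _ n ih =>
  intro T 𝓕 hn hT hdT hfin hF hcov
  by_cases hend : ∀ f ∈ 𝓕, Disjoint f.1 (⋃₀ 𝒜)
  · exact ⟨𝓕, hfin, fun f hf => ⟨(hF f hf).1, (hF f hf).2.1, hend f hf⟩,
      hcov.trans (union_subset_union_left _ hT.subset)⟩
  push Not at hend
  obtain ⟨f, hf, hfA⟩ := hend
  obtain ⟨hfd, hfu, hfT, hfdT, hfsub⟩ := hF f hf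
  obtain ⟨z₀, hz₀, a, ha, hz₀a⟩ := not_disjoint_iff.1 hfA
  obtain ⟨z, hzf, hza, hzV⟩ :=
    mem_closure_iff.1 (h.graph.subset_closure_edge ha hz₀a) f.1 hfd.isOpen hz₀
  have hzT : z ∉ T := disjoint_left.1 hfdT hzf
  obtain ⟨c, hc, hac⟩ := h.edges a ha
  obtain ⟨x, hx, y, hy, hxy⟩ := h.meet c hc d hd ⟨z, hac hza, hfsub hzf⟩
  have hTc : IsClosed T := h.graph.isClosed_of_isUnionOf hT
  obtain ⟨e, u, v, he, hec, hze, heT⟩ := (h.disc c hc).1.isJordan.exists_ear hTc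
    ⟨hx.1, hdT hx.2⟩ ⟨hy.1, hdT hy.2⟩ hxy (hac hza) hzT
  have heA : e ⊆ ⋃₀ 𝒜 := hec.trans (h.disc c hc).2.1.subset
  have huv := h.graph.ear_end_mem hT he heA heT
  have huV : u ∈ V := huv (Or.inl rfl)
  have hvV : v ∈ V := huv (Or.inr rfl)
  have heu : IsUnionOf 𝒜 e := h.graph.isUnionOf_arc he huV hvV heA
  have hinner : e \ {u, v} ⊆ f.1 := by
    refine hfd.subset_of_meet he.diff_ends.1 ?_ ⟨z, ⟨hze, fun hz => hzT ?_⟩, hzf⟩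
    · exact disjoint_left.2 fun w hw hw' => hw.2 (heT ▸ ⟨hw.1, hfT hw'⟩)
    · rw [← heT] at hz; exact hz.2
  have hends : ∀ w ∈ ({u, v} : Set X), w ∈ f.2 := by
    intro w hw
    have h1 : w ∈ f.1 ∪ f.2 := by
      rw [← hfd.closure_eq]
      exact closure_mono hinner (he.diff_ends.2.2 (he.ends_subset hw))
    rw [← heT] at hw
    exact h1.resolve_left fun h2 => disjoint_left.1 hfdT h2 hw.2
  obtain ⟨b₁, b₂, hJ⟩ := hfd.isJordan.split (hends u (Or.inl rfl)) (hends v (Or.inr rfl)) he.ne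
  have hb₁ : b₁ ⊆ f.2 := hJ.2.2.2 ▸ subset_union_left
  have hb₂ : b₂ ⊆ f.2 := hJ.2.2.2 ▸ subset_union_right
  obtain ⟨F₁, F₂, hF₁, hF₂, hF₁₂, -⟩ := hfd.theta hJ he hinner
  have hF₁s : F₁ ⊆ f.1 \ e := hF₁₂ ▸ subset_union_left
  have hF₂s : F₂ ⊆ f.1 \ e := hF₁₂ ▸ subset_union_right
  have hdisj : ∀ {F : Set X}, F ⊆ f.1 \ e → Disjoint F (T ∪ e) := fun hFs =>
    disjoint_left.2 fun w hw hw' => hw'.elim (disjoint_left.1 hfdT (hFs hw).1) (hFs hw).2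
  refine ih _ ?_ (T ∪ e) ((𝓕 \ {f}) ∪ {(F₁, e ∪ b₁), (F₂, e ∪ b₂)}) rfl (hT.union heu)
    (hdT.trans subset_union_left) (hfin.sdiff.union (toFinite _)) ?_ ?_
  · rw [← hn]
    refine ncard_lt_ncard ⟨fun b hb => ⟨hb.1, fun hbT => hb.2 (hbT.trans subset_union_left)⟩,
      fun hsub => ?_⟩ (h.graph.finA.subset fun b hb => hb.1)
    exact (hsub (show a ∈ {b ∈ 𝒜 | ¬ b ⊆ T} from ⟨ha, fun haT => hzT (haT hza)⟩)).2
      ((h.graph.subset_of_mem heu ha hza hze hzV).trans subset_union_right)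
  · rintro g (⟨hg, hgf⟩ | rfl | rfl)
    · obtain ⟨hgd, hgu, hgT, hgdT, hgsub⟩ := hF g hg
      refine ⟨hgd, hgu, hgT.trans subset_union_left, ?_, hgsub⟩
      refine disjoint_left.2 fun w hw hw' => hw'.elim (disjoint_left.1 hgdT hw) fun hwe => ?_
      have hwf : w ∈ f.1 := hinner ⟨hwe, fun hw2 => by
        rw [← heT] at hw2; exact disjoint_left.1 hgdT hw hw2.2⟩
      obtain ⟨h1, h2⟩ := hgd.eq_of_meet hfd (hgdT.mono_right hfT) (hfdT.mono_right hgT) ⟨w, hw, hwf⟩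
      exact hgf (Prod.ext h1 h2)
    · exact ⟨hF₁, heu.union (h.graph.isUnionOf_arc' hfu hJ.1 huV hvV hb₁),
        union_subset subset_union_right (hb₁.trans (hfT.trans subset_union_left)), hdisj hF₁s,
        (hF₁s.trans sdiff_subset).trans hfsub⟩
    · exact ⟨hF₂, heu.union (h.graph.isUnionOf_arc' hfu hJ.2.1 huV hvV hb₂),
        union_subset subset_union_right (hb₂.trans (hfT.trans subset_union_left)), hdisj hF₂s,
        (hF₂s.trans sdiff_subset).trans hfsub⟩
  · intro w hw
    rcases hcov hw with hwT | hwF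
    · exact Or.inl (Or.inl hwT)
    simp only [mem_iUnion] at hwF
    obtain ⟨g, hg, hwg⟩ := hwF
    by_cases hgf : g = f
    · subst hgf
      by_cases hwe : w ∈ e
      · exact Or.inl (Or.inr hwe)
      right
      simp only [mem_iUnion]
      rcases hF₁₂.subset ⟨hwg, hwe⟩ with hw1 | hw2
      · exact ⟨(F₁, e ∪ b₁), Or.inr (Or.inl rfl), hw1⟩
      · exact ⟨(F₂, e ∪ b₂), Or.inr (Or.inr rfl), hw2⟩
    · right
      simp only [mem_iUnion]
      exact ⟨g, Or.inl ⟨hg, hgf⟩, hwg⟩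

/-- A finite graph whose complementary components are open discs. -/
structure CellSystem (D V : Set X) (𝒜 : Set (Set X)) (𝓕 : Set (Set X × Set X)) : Prop where
  graph : GraphFam D V 𝒜
  sub : V ⊆ ⋃₀ 𝒜
  boundary : D ⊆ ⋃₀ 𝒜
  fin : 𝓕.Finite
  disc : ∀ f ∈ 𝓕, IsDisc f.1 f.2 ∧ IsUnionOf 𝒜 f.2 ∧ Disjoint f.1 (⋃₀ 𝒜)
  cover : (⋃₀ 𝒜 ∪ ⋃ f ∈ 𝓕, f.1) = univ

lemma DiscSystem.exists_cellSystem (h : DiscSystem D V 𝒜 𝓓) : ∃ 𝓕, CellSystem D V 𝒜 𝓕 := by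
  have key : ∀ d ∈ 𝓓, ∃ 𝓖 : Set (Set X × Set X), 𝓖.Finite ∧
      (∀ f ∈ 𝓖, IsDisc f.1 f.2 ∧ IsUnionOf 𝒜 f.2 ∧ Disjoint f.1 (⋃₀ 𝒜)) ∧
      d.1 ⊆ ⋃₀ 𝒜 ∪ ⋃ f ∈ 𝓖, f.1 := by
    intro d hd
    obtain ⟨hdd, hdu, -⟩ := h.disc d hd
    refine h.exists_faces_disc hd _ d.2 {d} rfl hdu Subset.rfl (finite_singleton d) ?_ ?_
    · rintro f rfl
      exact ⟨hdd, hdu, Subset.rfl, hdd.disjoint, Subset.rfl⟩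
    · intro x hx
      right
      simpa using hx
  choose! 𝓖 h𝓖 using key
  refine ⟨⋃ d ∈ 𝓓, 𝓖 d, h.graph, h.sub, h.boundary,
    h.fin.biUnion fun d hd => (h𝓖 d hd).1, ?_, eq_univ_of_forall fun x => ?_⟩
  · intro f hf
    simp only [mem_iUnion] at hf
    obtain ⟨d, hd, hf⟩ := hf
    exact (h𝓖 d hd).2.1 f hf
  · have : x ∈ ⋃ d ∈ 𝓓, d.1 ∪ d.2 := h.cover ▸ mem_univ x
    simp only [mem_iUnion] at this
    obtain ⟨d, hd, hx | hx⟩ := this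
    · refine ((h𝓖 d hd).2.2 hx).imp_right fun hx => ?_
      simp only [mem_iUnion] at hx ⊢
      obtain ⟨f, hf, hxf⟩ := hx
      exact ⟨f, ⟨d, hd, hf⟩, hxf⟩
    · exact Or.inl ((h.disc d hd).2.1.subset hx)

end Faces

section Retraction

variable {X : Type*} [TopologicalSpace X]

/-- `A` is a strong deformation retract of `K`. -/
def SDR (K A : Set X) : Prop :=
  ∃ H : ℝ → X → X, ContinuousOn (fun q : ℝ × X => H q.1 q.2) (univ ×ˢ K) ∧
    (∀ z ∈ K, H 0 z = z) ∧ (∀ t, ∀ z ∈ K, H t z ∈ K) ∧ (∀ z ∈ K, H 1 z ∈ A) ∧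
    ∀ t, ∀ z ∈ A, H t z = z

lemma SDR.refl (K : Set X) : SDR K K :=
  ⟨fun _ z => z, continuousOn_snd, fun _ _ => rfl, fun _ _ h => h, fun _ h => h, fun _ _ _ => rfl⟩

lemma SDR.trans {K A B : Set X} (hK : IsClosed K) (hAK : A ⊆ K) (hBA : B ⊆ A) (h : SDR K A)
    (h' : SDR A B) : SDR K B := by
  classical
  obtain ⟨H, hc, h0, hm, h1, hf⟩ := h
  obtain ⟨H', hc', h0', hm', h1', hf'⟩ := h'
  have hK1 : IsClosed ({t : ℝ | t ≤ 1 / 2} ×ˢ K) := (isClosed_Iic (a := (1 / 2 : ℝ))).prod hK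
  have hK2 : IsClosed ({t : ℝ | 1 / 2 ≤ t} ×ˢ K) := (isClosed_Ici (a := (1 / 2 : ℝ))).prod hK
  have hu : ContinuousOn (fun q : ℝ × X => H (2 * q.1) q.2) ({t : ℝ | t ≤ 1 / 2} ×ˢ K) :=
    hc.comp (f := fun q : ℝ × X => (2 * q.1, q.2)) (by fun_prop) fun q hq => ⟨trivial, hq.2⟩
  have hw : ContinuousOn (fun q : ℝ × X => H' (2 * q.1 - 1) (H 1 q.2))
      ({t : ℝ | 1 / 2 ≤ t} ×ˢ K) := by
    have h2 : ContinuousOn (fun q : ℝ × X => H 1 q.2) ({t : ℝ | 1 / 2 ≤ t} ×ˢ K) :=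
      hc.comp (f := fun q : ℝ × X => ((1 : ℝ), q.2)) (by fun_prop) fun q hq => ⟨trivial, hq.2⟩
    exact hc'.comp (f := fun q : ℝ × X => (2 * q.1 - 1, H 1 q.2))
      (ContinuousOn.prodMk (by fun_prop) h2) fun q hq => ⟨trivial, h1 _ hq.2⟩
  have hg := continuousOn_glue_closed hu hw hK1 hK2 (fun q hq => by
    have h3 : q.1 = 1 / 2 := le_antisymm hq.1.1 hq.2.1
    have h4 : (2 : ℝ) * q.1 = 1 := by rw [h3]; norm_num
    show H (2 * q.1) q.2 = H' (2 * q.1 - 1) (H 1 q.2)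
    rw [h4, sub_self, h0' _ (h1 _ hq.1.2)])
  refine ⟨fun t z => if t ≤ 1 / 2 then H (2 * t) z else H' (2 * t - 1) (H 1 z), ?_, ?_, ?_, ?_, ?_⟩
  · refine (hg.mono fun q hq => ?_).congr fun q hq => ?_
    · rcases le_total q.1 (1 / 2) with h | h
      · exact Or.inl ⟨h, hq.2⟩
      · exact Or.inr ⟨h, hq.2⟩
    · by_cases h : q.1 ≤ 1 / 2
      · have : q ∈ {t : ℝ | t ≤ 1 / 2} ×ˢ K := ⟨h, hq.2⟩
        simp only [if_pos h, if_pos this]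
      · have : q ∉ {t : ℝ | t ≤ 1 / 2} ×ˢ K := fun h' => h h'.1
        simp only [if_neg h, if_neg this]
  · intro z hz
    simp [h0 z hz]
  · intro t z hz
    by_cases h : t ≤ 1 / 2
    · simp only [if_pos h]; exact hm _ z hz
    · simp only [if_neg h]; exact hAK (hm' _ _ (h1 z hz))
  · intro z hz
    have h : ¬ (1 : ℝ) ≤ 1 / 2 := by norm_num
    simp only [if_neg h]
    have h5 : (2 : ℝ) * 1 - 1 = 1 := by norm_num
    rw [h5]; exact h1' _ (h1 z hz)
  · intro t z hz
    simp only [hf _ z (hBA hz), hf' _ z hz, ite_self]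

lemma SDR.glue {K A L : Set X} (hK : IsClosed K) (hL : IsClosed L) (h : SDR K A)
    (hKL : K ∩ L = A) : SDR (K ∪ L) L := by
  classical
  obtain ⟨H, hc, h0, hm, h1, hf⟩ := h
  have hg := continuousOn_glue_closed hc (w := fun q => q.2) continuousOn_snd
    (isClosed_univ.prod hK) ((isClosed_univ (X := ℝ)).prod hL) (fun q hq => hf _ _ (hKL ▸ ⟨hq.1.2, hq.2.2⟩))
  refine ⟨fun t z => if z ∈ K then H t z else z, ?_, ?_, ?_, ?_, ?_⟩
  · refine (hg.mono fun q hq => hq.2.imp (fun h => ⟨trivial, h⟩) fun h => ⟨trivial, h⟩).congr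
      fun q hq => ?_
    simp
  · intro z _
    by_cases h : z ∈ K
    · simp [h, h0 z h]
    · simp [h]
  · intro t z hz
    by_cases h : z ∈ K
    · simp only [h, if_true]; exact Or.inl (hm t z h)
    · simpa only [h, if_false] using hz
  · intro z hz
    by_cases h : z ∈ K
    · simp only [h, if_true]; exact (hKL ▸ h1 z h : H 1 z ∈ K ∩ L).2
    · simp only [h, if_false]; exact hz.resolve_left h
  · intro t z hz
    by_cases h : z ∈ K
    · simp only [h, if_true]; exact hf t z (hKL ▸ ⟨h, hz⟩)
    · simp only [h, if_false]

end Retraction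

namespace CellSystem

variable {X : Type*} [TopologicalSpace X] [T2Space X] {D V K : Set X} {𝒜 𝓑 : Set (Set X)}
  {𝓕 𝓡 : Set (Set X × Set X)} {a : Set X} {f g : Set X × Set X}

omit [T2Space X] in
lemma notMem_of_mem (h : CellSystem D V 𝒜 𝓕) (hf : f ∈ 𝓕) {x : X} (hx : x ∈ ⋃₀ 𝒜) : x ∉ f.1 :=
  fun hxf => disjoint_left.1 (h.disc f hf).2.2 hxf hx

lemma eq_of_meet (h : CellSystem D V 𝒜 𝓕) (hf : f ∈ 𝓕) (hg : g ∈ 𝓕) {x : X} (hx : x ∈ f.1)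
    (hx' : x ∈ g.1) : f = g := by
  obtain ⟨h1, h2⟩ := (h.disc f hf).1.eq_of_meet (h.disc g hg).1
    ((h.disc f hf).2.2.mono_right (h.disc g hg).2.1.subset)
    ((h.disc g hg).2.2.mono_right (h.disc f hf).2.1.subset) ⟨x, hx, hx'⟩
  exact Prod.ext h1 h2

lemma mem_nhds_avoid (h : CellSystem D V 𝒜 𝓕) (ha : a ∈ 𝒜) {z : X} (hz : z ∈ a \ V) :
    (V ∪ ⋃₀ (𝒜 \ {a}))ᶜ ∈ 𝓝 z := by
  refine IsOpen.mem_nhds (h.graph.finV.isClosed.union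
    (h.graph.isClosed_of_isUnionOf (isUnionOf_of_subset sdiff_subset))).isOpen_compl ?_
  rintro (hzV | ⟨b, hb, hzb⟩)
  · exact hz.2 hzV
  · exact hz.2 (h.graph.inter b hb.1 a ha hb.2 ⟨hzb, hz.1⟩)

omit [T2Space X] in
lemma mem_face (h : CellSystem D V 𝒜 𝓕) {x : X} (hx : x ∉ ⋃₀ 𝒜) : ∃ f ∈ 𝓕, x ∈ f.1 := by
  have : x ∈ ⋃₀ 𝒜 ∪ ⋃ f ∈ 𝓕, f.1 := h.cover ▸ mem_univ x
  simpa using this.resolve_left hx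

lemma exists_face (h : CellSystem D V 𝒜 𝓕) (ha : a ∈ 𝒜) : ∃ f ∈ 𝓕, a ⊆ f.2 := by
  obtain ⟨z, hz⟩ := (h.graph.edge_diff ha).2
  have hcl := (h.graph.flat a ha z hz).1
  have h1 : z ∈ closure (⋃ f ∈ 𝓕, f.1) := by
    rw [mem_closure_iff_nhds] at hcl ⊢
    intro W hW
    obtain ⟨w, ⟨hwW, hw⟩, hwa⟩ := hcl _ (Filter.inter_mem hW (h.mem_nhds_avoid ha hz))
    refine ⟨w, hwW, ?_⟩
    obtain ⟨f, hf, hwf⟩ := h.mem_face (x := w) (by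
      rintro ⟨b, hb, hwb⟩
      exact hw (Or.inr ⟨b, ⟨hb, fun hba => hwa (hba ▸ hwb)⟩, hwb⟩))
    simp only [mem_iUnion]
    exact ⟨f, hf, hwf⟩
  rw [h.fin.closure_biUnion] at h1
  simp only [mem_iUnion] at h1
  obtain ⟨f, hf, hzf⟩ := h1
  rw [(h.disc f hf).1.closure_eq] at hzf
  exact ⟨f, hf, h.graph.subset_of_mem (h.disc f hf).2.1 ha hz.1
    (hzf.resolve_left (h.notMem_of_mem hf ⟨a, ha, hz.1⟩)) hz.2⟩

lemma exists_sides (h : CellSystem D V 𝒜 𝓕) (ha : a ∈ 𝒜) {z : X} (hz : z ∈ a \ V) :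
    ∃ P₁ P₂ : Set X, (z ∈ D → P₁ = P₂) ∧
      (∀ f ∈ 𝓕, a ⊆ f.2 → (P₁.Nonempty ∧ P₁ ⊆ f.1) ∨ (P₂.Nonempty ∧ P₂ ⊆ f.1)) := by
  obtain ⟨B, hB, hBW, P₁, P₂, hP₁, hP₂, hBP, hD⟩ :=
    (h.graph.flat a ha z hz).2 _ (h.mem_nhds_avoid ha hz)
  have hout : ∀ x ∈ B \ a, x ∉ ⋃₀ 𝒜 := by
    rintro x hx ⟨b, hb, hxb⟩
    exact hBW hx.1 (Or.inr ⟨b, ⟨hb, fun hba => hx.2 (hba ▸ hxb)⟩, hxb⟩)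
  have hside : ∀ P ⊆ B \ a, IsPreconnected P → ∀ f ∈ 𝓕, (P ∩ f.1).Nonempty →
      P.Nonempty ∧ P ⊆ f.1 := fun P hPB hP f hf hm =>
    ⟨hm.mono inter_subset_left, (h.disc f hf).1.subset_of_meet hP
      (disjoint_left.2 fun x hx hx' => hout x (hPB hx) ((h.disc f hf).2.1.subset hx')) hm⟩
  refine ⟨P₁, P₂, hD, fun f hf haf => ?_⟩
  obtain ⟨w, hwB, hwf⟩ :=
    mem_closure_iff_nhds.1 ((h.disc f hf).1.subset_closure (haf hz.1)) B hB
  have hwa : w ∉ a := fun hwa => h.notMem_of_mem hf ⟨a, ha, hwa⟩ hwf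
  rcases hBP.subset ⟨hwB, hwa⟩ with hw | hw
  · exact Or.inl (hside P₁ (hBP ▸ subset_union_left) hP₁ f hf ⟨w, hw, hwf⟩)
  · exact Or.inr (hside P₂ (hBP ▸ subset_union_right) hP₂ f hf ⟨w, hw, hwf⟩)

lemma eq_of_subset_subset (h : CellSystem D V 𝒜 𝓕) {P : Set X} (hf : f ∈ 𝓕) (hg : g ∈ 𝓕)
    (hPf : P.Nonempty ∧ P ⊆ f.1) (hPg : P.Nonempty ∧ P ⊆ g.1) : f = g := by
  obtain ⟨x, hx⟩ := hPf.1
  exact h.eq_of_meet hf hg (hPf.2 hx) (hPg.2 hx)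

lemma face_unique (h : CellSystem D V 𝒜 𝓕) (ha : a ∈ 𝒜) (haD : ((a \ V) ∩ D).Nonempty)
    (hf : f ∈ 𝓕) (hg : g ∈ 𝓕) (haf : a ⊆ f.2) (hag : a ⊆ g.2) : f = g := by
  obtain ⟨z, hz, hzD⟩ := haD
  obtain ⟨P₁, P₂, hP, hside⟩ := h.exists_sides ha hz
  obtain rfl := hP hzD
  exact h.eq_of_subset_subset hf hg (or_self_iff.1 (hside f hf haf)) (or_self_iff.1 (hside g hg hag))

lemma face_eq_or_eq (h : CellSystem D V 𝒜 𝓕) (ha : a ∈ 𝒜) {k : Set X × Set X} (hf : f ∈ 𝓕)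
    (hg : g ∈ 𝓕) (hk : k ∈ 𝓕) (haf : a ⊆ f.2) (hag : a ⊆ g.2) (hak : a ⊆ k.2) (hfg : f ≠ g) :
    k = f ∨ k = g := by
  obtain ⟨z, hz⟩ := (h.graph.edge_diff ha).2
  obtain ⟨P₁, P₂, -, hside⟩ := h.exists_sides ha hz
  rcases hside f hf haf with h1 | h1 <;> rcases hside g hg hag with h2 | h2 <;>
    rcases hside k hk hak with h3 | h3
  all_goals first
    | exact absurd (h.eq_of_subset_subset hf hg h1 h2) hfg
    | exact Or.inl (h.eq_of_subset_subset hk hf h3 h1)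
    | exact Or.inr (h.eq_of_subset_subset hk hg h3 h2)

lemma exists_common_edge [PreconnectedSpace X] (hX : PuncturedConnected X)
    (h : CellSystem D V 𝒜 𝓕) (hR : 𝓡 ⊆ 𝓕) (hne : 𝓡.Nonempty) (hne' : (𝓕 \ 𝓡).Nonempty) :
    ∃ a ∈ 𝒜, ∃ f ∈ 𝓡, ∃ g ∈ 𝓕 \ 𝓡, a ⊆ f.2 ∧ a ⊆ g.2 := by
  have hcl : ∀ 𝓢 ⊆ 𝓕, IsClosed (⋃ f ∈ 𝓢, f.1 ∪ f.2) := fun 𝓢 h𝓢 =>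
    (h.fin.subset h𝓢).isClosed_biUnion fun f hf => (h.disc f (h𝓢 hf)).1.isCompact.isClosed
  have hmeet : ∀ 𝓢 ⊆ 𝓕, 𝓢.Nonempty → (Vᶜ ∩ ⋃ f ∈ 𝓢, f.1 ∪ f.2).Nonempty := by
    rintro 𝓢 h𝓢 ⟨f, hf⟩
    obtain ⟨x, hx⟩ := (h.disc f (h𝓢 hf)).1.nonempty
    refine ⟨x, fun hxV => h.notMem_of_mem (h𝓢 hf) (h.sub hxV) hx, ?_⟩
    simp only [mem_iUnion]
    exact ⟨f, hf, Or.inl hx⟩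
  have hsub : Vᶜ ⊆ (⋃ f ∈ 𝓡, f.1 ∪ f.2) ∪ ⋃ f ∈ 𝓕 \ 𝓡, f.1 ∪ f.2 := by
    intro x _
    obtain ⟨f, hf, hxf⟩ : ∃ f ∈ 𝓕, x ∈ f.1 ∪ f.2 := by
      by_cases hxA : x ∈ ⋃₀ 𝒜
      · obtain ⟨a, ha, hxa⟩ := hxA
        obtain ⟨f, hf, haf⟩ := h.exists_face ha
        exact ⟨f, hf, Or.inr (haf hxa)⟩
      · obtain ⟨f, hf, hxf⟩ := h.mem_face hxA
        exact ⟨f, hf, Or.inl hxf⟩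
    by_cases hfR : f ∈ 𝓡
    · left; simp only [mem_iUnion]; exact ⟨f, hfR, hxf⟩
    · right; simp only [mem_iUnion]; exact ⟨f, ⟨hf, hfR⟩, hxf⟩
  obtain ⟨x, hxV, hx1, hx2⟩ := isPreconnected_closed_iff.1 (hX.isPreconnected_compl h.graph.finV)
    _ _ (hcl 𝓡 hR) (hcl (𝓕 \ 𝓡) sdiff_subset) hsub (hmeet 𝓡 hR hne) (hmeet _ sdiff_subset hne')
  simp only [mem_iUnion] at hx1 hx2
  obtain ⟨f, hf, hxf⟩ := hx1
  obtain ⟨g, hg, hxg⟩ := hx2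
  have hgu := (h.disc g hg.1).2.1
  have hfu := (h.disc f (hR hf)).2.1
  have hxf2 : x ∈ f.2 := by
    refine hxf.resolve_left fun hx => ?_
    rcases hxg with hxg | hxg
    · exact hg.2 (h.eq_of_meet (hR hf) hg.1 hx hxg ▸ hf)
    · exact h.notMem_of_mem (hR hf) (hgu.subset hxg) hx
  have hxg2 : x ∈ g.2 := hxg.resolve_left (h.notMem_of_mem hg.1 (hfu.subset hxf2))
  obtain ⟨a, ha, hxa⟩ := hfu.subset hxf2
  exact ⟨a, ha, f, hf, g, hg, h.graph.subset_of_mem hfu ha hxa hxf2 hxV,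
    h.graph.subset_of_mem hgu ha hxa hxg2 hxV⟩

/-- The closed set that remains when only the edges in `𝓑` and the faces in `𝓡` are kept. -/
def body (V : Set X) (𝓑 : Set (Set X)) (𝓡 : Set (Set X × Set X)) : Set X :=
  (V ∪ ⋃₀ 𝓑) ∪ ⋃ f ∈ 𝓡, f.1 ∪ f.2

omit [T2Space X] in
lemma boundary_subset (h : CellSystem D V 𝒜 𝓕) (hf : f ∈ 𝓕) (hB : ∀ a ∈ 𝒜 \ 𝓑, ¬ a ⊆ f.2) :
    f.2 ⊆ ⋃₀ 𝓑 := by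
  obtain ⟨𝓒, h𝓒, h𝓒f⟩ := (h.disc f hf).2.1
  rw [← h𝓒f]
  exact sUnion_subset_sUnion fun b hb => by_contra fun hbB =>
    hB b ⟨h𝓒 hb, hbB⟩ (h𝓒f ▸ subset_sUnion_of_mem hb)

lemma isClosed_body (h : CellSystem D V 𝒜 𝓕) (hB : 𝓑 ⊆ 𝒜) (hR : 𝓡 ⊆ 𝓕) :
    IsClosed (body V 𝓑 𝓡) :=
  (h.graph.finV.isClosed.union (h.graph.isClosed_of_isUnionOf (isUnionOf_of_subset hB))).union
    ((h.fin.subset hR).isClosed_biUnion fun f hf => (h.disc f (hR hf)).1.isCompact.isClosed)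

/-- Collapse of a face through a free edge. -/
lemma sdr_collapse (h : CellSystem D V 𝒜 𝓕) (hB : 𝓑 ⊆ 𝒜) (hR : 𝓡 ⊆ 𝓕)
    (hRB : ∀ f ∈ 𝓡, ∀ a ∈ 𝒜 \ 𝓑, ¬ a ⊆ f.2) (hf : f ∈ 𝓡) (ha : a ∈ 𝓑) (haf : a ⊆ f.2)
    (hu : ∀ g ∈ 𝓡, a ⊆ g.2 → g = f) :
    SDR (body V 𝓑 𝓡) (body V (𝓑 \ {a}) (𝓡 \ {f})) ∧
      body V (𝓑 \ {a}) (𝓡 \ {f}) ⊆ body V 𝓑 𝓡 := by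
  have hfd := (h.disc f (hR hf)).1
  have hfu := (h.disc f (hR hf)).2.1
  obtain ⟨x, y, hxy, hav⟩ := h.graph.arc a (hB ha)
  obtain ⟨A, hJ⟩ : ∃ A, JSplit f.2 x y a A := by
    obtain ⟨b₁, b₂, hb⟩ := hfd.isJordan.split (haf hxy.left_mem) (haf hxy.right_mem) hxy.ne
    rcases hb.arc_eq hxy haf with rfl | rfl
    exacts [⟨_, hb⟩, ⟨_, hb.swap⟩]
  have hAf : A ⊆ f.2 := hJ.2.2.2 ▸ subset_union_right
  have hRf : ∀ g ∈ 𝓡 \ {f}, ∀ p ∈ f.2, p ∈ g.1 ∪ g.2 → p ∈ g.2 := fun g hg p hp hpg =>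
    hpg.resolve_left (h.notMem_of_mem (hR hg.1) (hfu.subset hp))
  have hsub : body V (𝓑 \ {a}) (𝓡 \ {f}) ⊆ body V 𝓑 𝓡 :=
    union_subset_union (union_subset_union_right _ (sUnion_subset_sUnion sdiff_subset))
      (biUnion_subset_biUnion_left sdiff_subset)
  have hinner : (f.1 ∪ f.2) ∩ body V (𝓑 \ {a}) (𝓡 \ {f}) = A := by
    apply Subset.antisymm
    · rintro p ⟨hpf, hp⟩
      have hpf2 : p ∈ f.2 := by
        refine hpf.resolve_left fun hpf => ?_
        rcases hp with (hp | ⟨b, hb, hpb⟩) | hp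
        · exact h.notMem_of_mem (hR hf) (h.sub hp) hpf
        · exact h.notMem_of_mem (hR hf) ⟨b, hB hb.1, hpb⟩ hpf
        · simp only [mem_iUnion] at hp
          obtain ⟨g, hg, hp | hp⟩ := hp
          · exact hg.2 (h.eq_of_meet (hR hg.1) (hR hf) hp hpf)
          · exact h.notMem_of_mem (hR hf) ((h.disc g (hR hg.1)).2.1.subset hp) hpf
      by_contra hpA
      have hpa : p ∈ a := (hJ.2.2.2.symm ▸ hpf2 : p ∈ a ∪ A).resolve_right hpA
      have hpV : p ∉ V := fun hpV => hpA (hJ.2.1.ends_subset (hav ▸ ⟨hpa, hpV⟩))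
      rcases hp with (hp | ⟨b, hb, hpb⟩) | hp
      · exact hpV hp
      · exact hpV (h.graph.inter b (hB hb.1) a (hB ha) hb.2 ⟨hpb, hpa⟩)
      · simp only [mem_iUnion] at hp
        obtain ⟨g, hg, hpg⟩ := hp
        exact hg.2 (hu g hg.1 (h.graph.subset_of_mem (h.disc g (hR hg.1)).2.1 (hB ha) hpa
          (hRf g hg p hpf2 hpg) hpV))
    · intro p hp
      refine ⟨Or.inr (hAf hp), Or.inl ?_⟩
      obtain ⟨b, hb, hpb⟩ := h.boundary_subset (hR hf) (hRB f hf) (hAf hp)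
      by_cases hba : b = a
      · subst hba
        have : p ∈ b ∩ A := ⟨hpb, hp⟩
        rw [hJ.2.2.1, ← hav] at this
        exact Or.inl this.2
      · exact Or.inr ⟨b, ⟨hb, hba⟩, hpb⟩
  have hun : (f.1 ∪ f.2) ∪ body V (𝓑 \ {a}) (𝓡 \ {f}) = body V 𝓑 𝓡 := by
    apply Subset.antisymm
    · refine union_subset (fun p hp => Or.inr ?_) hsub
      simp only [mem_iUnion]
      exact ⟨f, hf, hp⟩
    · rintro p ((hp | ⟨b, hb, hpb⟩) | hp)
      · exact Or.inr (Or.inl (Or.inl hp))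
      · by_cases hba : b = a
        · exact Or.inl (Or.inr (haf (hba ▸ hpb)))
        · exact Or.inr (Or.inl (Or.inr ⟨b, ⟨hb, hba⟩, hpb⟩))
      · simp only [mem_iUnion] at hp
        obtain ⟨g, hg, hpg⟩ := hp
        by_cases hgf : g = f
        · exact Or.inl (hgf ▸ hpg)
        · refine Or.inr (Or.inr ?_)
          simp only [mem_iUnion]
          exact ⟨g, ⟨hg, hgf⟩, hpg⟩
  refine ⟨?_, hsub⟩
  rw [← hun]
  exact SDR.glue hfd.isCompact.isClosed
    (h.isClosed_body (sdiff_subset.trans hB) (sdiff_subset.trans hR))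
    (hfd.exists_sdr hJ.2.1 hAf) hinner

lemma exists_free_edge [PreconnectedSpace X] (hX : PuncturedConnected X)
    (h : CellSystem D V 𝒜 𝓕) (hK : K ⊆ D) {a₀ : Set X} (ha₀ : a₀ ∈ 𝒜)
    (ha₀D : ((a₀ \ V) ∩ D).Nonempty) (ha₀K : Disjoint a₀ K) (hR : 𝓡 ⊆ 𝓕) (hne : 𝓡.Nonempty) :
    ∃ f ∈ 𝓡, ∃ a ∈ 𝒜, a ⊆ f.2 ∧ (∀ g ∈ 𝓡, a ⊆ g.2 → g = f) ∧ Disjoint (a \ V) K := by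
  rcases (𝓕 \ 𝓡).eq_empty_or_nonempty with he | hne'
  · obtain ⟨f, hf, haf⟩ := h.exists_face ha₀
    exact ⟨f, sdiff_eq_empty.1 he hf, a₀, ha₀, haf,
      fun g hg hag => h.face_unique ha₀ ha₀D (hR hg) hf hag haf, ha₀K.mono_left sdiff_subset⟩
  · obtain ⟨a, ha, f, hf, g, hg, haf, hag⟩ := h.exists_common_edge hX hR hne hne'
    have hfg : f ≠ g := fun hfg => hg.2 (hfg ▸ hf)
    refine ⟨f, hf, a, ha, haf, fun k hk hak => ?_, ?_⟩
    · exact (h.face_eq_or_eq ha (hR hf) hg.1 (hR hk) haf hag hak hfg).resolve_right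
        fun hkg => hg.2 (hkg ▸ hk)
    · exact disjoint_left.2 fun z hz hzK =>
        hfg (h.face_unique ha ⟨z, hz, hK hzK⟩ (hR hf) hg.1 haf hag)

lemma exists_collapse_aux [PreconnectedSpace X] (hX : PuncturedConnected X)
    (h : CellSystem D V 𝒜 𝓕) (hK : K ⊆ D) {a₀ : Set X} (ha₀ : a₀ ∈ 𝒜)
    (ha₀D : ((a₀ \ V) ∩ D).Nonempty) (ha₀K : Disjoint a₀ K) (n : ℕ) :
    ∀ 𝓑 𝓡, 𝓡.ncard = n → 𝓑 ⊆ 𝒜 → 𝓡 ⊆ 𝓕 → (∀ f ∈ 𝓡, ∀ a ∈ 𝒜 \ 𝓑, ¬ a ⊆ f.2) →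
      (∀ a ∈ 𝒜 \ 𝓑, Disjoint (a \ V) K) → SDR univ (body V 𝓑 𝓡) →
      ∃ 𝓑' ⊆ 𝒜, (∀ a ∈ 𝒜 \ 𝓑', Disjoint (a \ V) K) ∧ SDR univ (V ∪ ⋃₀ 𝓑') := by
  induction n using Nat.strong_induction_on with
  | _ n ih =>
  intro 𝓑 𝓡 hn hB hR hRB hBK hs
  rcases 𝓡.eq_empty_or_nonempty with rfl | hne
  · exact ⟨𝓑, hB, hBK, by simpa [body] using hs⟩
  obtain ⟨f, hf, a, ha, haf, hu, haK⟩ := h.exists_free_edge hX hK ha₀ ha₀D ha₀K hR hne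
  have haB : a ∈ 𝓑 := by_contra fun haB => hRB f hf a ⟨ha, haB⟩ haf
  obtain ⟨hs', hsub⟩ := h.sdr_collapse hB hR hRB hf haB haf hu
  have hcase : ∀ b ∈ 𝒜 \ (𝓑 \ {a}), b ∈ 𝒜 \ 𝓑 ∨ b = a := fun b hb => by
    by_cases hba : b = a
    · exact Or.inr hba
    · exact Or.inl ⟨hb.1, fun hbB => hb.2 ⟨hbB, hba⟩⟩
  refine ih _ ?_ (𝓑 \ {a}) (𝓡 \ {f}) rfl (sdiff_subset.trans hB) (sdiff_subset.trans hR) ?_ ?_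
    (hs.trans isClosed_univ (subset_univ _) hsub hs')
  · rw [← hn]
    exact ncard_sdiff_singleton_lt_of_mem hf (h.fin.subset hR)
  · intro g hg b hb hbg
    rcases hcase b hb with hb | rfl
    · exact hRB g hg.1 b hb hbg
    · exact hg.2 (hu g hg.1 hbg)
  · intro b hb
    rcases hcase b hb with hb | rfl
    · exact hBK b hb
    · exact haK

lemma exists_collapse [PreconnectedSpace X] (hX : PuncturedConnected X)
    (h : CellSystem D V 𝒜 𝓕) (hK : K ⊆ D) {a₀ : Set X} (ha₀ : a₀ ∈ 𝒜)
    (ha₀D : ((a₀ \ V) ∩ D).Nonempty) (ha₀K : Disjoint a₀ K) :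
    ∃ 𝓑, GraphFam D V 𝓑 ∧ K ⊆ V ∪ ⋃₀ 𝓑 ∧ SDR univ (V ∪ ⋃₀ 𝓑) := by
  obtain ⟨𝓑, hB, hBK, hs⟩ := h.exists_collapse_aux hX hK ha₀ ha₀D ha₀K _ 𝒜 𝓕 rfl Subset.rfl
    Subset.rfl (fun f _ a ha => absurd ha.1 ha.2) (fun a ha => absurd ha.1 ha.2) (by
      have : body V 𝒜 𝓕 = univ := by
        refine eq_univ_of_univ_subset ?_
        rw [← h.cover]
        exact union_subset_union subset_union_right
          (iUnion₂_mono fun f _ => subset_union_left)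
      rw [this]
      exact SDR.refl _)
  refine ⟨𝓑, h.graph.mono hB, fun p hp => ?_, hs⟩
  obtain ⟨a, ha, hpa⟩ := h.boundary (hK hp)
  by_cases haB : a ∈ 𝓑
  · exact Or.inr ⟨a, haB, hpa⟩
  · exact Or.inl (by_contra fun hpV => disjoint_left.1 (hBK a ⟨ha, haB⟩) ⟨hpa, hpV⟩ hp)

end CellSystem

section Graph

variable {X : Type*} [TopologicalSpace X] [T2Space X] {D V : Set X} {𝓑 : Set (Set X)}

omit [T2Space X] in
lemma GraphFam.exists_param (h : GraphFam D V 𝓑) {a : Set X} (ha : a ∈ 𝓑) :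
    ∃ e : C(I, ↥(V ∪ ⋃₀ 𝓑)), Function.Injective e ∧ (∀ z : ↥(V ∪ ⋃₀ 𝓑), (z : X) ∈ a ↔ z ∈ range e) ∧
      ∀ t, (e t : X) ∈ V ↔ t = 0 ∨ t = 1 := by
  obtain ⟨x, y, ⟨f, hf, hi, hfa, h0, h1⟩, hav⟩ := h.arc a ha
  have hmem : ∀ t : I, f t ∈ a := fun t => hfa ▸ mem_image_of_mem f t.2
  have hinj : Function.Injective fun t : I => f t := fun s t hst => Subtype.ext (hi s.2 t.2 hst)
  refine ⟨⟨fun t => ⟨f t, Or.inr ⟨a, ha, hmem t⟩⟩, (continuousOn_iff_continuous_domRestrict.1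
    hf).subtype_mk _⟩, fun s t hst => hinj (congrArg Subtype.val hst), fun z => ⟨fun hz => ?_, ?_⟩,
    fun t => ?_⟩
  · obtain ⟨t, ht, htz⟩ := (hfa.symm ▸ hz : (z : X) ∈ f '' Icc 0 1)
    exact ⟨⟨t, ht⟩, Subtype.ext htz⟩
  · rintro ⟨t, rfl⟩
    exact hmem t
  · have h2 : f t ∈ V ↔ f t ∈ ({x, y} : Set X) := by
      rw [← hav]; exact ⟨fun hV => ⟨hmem t, hV⟩, fun h => h.2⟩
    show f t ∈ V ↔ _
    rw [h2, mem_insert_iff, mem_singleton_iff, ← h0, ← h1]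
    exact or_congr (hinj.eq_iff (a := t) (b := 0)) (hinj.eq_iff (a := t) (b := 1))

lemma GraphFam.isFiniteGraph (h : GraphFam D V 𝓑) (hc : IsConnected (V ∪ ⋃₀ 𝓑)) :
    IsFiniteGraph ↥(V ∪ ⋃₀ 𝓑) := by
  have : ConnectedSpace ↥(V ∪ ⋃₀ 𝓑) := isConnected_iff_connectedSpace.1 hc
  have hcomp : IsCompact (V ∪ ⋃₀ 𝓑) := h.finV.isCompact.union
    (h.finA.isCompact_sUnion fun a ha => by
      obtain ⟨x, y, hxy, -⟩ := h.arc a ha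
      exact hxy.isCompact)
  have : Nonempty C(I, ↥(V ∪ ⋃₀ 𝓑)) := ⟨ContinuousMap.const _ (Classical.arbitrary _)⟩
  choose! e he hr hV using fun a (ha : a ∈ 𝓑) => h.exists_param ha
  have hfin : (e '' 𝓑).Finite := h.finA.image e
  have hVc : IsClosed ((↑) ⁻¹' V : Set ↥(V ∪ ⋃₀ 𝓑)) :=
    h.finV.isClosed.preimage continuous_subtype_val
  have hVf : ((↑) ⁻¹' V : Set ↥(V ∪ ⋃₀ 𝓑)).Finite :=
    h.finV.preimage Subtype.val_injective.injOn
  have hcl : ∀ a ∈ 𝓑, IsClosedEmbedding (e a) := fun a ha =>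
    (e a).continuous.isClosedEmbedding (he a ha)
  have hinner : ∀ a ∈ 𝓑, ∀ t ∈ edgeInt, (e a t : X) ∉ V := by
    intro a ha t ht htV
    rcases (hV a ha t).1 htV with rfl | rfl
    · exact absurd ht.1 (by simp)
    · exact absurd ht.2 (by simp)
  refine ⟨⟨inferInstance, inferInstance, (↑) ⁻¹' V, e '' 𝓑, hVc, ?_, ?_, ?_, ?_, ?_, ?_, ?_, ?_,
    ?_⟩, isCompact_iff_compactSpace.1 hcomp⟩
  · have := hVf.to_subtype
    infer_instance
  · rintro _ ⟨a, ha, rfl⟩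
    exact ⟨(hV a ha 0).2 (Or.inl rfl), (hV a ha 1).2 (Or.inr rfl)⟩
  · rintro _ ⟨a, ha, rfl⟩
    exact (hcl a ha).isEmbedding.comp IsEmbedding.subtypeVal
  · rintro _ ⟨a, ha, rfl⟩
    refine disjoint_iff_inter_eq_empty.1 (disjoint_left.2 ?_)
    rintro _ ⟨t, ht, rfl⟩ htV
    exact hinner a ha t ht htV
  · rintro _ ⟨a, ha, rfl⟩ _ ⟨b, hb, rfl⟩ hab
    refine disjoint_iff_inter_eq_empty.1 (disjoint_left.2 ?_)
    rintro _ ⟨t, ht, rfl⟩ ⟨s, hs, hst⟩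
    have hne : a ≠ b := fun h => hab (h ▸ rfl)
    exact hinner a ha t ht (h.inter a ha b hb hne ⟨(hr a ha _).2 ⟨t, rfl⟩, (hr b hb _).2 ⟨s, hst⟩⟩)
  · refine eq_univ_of_forall fun x => ?_
    by_cases hx : (x : X) ∈ V
    · exact Or.inl hx
    obtain ⟨a, ha, hxa⟩ := x.2.resolve_left hx
    obtain ⟨t, rfl⟩ := (hr a ha x).1 hxa
    rw [hV a ha, not_or] at hx
    refine Or.inr (mem_biUnion (mem_image_of_mem e ha) ⟨t, ⟨?_, ?_⟩, rfl⟩)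
    · exact lt_of_le_of_ne t.2.1 fun h => hx.1 (Subtype.ext h.symm)
    · exact lt_of_le_of_ne t.2.2 fun h => hx.2 (Subtype.ext h)
  · exact fun x => ⟨univ, isOpen_univ, trivial, hfin.subset fun e he => he.1⟩
  · intro A hA
    rw [inter_iUnion₂]
    refine hfin.isClosed_biUnion ?_
    rintro _ ⟨a, ha, rfl⟩
    rw [← image_preimage_eq_inter_range]
    exact (hcl a ha).isClosedMap _ (hA _ (mem_image_of_mem e ha))
  · intro v hv
    by_contra hcon
    push Not at hcon
    obtain ⟨hv1, hv2⟩ := hcon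
    refine hv2 (IsClopen.eq_univ ⟨isClosed_singleton, ?_⟩ (singleton_nonempty v)).symm
    have hcompl : ({v} : Set ↥(V ∪ ⋃₀ 𝓑)) =
        (((↑) ⁻¹' V \ {v}) ∪ ⋃ c ∈ e '' 𝓑, range c)ᶜ := by
      ext x
      simp only [mem_singleton_iff, mem_compl_iff]
      constructor
      · rintro rfl (hx | hx)
        · exact hx.2 rfl
        · obtain ⟨c, hc, hx⟩ := mem_iUnion₂.1 hx
          exact hv1 c hc hx
      · intro hx
        by_contra hxv
        by_cases hxV : (x : X) ∈ V
        · exact hx (Or.inl ⟨hxV, hxv⟩)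
        · obtain ⟨a, ha, hxa⟩ := x.2.resolve_left hxV
          exact hx (Or.inr (mem_biUnion (mem_image_of_mem e ha) ((hr a ha x).1 hxa)))
    rw [hcompl]
    refine (hVf.sdiff.isClosed.union (hfin.isClosed_biUnion ?_)).isOpen_compl
    rintro _ ⟨a, ha, rfl⟩
    exact (hcl a ha).isClosed_range

end Graph

lemma exists_spine {X : Type*} [MetricSpace X] [CompactSpace X] [ConnectedSpace X]
    {D K : Set X} (hD : IsClosed D) (hK : IsClosed K) (hKD : K ⊂ D)
    (hch : ∀ x : X, ∃ (φ : ℂ → X) (H : Set ℂ), IsChart D φ H ∧ φ 0 = x) :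
    ∃ (G : Set X) (H : X × I → X), IsFiniteGraph ↥G ∧ IsDeformationRetraction H G ∧
      ∀ x ∈ K, ∀ t : I, H (x, t) = x := by
  obtain ⟨V, 𝒜, 𝓓, h, a, ha, haD, haK⟩ := exists_discSystem_free hD hK hKD hch
  obtain ⟨𝓕, hF⟩ := h.exists_cellSystem
  obtain ⟨𝓑, hB, hKB, H, hc, h0, -, h1, hf⟩ :=
    hF.exists_collapse (puncturedConnected hch) hKD.subset ha haD haK
  rw [univ_prod_univ, continuousOn_univ] at hc
  refine ⟨V ∪ ⋃₀ 𝓑, fun q => H q.2 q.1, hB.isFiniteGraph ?_, ⟨?_, fun x => ?_, fun x => ?_,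
    fun x hx => ?_⟩, fun x hx t => hf _ _ (hKB hx)⟩
  · have hG : V ∪ ⋃₀ 𝓑 = range (H 1) := Subset.antisymm (fun x hx => ⟨x, hf 1 x hx⟩)
      (range_subset_iff.2 fun x => h1 x trivial)
    rw [hG]
    exact isConnected_range (hc.comp (f := fun x => ((1 : ℝ), x)) (by fun_prop))
  · exact hc.comp (f := fun q : X × I => ((q.2 : ℝ), q.1)) (by fun_prop)
  · simpa using h0 x trivial
  · simpa using h1 x trivial
  · simpa using hf 1 x hx

end SurfaceSpine

/-- Let `S` be a compact surface with nonempty boundary and let `I₀ ⊊ ∂S`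
be a closed subset properly contained in the boundary. Then there exist a subspace `Γ ⊆ S`
that is a finite graph and a deformation retraction `H` of `S` onto `Γ` with
`H (x, t) = x` for all `x ∈ I₀` and all `t`. -/
theorem compact_surface_deformation_retraction_rel (S : Type*) [TopologicalSpace S]
    (hS : IsSurface S) [CompactSpace S] (hbd : (Bd S).Nonempty)
    (I₀ : Set S) (hI₀closed : IsClosed I₀) (hI₀ : I₀ ⊂ Bd S) :
    ∃ (G : Set S) (H : S × I → S), IsFiniteGraph ↥G ∧ IsDeformationRetraction H G ∧
      ∀ x ∈ I₀, ∀ t : I, H (x, t) = x := by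
  have := hS.connected
  have := hS.t2
  have := hS.secondCountable
  letI := TopologicalSpace.metrizableSpaceMetric S
  exact SurfaceSpine.exists_spine SurfaceSpine.isClosed_bd hI₀closed hI₀
    (SurfaceSpine.exists_isChart hS)
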